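/- Let S = R ∪ B be a bicolored point set in convex position with |R| = |B| = n ≥ 1, let r ∈ R and b ∈ B, and suppose (S, r, b) is a special configuration. Then every Hamiltonian alternating path on S with endpoints r and b has at least n − r(S) crossings; moreover, there exists a Hamiltonian alternating path on S with endpoints r and b having exactly n − r(S) crossings, and every optimum Hamiltonian alternating path on S with endpoints r and b has exactly n − r(S) crossings and all of its edges are crossed at most once, except for exactly one edge that is crossed exactly twice. -/

import Mathlib

open scoped Classical

noncomputable section

/-- Points of the plane. -/
abbrev Pt := ℝ × ℝ

/-- Orientation determinant of the ordered triple `(a, b, c)`. -/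
def det2 (a b c : Pt) : ℝ :=
  (b.1 - a.1) * (c.2 - a.2) - (b.2 - a.2) * (c.1 - a.1)

/-- Two closed segments cross: some point lies in the relative interior of both. -/
def SegCross (e f : Pt × Pt) : Prop :=
  ∃ x : Pt, x ∈ openSegment ℝ e.1 e.2 ∧ x ∈ openSegment ℝ f.1 f.2

/-- Number of crossings (unordered pairs of crossing edges) among a list of edges. -/
def crossNum (es : List (Pt × Pt)) : ℕ :=
  ((Finset.range es.length ×ˢ Finset.range es.length).filter
    (fun ij => ij.1 < ij.2 ∧
      SegCross (es.getD ij.1 ((0, 0), (0, 0))) (es.getD ij.2 ((0, 0), (0, 0))))).card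

/-- Number of other edges crossing the `i`-th edge of the list. -/
def edgeCrossCount (es : List (Pt × Pt)) (i : ℕ) : ℕ :=
  ((Finset.range es.length).filter (fun j => j ≠ i ∧
      SegCross (es.getD i ((0, 0), (0, 0))) (es.getD j ((0, 0), (0, 0))))).card

/-- Every edge is crossed by at most one other edge. -/
def OnePlane (es : List (Pt × Pt)) : Prop :=
  ∀ i ∈ Finset.range es.length, edgeCrossCount es i ≤ 1

/-- The edges of a path given by its list of vertices. -/
def pathEdges (l : List Pt) : List (Pt × Pt) := l.zip l.tail

/-- The edges of a cycle given by its list of vertices (including the wrap-around edge). -/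
def cycleEdges (l : List Pt) : List (Pt × Pt) := l.zip (l.rotate 1)

/-- An edge joining a point of `R` to a point of `B`. -/
def Bichromatic (R B : Finset Pt) (e : Pt × Pt) : Prop :=
  (e.1 ∈ R ∧ e.2 ∈ B) ∨ (e.1 ∈ B ∧ e.2 ∈ R)

/-- A Hamiltonian alternating path on the bicolored point set `R ∪ B`
with endpoints `p` and `q`. -/
structure HamAltPath (R B : Finset Pt) (p q : Pt) where
  verts : List Pt
  nodup : verts.Nodup
  cover : verts.toFinset = R ∪ B
  head_eq : verts.head? = some p
  last_eq : verts.getLast? = some q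
  alt : ∀ e ∈ pathEdges verts, Bichromatic R B e

/-- A Hamiltonian alternating cycle on the bicolored point set `R ∪ B`. -/
structure HamAltCycle (R B : Finset Pt) where
  verts : List Pt
  nodup : verts.Nodup
  cover : verts.toFinset = R ∪ B
  alt : ∀ e ∈ cycleEdges verts, Bichromatic R B e

/-- A Hamiltonian alternating path with prescribed endpoints is optimum if it has the
minimum number of crossings among all such paths. -/
def OptimumPath (R B : Finset Pt) (p q : Pt) (P : HamAltPath R B p q) : Prop :=
  ∀ Q : HamAltPath R B p q, crossNum (pathEdges P.verts) ≤ crossNum (pathEdges Q.verts)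

/-- No three points of `S` are collinear. -/
def GeneralPosition (S : Finset Pt) : Prop :=
  ∀ p ∈ S, ∀ q ∈ S, ∀ r ∈ S, p ≠ q → p ≠ r → q ≠ r → ¬ Collinear ℝ ({p, q, r} : Set Pt)

/-- Every point of `S` is a vertex (extreme point) of its convex hull. -/
def ConvexPosition (S : Finset Pt) : Prop :=
  ∀ p ∈ S, p ∉ convexHull ℝ ((S.erase p : Finset Pt) : Set Pt)

/-- The points of `S` lying on the boundary of the convex hull of `S`
(i.e. the extreme points of `S`). -/
def hullPts (S : Finset Pt) : Finset Pt :=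
  S.filter fun p => p ∉ convexHull ℝ ((S.erase p : Finset Pt) : Set Pt)

/-- Cyclic successor on `Fin m`. -/
def cycSucc {m : ℕ} (hm : 0 < m) (i : Fin m) : Fin m :=
  ⟨(i.val + 1) % m, Nat.mod_lt _ hm⟩

/-- Cyclic predecessor on `Fin m`. -/
def cycPred {m : ℕ} (hm : 0 < m) (i : Fin m) : Fin m :=
  ⟨(i.val + (m - 1)) % m, Nat.mod_lt _ hm⟩

/-- `pt` lists points in convex position, in clockwise circular order:
every index-increasing triple is clockwise oriented. -/
def CWList {m : ℕ} (pt : Fin m → Pt) : Prop :=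
  Function.Injective pt ∧
    ∀ i j k : Fin m, i < j → j < k → det2 (pt i) (pt j) (pt k) < 0

/-- `pt` is a clockwise listing of the points of `S` on the boundary of `CH(S)`. -/
def IsHullList (S : Finset Pt) {m : ℕ} (pt : Fin m → Pt) : Prop :=
  CWList pt ∧ Finset.univ.image pt = hullPts S

/-- The number of runs of color `A` (with other color `C`) in the cyclic sequence `pt`:
a run starts at an `A`-point whose cyclic predecessor is a `C`-point; a completely
`A`-colored cycle forms a single run. -/
def runCount {m : ℕ} (hm : 0 < m) (A C : Finset Pt) (pt : Fin m → Pt) : ℕ :=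
  if ∀ i : Fin m, pt i ∈ A then 1
  else (Finset.univ.filter fun i : Fin m => pt i ∈ A ∧ pt (cycPred hm i) ∈ C).card

/-- `q` is the counterclockwise radial order of the points of `T` around `r`. -/
def CCWOrder (r : Pt) {k : ℕ} (q : Fin k → Pt) (T : Finset Pt) : Prop :=
  Function.Injective q ∧ Finset.univ.image q = T ∧
    ∀ i j : Fin k, i < j → 0 < det2 r (q i) (q j)

/-- `q` is the clockwise radial order of the points of `T` around `r`. -/
def CWOrder (r : Pt) {k : ℕ} (q : Fin k → Pt) (T : Finset Pt) : Prop :=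
  Function.Injective q ∧ Finset.univ.image q = T ∧
    ∀ i j : Fin k, i < j → det2 r (q i) (q j) < 0

/-- Counting one extra point of color `A` (the center), the initial segment
`q 0, …, q j` contains equally many points of color `A` and of color `C`. -/
def BalancedAt (A C : Finset Pt) {k : ℕ} (q : Fin k → Pt) (j : Fin k) : Prop :=
  1 + (Finset.univ.filter fun i : Fin k => i ≤ j ∧ q i ∈ A).card
    = (Finset.univ.filter fun i : Fin k => i ≤ j ∧ q i ∈ C).card

/-- `j` is the first balanced index of the sequence `q`. -/
def FirstBalanced (A C : Finset Pt) {k : ℕ} (q : Fin k → Pt) (j : Fin k) : Prop :=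
  BalancedAt A C q j ∧ ∀ j' : Fin k, j' < j → ¬ BalancedAt A C q j'

/-- The triple `(R ∪ B, r, b)` is a special configuration (Definition 2.2):
(i) both neighbors of `r` on the hull boundary are red and both neighbors of `b` are
blue; (ii) in the counterclockwise and clockwise radial orders around `r`, the first
balanced point is `b`; (iii) symmetrically around `b`, the first balanced point is `r`. -/
def SpecialConfig (R B : Finset Pt) (r b : Pt) : Prop :=
  r ∈ hullPts (R ∪ B) ∧ b ∈ hullPts (R ∪ B) ∧
  (∀ (m : ℕ) (hm : 0 < m) (pt : Fin m → Pt), IsHullList (R ∪ B) pt →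
    ∀ i : Fin m,
      (pt i = r → pt (cycPred hm i) ∈ R ∧ pt (cycSucc hm i) ∈ R) ∧
      (pt i = b → pt (cycPred hm i) ∈ B ∧ pt (cycSucc hm i) ∈ B)) ∧
  (∀ (k : ℕ) (q : Fin k → Pt),
      (CCWOrder r q ((R ∪ B).erase r) ∨ CWOrder r q ((R ∪ B).erase r)) →
      ∀ j : Fin k, FirstBalanced R B q j → q j = b) ∧
  (∀ (k : ℕ) (q : Fin k → Pt),
      (CCWOrder b q ((R ∪ B).erase b) ∨ CWOrder b q ((R ∪ B).erase b)) →
      ∀ j : Fin k, FirstBalanced B R q j → q j = r)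

/-- The unordered pair `{a, b}` occurs as an edge of the list `es`. -/
def IsEdgeOf (es : List (Pt × Pt)) (a b : Pt) : Prop := (a, b) ∈ es ∨ (b, a) ∈ es

/-- The clockwise cyclic interval of indices from `a` to `b`, inclusive. -/
def cycIdx {m : ℕ} (hm : 0 < m) (a b : Fin m) : Finset (Fin m) :=
  (Finset.range ((b.val + m - a.val) % m + 1)).image
    fun t => (⟨(a.val + t) % m, Nat.mod_lt _ hm⟩ : Fin m)

/-- Chords `ab` and `cd` with endpoints among points in convex position listed by naturals cross. -/
def Cr (a b c d : ℕ) : Prop :=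
  (min a b < min c d ∧ min c d < max a b ∧ max a b < max c d) ∨
    (min c d < min a b ∧ min a b < max c d ∧ max c d < max a b)

/-- Indicator of `Cr`. -/
def ic (a b c d : ℕ) : ℕ := if Cr a b c d then 1 else 0

theorem cr_swap_or {x x1 y y1 z w : ℕ} (h : Cr x x1 y y1) 
    (h1 : Cr z w x y1 ) : Cr z w x x1 ∨ Cr z w y y1 := by
  unfold Cr at *
  omega

theorem cr_swap_and {x x1 y y1 z w : ℕ} (h : Cr x x1 y y1) 
    (h1 : Cr z w x y1 ) (h2 : Cr z w y x1) : Cr z w x x1 ∧ Cr z w y y1 := by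
  unfold Cr at *
  omega

/-- The orbit of `x` under the permutation `σ`. -/
def orb {N : ℕ} (σ : Equiv.Perm (Fin N)) (x : Fin N) : Finset (Fin N) :=
  Finset.univ.filter (fun y => σ.SameCycle x y)

theorem mem_orb {N : ℕ} {σ : Equiv.Perm (Fin N)} {x y : Fin N} :
    y ∈ orb σ x ↔ σ.SameCycle x y := by
  simp [orb]

theorem orb_eq_iff {N : ℕ} {σ : Equiv.Perm (Fin N)} {x y : Fin N} :
    orb σ x = orb σ y ↔ σ.SameCycle x y := by
  constructor
  · intro h
    have : y ∈ orb σ y := mem_orb.2 (Equiv.Perm.SameCycle.refl _ _)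
    rw [← h] at this
    exact mem_orb.1 this
  · intro h
    ext z
    rw [mem_orb, mem_orb]
    exact ⟨fun hz => h.symm.trans hz, fun hz => h.trans hz⟩

/-- The number of orbits of `σ`. -/
def orbNum {N : ℕ} (σ : Equiv.Perm (Fin N)) : ℕ := (Finset.univ.image (orb σ)).card

theorem sameCycle_induction {N : ℕ} {σ : Equiv.Perm (Fin N)} {P : Fin N → Prop} {a c : Fin N}
    (h : ∀ w, σ.SameCycle a w → P w → P (σ w)) (hac : σ.SameCycle a c) (ha : P a) : P c := by
  obtain ⟨i, -, rfl⟩ := hac.exists_pow_eq'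
  induction i with
  | zero => simpa using ha
  | succ i ih =>
    rw [pow_succ']
    exact h _ ⟨i, by simp⟩ (ih ⟨i, by simp⟩)

theorem sameCycle_of_agree {N : ℕ} {σ τ : Equiv.Perm (Fin N)} {a c : Fin N}
    (h : ∀ w, σ.SameCycle a w → τ w = σ w) (hac : σ.SameCycle a c) : τ.SameCycle a c := by
  refine sameCycle_induction (P := fun w => τ.SameCycle a w) ?_ hac (Equiv.Perm.SameCycle.refl _ _)
  intro w hw hw'
  rw [← h w hw]
  exact Equiv.Perm.sameCycle_apply_right.2 hw'

theorem orb_eq_of_agree {N : ℕ} {σ τ : Equiv.Perm (Fin N)} {a : Fin N}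
    (h : ∀ w, σ.SameCycle a w → τ w = σ w) : orb τ a = orb σ a := by
  have key : ∀ c, τ.SameCycle a c → σ.SameCycle a c := by
    intro c hc
    refine sameCycle_induction (P := fun w => σ.SameCycle a w) ?_ hc
      (Equiv.Perm.SameCycle.refl _ _)
    intro w _ hw'
    rw [h w hw']
    exact Equiv.Perm.sameCycle_apply_right.2 hw'
  ext c
  rw [mem_orb, mem_orb]
  exact ⟨key c, sameCycle_of_agree h⟩

theorem orbNum_mul_swap_le {N : ℕ} (σ : Equiv.Perm (Fin N)) (p t : Fin N) :
    orbNum (σ * Equiv.swap p t) ≤ orbNum σ + 1 := by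
  set τ := σ * Equiv.swap p t with hτ
  have hsub : Finset.univ.image (orb τ) ⊆
      insert (orb τ p) (insert (orb τ t) ((Finset.univ.image (orb σ)).erase (orb σ p))) := by
    intro O hO
    obtain ⟨x, -, rfl⟩ := Finset.mem_image.1 hO
    by_cases h1 : τ.SameCycle x p
    · rw [orb_eq_iff.2 h1]; simp
    by_cases h2 : τ.SameCycle x t
    · rw [orb_eq_iff.2 h2]; simp
    have hag : ∀ w, τ.SameCycle x w → σ w = τ w := by
      intro w hw
      have hp : w ≠ p := fun h => h1 (h ▸ hw)
      have ht : w ≠ t := fun h => h2 (h ▸ hw)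
      simp [hτ, Equiv.swap_apply_of_ne_of_ne hp ht]
    have he := orb_eq_of_agree hag
    have hne : orb σ x ≠ orb σ p := by
      intro h
      have : p ∈ orb σ x := by rw [h]; exact mem_orb.2 (Equiv.Perm.SameCycle.refl _ _)
      rw [he] at this
      exact h1 (mem_orb.1 this)
    rw [← he]
    simp [hne]
  have h1 := Finset.card_le_card hsub
  have h2 := Finset.card_insert_le (orb τ p)
    (insert (orb τ t) ((Finset.univ.image (orb σ)).erase (orb σ p)))
  have h3 := Finset.card_insert_le (orb τ t) ((Finset.univ.image (orb σ)).erase (orb σ p))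
  have h4 := Finset.card_erase_add_one (s := Finset.univ.image (orb σ)) (a := orb σ p) (by simp)
  unfold orbNum
  omega

/-- Indicator of a crossing between the edges leaving `x` and `y`, the edge leaving `b`
being disregarded. -/
def iot {N : ℕ} (b : Fin N) (σ : Equiv.Perm (Fin N)) (x y : Fin N) : ℕ :=
  if x ≠ b ∧ y ≠ b ∧ Cr x (σ x) y (σ y) then 1 else 0

/-- Twice the number of crossings. -/
def cr2 {N : ℕ} (b : Fin N) (σ : Equiv.Perm (Fin N)) : ℕ := ∑ x, ∑ y, iot b σ x y

theorem Cr.symm {a b c d : ℕ} (h : Cr a b c d) : Cr c d a b := by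
  unfold Cr at *; omega

theorem cr_comm {a b c d : ℕ} : Cr a b c d ↔ Cr c d a b := ⟨Cr.symm, Cr.symm⟩

theorem not_cr_self {a b : ℕ} : ¬ Cr a b a b := by
  unfold Cr; omega

theorem iot_comm {N : ℕ} (b : Fin N) (σ : Equiv.Perm (Fin N)) (x y : Fin N) :
    iot b σ x y = iot b σ y x := by
  unfold iot
  rw [cr_comm]
  congr 1
  simp only [eq_iff_iff]; tauto

theorem iot_self {N : ℕ} (b : Fin N) (σ : Equiv.Perm (Fin N)) (x : Fin N) :
    iot b σ x x = 0 := by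
  simp [iot, not_cr_self]

theorem sum_sum_eq {α : Type*} [Fintype α] (f : α → α → ℕ) (hs : ∀ x y, f x y = f y x)
    (h0 : ∀ x, f x x = 0) {p t : α} (hpt : p ≠ t) :
    ∑ x, ∑ y, f x y = ∑ x ∈ ({p, t} : Finset α)ᶜ, ∑ y ∈ ({p, t} : Finset α)ᶜ, f x y
      + 2 * ∑ x ∈ ({p, t} : Finset α)ᶜ, (f x p + f x t) + 2 * f p t := by
  have hsum : ∀ g : α → ℕ, ∑ x, g x = ∑ x ∈ ({p, t} : Finset α)ᶜ, g x + (g p + g t) := by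
    intro g
    rw [← Finset.sum_compl_add_sum ({p, t} : Finset α), Finset.sum_pair hpt]
  rw [hsum]
  simp_rw [hsum (f _)]
  rw [Finset.sum_add_distrib, h0, h0, hs t p]
  have : ∀ q, ∑ x ∈ ({p, t} : Finset α)ᶜ, f q x = ∑ x ∈ ({p, t} : Finset α)ᶜ, f x q :=
    fun q => Finset.sum_congr rfl fun x _ => hs _ _
  rw [this, this, Finset.sum_add_distrib]
  ring

theorem sum_sum_le {α : Type*} [Fintype α] (f g : α → α → ℕ) (hs : ∀ x y, f x y = f y x)
    (h0 : ∀ x, f x x = 0) (hs' : ∀ x y, g x y = g y x)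
    (h0' : ∀ x, g x x = 0) {p t : α} (hpt : p ≠ t)
    (heq : ∀ x y, x ≠ p → x ≠ t → y ≠ p → y ≠ t → g x y = f x y) (d : α → ℕ) (d0 : ℕ)
    (hd : ∀ z, z ≠ p → z ≠ t → g z p + g z t + d z ≤ f z p + f z t)
    (hd0 : g p t + d0 ≤ f p t) :
    ∑ x, ∑ y, g x y + 2 * (∑ z ∈ ({p, t} : Finset α)ᶜ, d z + d0) ≤ ∑ x, ∑ y, f x y := by
  rw [sum_sum_eq f hs h0 hpt, sum_sum_eq g hs' h0' hpt]
  have h1 : ∑ x ∈ ({p, t} : Finset α)ᶜ, ∑ y ∈ ({p, t} : Finset α)ᶜ, g x y =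
      ∑ x ∈ ({p, t} : Finset α)ᶜ, ∑ y ∈ ({p, t} : Finset α)ᶜ, f x y := by
    refine Finset.sum_congr rfl fun x hx => Finset.sum_congr rfl fun y hy => ?_
    simp at hx hy
    exact heq x y hx.1 hx.2 hy.1 hy.2
  have h2 : ∑ x ∈ ({p, t} : Finset α)ᶜ, (g x p + g x t) + ∑ z ∈ ({p, t} : Finset α)ᶜ, d z ≤
      ∑ x ∈ ({p, t} : Finset α)ᶜ, (f x p + f x t) := by
    rw [← Finset.sum_add_distrib]
    refine Finset.sum_le_sum fun x hx => ?_
    simp at hx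
    exact hd x hx.1 hx.2
  omega

/-- Crossing bookkeeping for exchanging the successors of `p` and `t`. -/
theorem cr2_mul_swap_le {N : ℕ} {b : Fin N} (σ : Equiv.Perm (Fin N)) {p t : Fin N} (hpt : p ≠ t)
    (D : Finset (Fin N)) (hDp : p ∉ D) (hDt : t ∉ D) (w d0 : ℕ)
    (hd : ∀ z, z ≠ p → z ≠ t →
      iot b (σ * Equiv.swap p t) z p + iot b (σ * Equiv.swap p t) z t + (if z ∈ D then w else 0)
        ≤ iot b σ z p + iot b σ z t)
    (hd0 : iot b (σ * Equiv.swap p t) p t + d0 ≤ iot b σ p t) :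
    cr2 b (σ * Equiv.swap p t) + 2 * (D.card * w + d0) ≤ cr2 b σ := by
  have := sum_sum_le (iot b σ) (iot b (σ * Equiv.swap p t)) (iot_comm _ _) (iot_self _ _)
    (iot_comm _ _) (iot_self _ _) hpt ?_ (fun z => if z ∈ D then w else 0) d0 hd hd0
  · rw [Finset.sum_ite_mem, Finset.sum_const, Finset.inter_eq_right.2] at this
    · simpa [cr2] using this
    · intro z hz
      simp only [Finset.mem_compl, Finset.mem_insert, Finset.mem_singleton, not_or]
      exact ⟨fun h => hDp (h ▸ hz), fun h => hDt (h ▸ hz)⟩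
  · intro x y h1 h2 h3 h4
    simp [iot, Equiv.swap_apply_of_ne_of_ne h1 h2, Equiv.swap_apply_of_ne_of_ne h3 h4]

/-- The number of colour changes in a list. -/
def chg : List Bool → ℕ
  | [] => 0
  | [_] => 0
  | x :: y :: l => (if x = y then 0 else 1) + chg (y :: l)

theorem chg_append_bounds (l l' : List Bool) :
    chg l + chg l' ≤ chg (l ++ l') ∧ chg (l ++ l') ≤ chg l + chg l' + 1 := by
  induction l with
  | nil => simp [chg]
  | cons x l ih =>
    cases l with
    | nil =>
      cases l' with
      | nil => simp [chg]
      | cons y l' => simp only [List.cons_append, List.nil_append, chg]; split_ifs <;> omega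
    | cons y l => simp only [List.cons_append, chg] at ih ⊢; omega

theorem chg_eq_length (l : List Bool) (h : l.IsChain (· ≠ ·)) : chg l + 1 = l.length ∨ l = [] := by
  induction l with
  | nil => simp
  | cons x l ih =>
    cases l with
    | nil => simp [chg]
    | cons y l =>
      rw [List.isChain_cons_cons] at h
      have := ih h.2
      simp only [chg, h.1, if_false, List.length_cons] at this ⊢
      simp at this; left; omega

/-- Colour changes of the cyclic sequence `l`. -/
def cchg (l : List Bool) : ℕ := chg (l ++ l.head?.toList)

theorem cchg_split (X J Y : List Bool) (hX : X ≠ []) :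
    cchg J + cchg (X ++ Y) ≤ cchg (X ++ J ++ Y) + 2 := by
  obtain ⟨x, X, rfl⟩ := List.exists_cons_of_ne_nil hX
  unfold cchg
  have h1 := chg_append_bounds J J.head?.toList
  have h2 : chg J.head?.toList = 0 := by cases J <;> simp [chg]
  have h3 := chg_append_bounds (x :: X) (Y ++ [x])
  have h4 := chg_append_bounds ((x :: X) ++ J) (Y ++ [x])
  have h5 := chg_append_bounds (x :: X) J
  simp only [List.cons_append, List.append_assoc, List.head?_cons, Option.toList_some] at *
  omega

theorem sort_split {N : ℕ} (I : Finset (Fin N)) (a c : Fin N) (hac : a ≤ c) :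
    ∃ X Y : List (Fin N), I.sort (· ≤ ·) = X ++ (I.filter (fun y => a ≤ y ∧ y ≤ c)).sort (· ≤ ·) ++ Y
      ∧ (I.filter (fun y => ¬ (a ≤ y ∧ y ≤ c))).sort (· ≤ ·) = X ++ Y ∧ (∀ x, x ∈ X ↔ x ∈ I ∧ x < a) := by
  refine ⟨(I.filter (fun y => y < a)).sort (· ≤ ·), (I.filter (fun y => c < y)).sort (· ≤ ·), ?_, ?_, ?_⟩
  · refine List.Perm.eq_of_pairwise (le := (· ≤ ·)) (fun _ _ _ _ h h' => le_antisymm h h')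
      (Finset.pairwise_sort _ _) ?_ ?_
    · simp only [List.pairwise_append, Finset.pairwise_sort, Finset.mem_sort, Finset.mem_filter,
        List.mem_append, true_and]
      grind
    · refine (List.perm_ext_iff_of_nodup (Finset.sort_nodup _ _) ?_).2 ?_
      · simp only [List.nodup_append, Finset.sort_nodup, Finset.mem_sort, Finset.mem_filter,
          List.mem_append, true_and]
        grind
      · simp only [Finset.mem_sort, Finset.mem_filter, List.mem_append]
        grind
  · refine List.Perm.eq_of_pairwise (le := (· ≤ ·)) (fun _ _ _ _ h h' => le_antisymm h h')
      (Finset.pairwise_sort _ _) ?_ ?_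
    · simp only [List.pairwise_append, Finset.pairwise_sort, Finset.mem_sort, Finset.mem_filter,
        true_and]
      grind
    · refine (List.perm_ext_iff_of_nodup (Finset.sort_nodup _ _) ?_).2 ?_
      · simp only [List.nodup_append, Finset.sort_nodup, Finset.mem_sort, Finset.mem_filter,
          true_and]
        grind
      · simp only [Finset.mem_sort, Finset.mem_filter, List.mem_append]
        grind
  · simp

theorem sameCycle_mem {N : ℕ} {σ : Equiv.Perm (Fin N)} {I : Finset (Fin N)}
    (hI : ∀ x, σ x ∈ I ↔ x ∈ I) {x y : Fin N} (h : σ.SameCycle x y) (hx : x ∈ I) : y ∈ I :=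
  sameCycle_induction (P := (· ∈ I)) (fun w _ hw => (hI w).2 hw) h hx

theorem single_orbit_cases {N : ℕ} {σ : Equiv.Perm (Fin N)} {I : Finset (Fin N)}
    (hI : ∀ x, σ x ∈ I ↔ x ∈ I)
    (hnc : ∀ x ∈ I, ∀ y ∈ I, ¬ Cr x (σ x) y (σ y))
    (hone : ∀ x ∈ I, ∀ y ∈ I, σ.SameCycle x y) {x y z : Fin N} (hx : x ∈ I) (hy : y ∈ I)
    (hz : z ∈ I) (hyx : y ≠ x) (hyσ : y ≠ σ x) (hzx : z ≠ x) (hzσ : z ≠ σ x) :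
    ((min (x : ℕ) (σ x) < y ∧ (y : ℕ) < max (x : ℕ) (σ x)) ↔
      (min (x : ℕ) (σ x) < z ∧ (z : ℕ) < max (x : ℕ) (σ x))) := by
  have hsx := (hI x).2 hx
  have key : ∀ Q : Fin N → Prop,
      (∀ w ∈ I, w ≠ x → w ≠ σ x → Q w → σ w ≠ x → Q (σ w)) → σ (σ x) ≠ x → Q (σ (σ x)) →
      ∀ w ∈ I, w ≠ x → w ≠ σ x → Q w := by
    intro Q hQ h1 h2 w hw hwx hwσ
    have := sameCycle_induction (σ := σ) (P := fun w => w ∈ I ∧ (w = x ∨ w = σ x ∨ Q w))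
      (a := x) (c := w) ?_ (hone x hx w hw) ⟨hx, Or.inl rfl⟩
    · tauto
    rintro v - ⟨hv, hv'⟩
    refine ⟨(hI v).2 hv, ?_⟩
    rcases hv' with rfl | rfl | hv'
    · simp
    · exact Or.inr (Or.inr h2)
    · by_cases e1 : σ v = x
      · exact Or.inl e1
      by_cases e2 : v = x
      · rw [e2]; simp
      by_cases e3 : v = σ x
      · rw [e3]; exact Or.inr (Or.inr h2)
      exact Or.inr (Or.inr (hQ v hv e2 e3 hv' e1))
  have hne : ∀ {u v : Fin N}, u ≠ v → (u : ℕ) ≠ v := fun h h' => h (Fin.ext h')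
  by_cases h2 : σ (σ x) = x
  · exfalso
    have := sameCycle_induction (σ := σ) (P := fun w => w = x ∨ w = σ x)
      (a := x) (c := y) ?_ (hone x hx y hy) (Or.inl rfl)
    · tauto
    rintro v - (rfl | rfl)
    · simp
    · left; exact h2
  have hin : ∀ w ∈ I, w ≠ x → w ≠ σ x → σ w ≠ x →
      ((min (x : ℕ) (σ x) < w ∧ (w : ℕ) < max (x : ℕ) (σ x)) ↔
      (min (x : ℕ) (σ x) < σ w ∧ (σ w : ℕ) < max (x : ℕ) (σ x))) := by
    intro w hw h1 h3 h4
    have hn := hnc x hx w hw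
    have h5 := hne h1
    have h6 := hne h3
    have h7 := hne h4
    have h8 := hne (fun h : σ w = σ x => h1 (σ.injective h))
    unfold Cr at hn
    omega
  by_cases hcase : (min (x : ℕ) (σ x) < σ (σ x) ∧ (σ (σ x) : ℕ) < max (x : ℕ) (σ x))
  · have := key (fun w => (min (x : ℕ) (σ x) < w ∧ (w : ℕ) < max (x : ℕ) (σ x)))
      (fun w hw a1 a2 a3 a4 => (hin w hw a1 a2 a4).1 a3) h2 hcase
    exact iff_of_true (this y hy hyx hyσ) (this z hz hzx hzσ)
  · have := key (fun w => ¬ (min (x : ℕ) (σ x) < w ∧ (w : ℕ) < max (x : ℕ) (σ x)))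
      (fun w hw a1 a2 a3 a4 => fun hh => a3 ((hin w hw a1 a2 a4).2 hh)) h2 hcase
    exact iff_of_false (this y hy hyx hyσ) (this z hz hzx hzσ)

/-- In a noncrossing single orbit, cyclically adjacent elements have different colours. -/
theorem single_orbit_adjacent {N : ℕ} {col : ℕ → Bool} {σ : Equiv.Perm (Fin N)}
    (hcol : ∀ x : Fin N, col (σ x) = !col x) {I : Finset (Fin N)}
    (hI : ∀ x, σ x ∈ I ↔ x ∈ I)
    (hnc : ∀ x ∈ I, ∀ y ∈ I, ¬ Cr x (σ x) y (σ y))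
    (hone : ∀ x ∈ I, ∀ y ∈ I, σ.SameCycle x y) {i j : Fin N} (hi : i ∈ I) (hj : j ∈ I)
    (hij : i < j)
    (hadj : (∀ y ∈ I, y ≤ i ∨ j ≤ y) ∨ (∀ y ∈ I, i ≤ y ∧ y ≤ j)) : col i ≠ col j := by
  intro hc
  set u := σ⁻¹ i with hu
  have hui : σ u = i := by simp [hu]
  have huI : u ∈ I := (hI u).1 (by rw [hui]; exact hi)
  have hsI := (hI i).2 hi
  have hcs := hcol i
  have hcu := hcol u
  rw [hui] at hcu
  have hij' : i ≠ j := ne_of_lt hij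
  have e1 : σ i ≠ i := fun h => by rw [h] at hcs; simp at hcs
  have e2 : σ i ≠ j := fun h => by rw [h, ← hc] at hcs; simp at hcs
  have e3 : u ≠ i := fun h => by rw [h] at hcu; simp at hcu
  have e4 : u ≠ j := fun h => by rw [h, ← hc] at hcu; simp at hcu
  by_cases e5 : σ i = u
  · have := sameCycle_induction (σ := σ) (P := fun w => w = i ∨ w = u)
      (a := i) (c := j) ?_ (hone i hi j hj) (Or.inl rfl)
    · rcases this with h | h
      · exact hij' h.symm
      · exact e4 h.symm
    rintro v - (rfl | rfl)
    · right; exact e5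
    · left; exact hui
  have h1 := single_orbit_cases hI hnc hone hi hj huI hij'.symm e2.symm e3 (Ne.symm e5)
  have h2 := single_orbit_cases hI hnc hone huI hj hsI e4.symm (by rw [hui]; exact hij'.symm)
    e5 (by rw [hui]; exact e1)
  rw [hui] at h2
  have hne : ∀ {u v : Fin N}, u ≠ v → (u : ℕ) ≠ v := fun h h' => h (Fin.ext h')
  have f1 := hne e1
  have f2 := hne e2
  have f3 := hne e3
  have f4 := hne e4
  have f5 := hne e5
  have hlt : (i : ℕ) < j := hij
  rcases hadj with h | h
  · have g1 := h u huI
    have g2 := h _ hsI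
    simp only [Fin.le_def] at g1 g2
    omega
  · have g1 := h u huI
    have g2 := h _ hsI
    simp only [Fin.le_def] at g1 g2
    omega

theorem isChain_sort {N : ℕ} (I : Finset (Fin N)) (Q : Fin N → Fin N → Prop)
    (h : ∀ i ∈ I, ∀ j ∈ I, i < j → (∀ y ∈ I, y ≤ i ∨ j ≤ y) → Q i j) :
    (I.sort (· ≤ ·)).IsChain Q := by
  rw [List.isChain_iff_getElem]
  intro k hk
  have hm := Finset.sortedLT_sort I
  refine h _ ?_ _ ?_ ?_ ?_
  · rw [← Finset.mem_sort (· ≤ ·)]; exact List.getElem_mem _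
  · rw [← Finset.mem_sort (· ≤ ·)]; exact List.getElem_mem _
  · exact hm.strictMono_get (a := ⟨k, by omega⟩) (b := ⟨k+1, hk⟩) (by simp [Fin.lt_def])
  · intro y hy
    rw [← Finset.mem_sort (· ≤ ·)] at hy
    obtain ⟨l, hl, rfl⟩ := List.getElem_of_mem hy
    rcases Nat.lt_or_ge k l with hlk | hlk
    · right; exact hm.strictMono_get.monotone (a := ⟨k+1, hk⟩) (b := ⟨l, hl⟩) (by simpa using hlk)
    · left; exact hm.strictMono_get.monotone (a := ⟨l, hl⟩) (b := ⟨k, by omega⟩) (by simpa using hlk)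

theorem cchg_single_orbit {N : ℕ} {col : ℕ → Bool} {σ : Equiv.Perm (Fin N)}
    (hcol : ∀ x : Fin N, col (σ x) = !col x) {I : Finset (Fin N)} (hne : I.Nonempty)
    (hI : ∀ x, σ x ∈ I ↔ x ∈ I)
    (hnc : ∀ x ∈ I, ∀ y ∈ I, ¬ Cr x (σ x) y (σ y))
    (hone : ∀ x ∈ I, ∀ y ∈ I, σ.SameCycle x y) :
    cchg ((I.sort (· ≤ ·)).map (fun x : Fin N => col x)) = I.card := by
  have hlen : (I.sort (· ≤ ·)).length = I.card := by simp
  obtain ⟨x, hx⟩ := hne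
  have hsx := (hI x).2 hx
  have hxs : σ x ≠ x := fun h => by have := hcol x; rw [h] at this; simp at this
  have h2 : 2 ≤ I.card := by
    have := Finset.card_le_card (s := {σ x, x}) (t := I) (by
      intro y hy; simp at hy; rcases hy with rfl | rfl <;> assumption)
    rwa [Finset.card_pair hxs] at this
  have hm := Finset.sortedLT_sort I
  have hmem : ∀ y, y ∈ I.sort (· ≤ ·) ↔ y ∈ I := fun y => by simp
  have hch := isChain_sort I (fun i j => col i ≠ col j)
    (fun i hi j hj hij h => single_orbit_adjacent hcol hI hnc hone hi hj hij (Or.inl h))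
  rcases hl : I.sort (· ≤ ·) with _ | ⟨a, l⟩
  · rw [hl] at hlen; simp at hlen; omega
  rcases l.eq_nil_or_concat with rfl | ⟨l', c, rfl⟩
  · rw [hl] at hlen; simp at hlen; omega
  rw [hl] at hm hmem hch hlen
  simp only [List.concat_eq_append] at *
  unfold cchg
  have hchain : ((a :: (l' ++ [c])) ++ [a]).IsChain (fun i j : Fin N => col i ≠ col j) := by
    rw [List.isChain_append]
    refine ⟨hch, by simp, ?_⟩
    intro u hu v hv
    simp only [List.head?_cons, Option.mem_def, Option.some.injEq] at hv
    have : (a :: (l' ++ [c])).getLast? = some c := by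
      rw [← List.cons_append, List.getLast?_concat]
    rw [this] at hu
    simp at hu
    subst hu hv
    have hp := hm.pairwise
    rw [List.pairwise_cons] at hp
    have hac : a < c := hp.1 c (by simp)
    refine (single_orbit_adjacent hcol hI hnc hone ((hmem a).1 (by simp)) ((hmem c).1 (by simp))
      hac (Or.inr ?_)).symm
    intro y hy
    rw [← hmem] at hy
    have hp2 := hp.2
    rw [List.pairwise_append] at hp2
    simp only [List.mem_cons, List.mem_append, List.not_mem_nil, or_false] at hy
    rcases hy with rfl | hy | rfl
    · exact ⟨le_rfl, hac.le⟩
    · exact ⟨(hp.1 y (by simp [hy])).le, (hp2.2.2 y hy c (by simp)).le⟩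
    · exact ⟨hac.le, le_rfl⟩
  have := chg_eq_length (((a :: (l' ++ [c])) ++ [a]).map (fun x : Fin N => col x))
    (by rw [List.isChain_map]; exact hchain)
  simp at this hlen ⊢
  omega

/-- Noncrossing colour-swapping permutations: orbits plus colour changes are abundant. -/
theorem card_le_of_noncrossing {N : ℕ} {col : ℕ → Bool} {σ : Equiv.Perm (Fin N)}
    (hcol : ∀ x : Fin N, col (σ x) = !col x) (hnc : ∀ x y : Fin N, ¬ Cr x (σ x) y (σ y))
    (I : Finset (Fin N)) (hne : I.Nonempty) (hI : ∀ x, σ x ∈ I ↔ x ∈ I) :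
    I.card + 2 ≤ 2 * (I.image (orb σ)).card +
      cchg ((I.sort (· ≤ ·)).map (fun x : Fin N => col x)) := by
  induction hn : I.card using Nat.strong_induction_on generalizing I with
  | _ n ih =>
  by_cases hone : ∀ x ∈ I, ∀ y ∈ I, σ.SameCycle x y
  · have h1 := cchg_single_orbit hcol hne hI (fun x _ y _ => hnc x y) hone
    have h2 : 0 < (I.image (orb σ)).card := Finset.card_pos.2 (hne.image _)
    omega
  set f := I.min' hne with hf
  have hfI : f ∈ I := Finset.min'_mem _ _
  obtain ⟨z, hz, hzf⟩ : ∃ z ∈ I, ¬ σ.SameCycle f z := by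
    by_contra! h
    exact hone fun x hx y hy => (h x hx).symm.trans (h y hy)
  have horb : (orb σ z).Nonempty := ⟨z, mem_orb.2 (Equiv.Perm.SameCycle.refl _ _)⟩
  set a := (orb σ z).min' horb with ha
  set c := (orb σ z).max' horb with hc
  have haz : σ.SameCycle z a := mem_orb.1 (Finset.min'_mem _ _)
  have hcz : σ.SameCycle z c := mem_orb.1 (Finset.max'_mem _ _)
  have hac : a ≤ c := Finset.min'_le _ _ (Finset.max'_mem _ _)
  have hle : ∀ w, σ.SameCycle z w → a ≤ w ∧ w ≤ c := fun w hw =>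
    ⟨Finset.min'_le _ _ (mem_orb.2 hw), Finset.le_max' _ _ (mem_orb.2 hw)⟩
  have hJ : ∀ x, (a ≤ σ x ∧ σ x ≤ c) ↔ (a ≤ x ∧ x ≤ c) := by
    intro x
    by_cases hxz : σ.SameCycle z x
    · exact iff_of_true (hle _ (Equiv.Perm.sameCycle_apply_right.2 hxz)) (hle _ hxz)
    have hside : ∀ w, σ.SameCycle z w →
        ((min (x : ℕ) (σ x) < w ∧ (w : ℕ) < max (x : ℕ) (σ x)) ↔
          (min (x : ℕ) (σ x) < σ w ∧ (σ w : ℕ) < max (x : ℕ) (σ x))) := by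
      intro w hw
      have hn := hnc x w
      have hne : ∀ {u v : Fin N}, u ≠ v → (u : ℕ) ≠ v := fun h h' => h (Fin.ext h')
      have h1 : (w : ℕ) ≠ x := hne (fun h => hxz (h ▸ hw))
      have h2 : (σ w : ℕ) ≠ x :=
        hne (fun h => hxz (h ▸ Equiv.Perm.sameCycle_apply_right.2 hw))
      have h3 : (w : ℕ) ≠ σ x :=
        hne (fun h => hxz (Equiv.Perm.sameCycle_apply_right.1 (h ▸ hw)))
      have h4 : (σ w : ℕ) ≠ σ x :=
        hne (fun h => hxz (σ.injective h ▸ hw))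
      unfold Cr at hn
      omega
    have hacs := haz.symm.trans hcz
    have hax : (x : ℕ) ≠ a := fun h => hxz (by rw [Fin.ext h]; exact haz)
    have hcx : (x : ℕ) ≠ c := fun h => hxz (by rw [Fin.ext h]; exact hcz)
    have hax' : (σ x : ℕ) ≠ a := fun h =>
      hxz (Equiv.Perm.sameCycle_apply_right.1 (by rw [Fin.ext h]; exact haz))
    have hcx' : (σ x : ℕ) ≠ c := fun h =>
      hxz (Equiv.Perm.sameCycle_apply_right.1 (by rw [Fin.ext h]; exact hcz))
    have hac' : (a : ℕ) ≤ c := hac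
    have h1 := sameCycle_induction (σ := σ)
      (P := fun w => (min (x : ℕ) (σ x) < w ∧ (w : ℕ) < max (x : ℕ) (σ x)))
      (a := a) (c := c) (fun w hw h => (hside w (haz.trans hw)).1 h) hacs
    have h2 := sameCycle_induction (σ := σ)
      (P := fun w => ¬ (min (x : ℕ) (σ x) < w ∧ (w : ℕ) < max (x : ℕ) (σ x)))
      (a := a) (c := c) (fun w hw h hh => h ((hside w (haz.trans hw)).2 hh)) hacs
    simp only [Fin.le_def]
    omega
  have hfa : f < a := lt_of_le_of_ne (Finset.min'_le _ _ (sameCycle_mem hI haz hz))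
    (fun h => hzf (h ▸ haz.symm))
  obtain ⟨X, Y, e1, e2, hX⟩ := sort_split I a c hac
  set J := I.filter (fun y => a ≤ y ∧ y ≤ c) with hJdef
  set L := I.filter (fun y => ¬ (a ≤ y ∧ y ≤ c)) with hLdef
  have hJcl : ∀ x, σ x ∈ J ↔ x ∈ J := fun x => by
    simp only [hJdef, Finset.mem_filter]; rw [hJ, hI]
  have hLcl : ∀ x, σ x ∈ L ↔ x ∈ L := fun x => by
    simp only [hLdef, Finset.mem_filter]; rw [hJ, hI]
  have hzJ : z ∈ J := by
    simp only [hJdef, Finset.mem_filter]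
    exact ⟨hz, hle z (Equiv.Perm.SameCycle.refl _ _)⟩
  have hfL : f ∈ L := by
    simp only [hLdef, Finset.mem_filter]
    exact ⟨hfI, fun h => absurd h.1 (not_le.2 hfa)⟩
  have hcard : J.card + L.card = I.card := Finset.card_filter_add_card_filter_not _
  have hJ0 := Finset.card_pos.2 ⟨z, hzJ⟩
  have hL0 := Finset.card_pos.2 ⟨f, hfL⟩
  have i1 := ih J.card (by omega) J ⟨z, hzJ⟩ hJcl rfl
  have i2 := ih L.card (by omega) L ⟨f, hfL⟩ hLcl rfl
  have himg : (I.image (orb σ)).card = (J.image (orb σ)).card + (L.image (orb σ)).card := by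
    rw [← Finset.card_union_of_disjoint, ← Finset.image_union, Finset.filter_union_filter_not_eq]
    rw [Finset.disjoint_left]
    intro O hO hO'
    obtain ⟨u, hu, rfl⟩ := Finset.mem_image.1 hO
    obtain ⟨v, hv, huv⟩ := Finset.mem_image.1 hO'
    have := sameCycle_mem hLcl (orb_eq_iff.1 huv) hv
    simp only [hJdef, hLdef, Finset.mem_filter] at hu this
    exact this.2 hu.2
  have hch := cchg_split (X.map (fun x : Fin N => col x))
    ((J.sort (· ≤ ·)).map (fun x : Fin N => col x)) (Y.map (fun x : Fin N => col x)) (by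
      have : f ∈ X := (hX f).2 ⟨hfI, hfa⟩
      intro h
      rw [List.map_eq_nil_iff] at h
      rw [h] at this; simp at this)
  rw [← List.map_append, ← List.map_append, ← List.map_append, ← e1, ← e2] at hch
  omega

/-- The number of colour changes along the positions `0, …, N - 1`. -/
def linChg (col : ℕ → Bool) (N : ℕ) : ℕ :=
  ∑ i ∈ Finset.range (N - 1), if col i = col (i + 1) then 0 else 1

theorem chg_concat (l : List Bool) (x y : Bool) :
    chg (l ++ [x, y]) = chg (l ++ [x]) + if x = y then 0 else 1 := by
  induction l with
  | nil => simp [chg]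
  | cons z l ih =>
    cases l with
    | nil => simp [chg]
    | cons w l =>
      simp only [List.cons_append, chg] at ih ⊢
      rw [ih]; ring

theorem chg_range (col : ℕ → Bool) (n : ℕ) : chg ((List.range (n + 1)).map col) = linChg col (n + 1) := by
  induction n with
  | zero => simp [chg, linChg]
  | succ n ih =>
    rw [List.range_succ, List.range_succ, List.map_append, List.map_append, List.append_assoc]
    simp only [List.map_cons, List.map_nil, List.cons_append, List.nil_append]
    rw [chg_concat]
    rw [List.range_succ, List.map_append] at ih
    simp only [List.map_cons, List.map_nil] at ih
    rw [ih]
    simp [linChg, Finset.sum_range_succ]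

theorem noncrossing_bound {N : ℕ} (hN : 0 < N) {col : ℕ → Bool} (h0 : col (N - 1) = col 0)
    {σ : Equiv.Perm (Fin N)}
    (hcol : ∀ x : Fin N, col (σ x) = !col x) (hnc : ∀ x y : Fin N, ¬ Cr x (σ x) y (σ y)) :
    N + 2 ≤ 2 * orbNum σ + linChg col N := by
  have := card_le_of_noncrossing hcol hnc Finset.univ ⟨⟨0, hN⟩, by simp⟩ (by simp)
  obtain ⟨n, rfl⟩ : ∃ n, N = n + 1 := ⟨N - 1, by omega⟩
  have e : cchg (((Finset.univ : Finset (Fin (n+1))).sort (· ≤ ·)).map (fun x : Fin (n+1) => col x))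
      = linChg col (n + 1) := by
    rw [Fin.sort_univ]
    have : (List.finRange (n+1)).map (fun x : Fin (n+1) => col x) = (List.range (n+1)).map col := by
      rw [← List.map_coe_finRange_eq_range, List.map_map]; rfl
    rw [this, ← chg_range]
    unfold cchg
    have hd : ((List.range (n + 1)).map col).head? = some (col 0) := by
      simp [List.head?_range]
    rw [hd, List.range_succ, List.map_append]
    simp only [List.map_cons, List.map_nil, Option.toList_some, List.append_assoc,
      List.cons_append, List.nil_append]
    rw [chg_concat, if_pos (by simpa using h0)]
    rfl
  rw [e] at this
  simpa [orbNum] using this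

theorem cr_inout_left {u v p s q t z w : ℕ} (h1 : u < p) (h2 : p < v) (h3 : u < s) (h4 : s < v)
    (h5 : q < u ∨ v < q) (h6 : t < u ∨ v < t)
    (hz : Cr z w u v → ¬ (min p s ≤ z ∧ z ≤ max p s) ∧ ¬ (min p s ≤ w ∧ w ≤ max p s))
    (h : Cr z w p s) : Cr z w p q ∨ Cr z w t s := by
  wlog hzw : z ≤ w generalizing z w
  · have hc : ∀ c d, Cr w z c d ↔ Cr z w c d := fun c d => by unfold Cr; rw [min_comm, max_comm]
    have := this (z := w) (w := z) (by rw [hc]; exact fun h => (hz h).symm) ((hc _ _).2 h) (by omega)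
    rwa [hc, hc] at this
  unfold Cr at *
  simp only [min_eq_left hzw, max_eq_right hzw] at *
  rcases le_total p s with hps | hps <;> simp only [min_eq_left hps, max_eq_right hps, min_eq_right hps, max_eq_left hps] at * <;>
  rcases h5 with h5 | h5 <;> rcases h6 with h6 | h6 <;> omega

theorem cr_inout_right {u v p s q t z w : ℕ} (h1 : u < p) (h2 : p < v) (h3 : u < s) (h4 : s < v)
    (h5 : q < u ∨ v < q) (h6 : t < u ∨ v < t)
    (hz : Cr z w u v → ¬ (min p s ≤ z ∧ z ≤ max p s) ∧ ¬ (min p s ≤ w ∧ w ≤ max p s))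
    (h : Cr z w t q) : Cr z w p q ∨ Cr z w t s := by
  wlog hzw : z ≤ w generalizing z w
  · have hc : ∀ c d, Cr w z c d ↔ Cr z w c d := fun c d => by unfold Cr; rw [min_comm, max_comm]
    have := this (z := w) (w := z) (by rw [hc]; exact fun h => (hz h).symm) ((hc _ _).2 h) (by omega)
    rwa [hc, hc] at this
  unfold Cr at *
  simp only [min_eq_left hzw, max_eq_right hzw] at *
  rcases le_total p s with hps | hps <;> simp only [min_eq_left hps, max_eq_right hps, min_eq_right hps, max_eq_left hps] at * <;>
  rcases h5 with h5 | h5 <;> rcases h6 with h6 | h6 <;>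
  rcases le_total t q with htq | htq <;>
  simp only [min_eq_left htq, max_eq_right htq, min_eq_right htq, max_eq_left htq] at * <;>
  rcases h with h | h <;> omega

theorem cr_inout_not_both {u v p s q t z w : ℕ} (h1 : u < p) (h2 : p < v) (h3 : u < s) (h4 : s < v)
    (h5 : q < u ∨ v < q) (h6 : t < u ∨ v < t)
    (hz : Cr z w u v → ¬ (min p s ≤ z ∧ z ≤ max p s) ∧ ¬ (min p s ≤ w ∧ w ≤ max p s))
    (h : Cr z w p s) (h' : Cr z w t q) : False := by
  unfold Cr at *
  omega

theorem not_cr_inout {u v p s q t : ℕ} (h1 : u < p) (h2 : p < v) (h3 : u < s) (h4 : s < v)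
    (h5 : q < u ∨ v < q) (h6 : t < u ∨ v < t) : ¬ Cr p s t q := by
  unfold Cr
  omega

/-- Colour-swapping permutations through the virtual edge from `b` to position `0`, in which only
edges leaving points of equal colours cross. -/
structure Adm {N : ℕ} (col : ℕ → Bool) (b : Fin N) (σ : Equiv.Perm (Fin N)) : Prop where
  hcol : ∀ x : Fin N, col (σ x) = !col x
  hb : (σ b : ℕ) = 0
  cls : ∀ x y : Fin N, x ≠ b → y ≠ b → Cr x (σ x) y (σ y) → col x = col y

/-- The potential: twice the crossings plus twice the orbits. -/
def pot {N : ℕ} (b : Fin N) (σ : Equiv.Perm (Fin N)) : ℕ := cr2 b σ + 2 * orbNum σ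

section Swap

variable {N : ℕ} {col : ℕ → Bool} {b : Fin N} {σ : Equiv.Perm (Fin N)} {p t : Fin N}

theorem mul_swap_left : (σ * Equiv.swap p t) p = σ t := by simp
theorem mul_swap_right : (σ * Equiv.swap p t) t = σ p := by simp
theorem mul_swap_ne {z : Fin N} (h : z ≠ p) (h' : z ≠ t) : (σ * Equiv.swap p t) z = σ z := by
  simp [Equiv.swap_apply_of_ne_of_ne h h']

theorem Adm.mul_swap (hσ : Adm col b σ) (hpb : p ≠ b) (htb : t ≠ b) (hc : col p = col t)
    (h : ∀ z, z ≠ p → z ≠ t →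
      iot b (σ * Equiv.swap p t) z p + iot b (σ * Equiv.swap p t) z t
        ≤ iot b σ z p + iot b σ z t) : Adm col b (σ * Equiv.swap p t) := by
  have key : ∀ z, z ≠ p → z ≠ t → ∀ a, a = p ∨ a = t → z ≠ b →
      Cr z ((σ * Equiv.swap p t) z) a ((σ * Equiv.swap p t) a) → col z = col a := by
    intro z h1 h2 a ha hzb hcr
    have hab : a ≠ b := by rcases ha with rfl | rfl <;> assumption
    have h3 : iot b (σ * Equiv.swap p t) z a = 1 := if_pos ⟨hzb, hab, hcr⟩
    have h4 : 0 < iot b σ z p ∨ 0 < iot b σ z t := by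
      have := h z h1 h2
      rcases ha with rfl | rfl <;> omega
    have hca : col a = col p ∧ col a = col t := by rcases ha with rfl | rfl <;> simp [hc]
    rcases h4 with h4 | h4
    · unfold iot at h4; split_ifs at h4 with h5
      · rw [hca.1]; exact hσ.cls _ _ h5.1 h5.2.1 h5.2.2
      · omega
    · unfold iot at h4; split_ifs at h4 with h5
      · rw [hca.2]; exact hσ.cls _ _ h5.1 h5.2.1 h5.2.2
      · omega
  refine ⟨?_, ?_, ?_⟩
  · intro x
    by_cases h1 : x = p
    · subst h1; rw [mul_swap_left, hσ.hcol, hc]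
    by_cases h2 : x = t
    · subst h2; rw [mul_swap_right, hσ.hcol, hc]
    rw [mul_swap_ne h1 h2, hσ.hcol]
  · rw [mul_swap_ne hpb.symm htb.symm, hσ.hb]
  · intro x y hx hy hxy
    by_cases h1 : x = p ∨ x = t
    · by_cases h2 : y = p ∨ y = t
      · rcases h1 with rfl | rfl <;> rcases h2 with rfl | rfl <;> simp [hc]
      · push Not at h2
        exact (key y h2.1 h2.2 x h1 hy hxy.symm).symm
    · push Not at h1
      by_cases h2 : y = p ∨ y = t
      · exact key x h1.1 h1.2 y h2 hx hxy
      · push Not at h2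
        rw [mul_swap_ne h1.1 h1.2, mul_swap_ne h2.1 h2.2] at hxy
        exact hσ.cls x y hx hy hxy

theorem iot_eq {z a : Fin N} (hz : z ≠ b) (ha : a ≠ b) :
    iot b σ z a = if Cr z (σ z) a (σ a) then 1 else 0 := by simp [iot, hz, ha]

theorem iot_b_left {a : Fin N} : iot b σ b a = 0 := by simp [iot]

/-- Exchanging the successors of two crossing edges removes a crossing. -/
theorem crossing_swap_pointwise (hpb : p ≠ b) (htb : t ≠ b)
    (hcr : Cr p (σ p) t (σ t)) : ∀ z, z ≠ p → z ≠ t →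
      iot b (σ * Equiv.swap p t) z p + iot b (σ * Equiv.swap p t) z t
        ≤ iot b σ z p + iot b σ z t := by
  intro z h1 h2
  by_cases hzb : z = b
  · subst hzb; simp [iot_b_left]
  rw [iot_eq hzb hpb, iot_eq hzb htb, iot_eq hzb hpb, iot_eq hzb htb, mul_swap_left,
    mul_swap_right, mul_swap_ne h1 h2]
  have a1 := fun h => cr_swap_or (z := z) (w := σ z) hcr h
  have a2 := fun h => cr_swap_or (z := z) (w := σ z) hcr.symm h
  have a3 := fun h => cr_swap_and (z := z) (w := σ z) hcr h
  by_cases g1 : Cr z (σ z) p (σ t) <;> by_cases g2 : Cr z (σ z) t (σ p) <;>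
  by_cases g3 : Cr z (σ z) p (σ p) <;> by_cases g4 : Cr z (σ z) t (σ t) <;>
  simp [g1, g2, g3, g4] at a1 a2 a3 ⊢

theorem iot_crossing_swap (hpb : p ≠ b) (htb : t ≠ b)
    (hcr : Cr p (σ p) t (σ t)) : iot b (σ * Equiv.swap p t) p t + 1 ≤ iot b σ p t := by
  have : ¬ Cr p (σ t) t (σ p) := by
    unfold Cr at *; omega
  rw [iot_eq hpb htb, iot_eq hpb htb, mul_swap_left, mul_swap_right, if_neg this, if_pos hcr]

theorem ne_of_cr {x y : Fin N} (h : Cr x (σ x) y (σ y)) : x ≠ y := by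
  rintro rfl; exact not_cr_self h

end Swap

/-- `x` is the tail of an edge leaving the open interval `(u, v)` across its chord. -/
def OutC {N : ℕ} (b : Fin N) (σ : Equiv.Perm (Fin N)) (u v : ℕ) (x : Fin N) : Prop :=
  x ≠ b ∧ u < x ∧ x < v ∧ ((σ x : ℕ) < u ∨ v < σ x)

/-- `x` is the tail of an edge entering the open interval `(u, v)` across its chord. -/
def InC {N : ℕ} (b : Fin N) (σ : Equiv.Perm (Fin N)) (u v : ℕ) (x : Fin N) : Prop :=
  x ≠ b ∧ u < σ x ∧ σ x < v ∧ ((x : ℕ) < u ∨ v < x)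

theorem cr_iff_outC_or_inC {N : ℕ} {b : Fin N} {σ : Equiv.Perm (Fin N)} {u v : ℕ} (huv : u ≤ v)
    {x : Fin N} : (x ≠ b ∧ Cr x (σ x) u v) ↔ (OutC b σ u v x ∨ InC b σ u v x) := by
  unfold OutC InC Cr
  rw [← and_or_left]
  refine and_congr_right fun _ => ?_
  omega

/-- If a chord is crossed in both directions, by edges whose tails all have the same colour, then
some in/out pair of edges can be exchanged without creating crossings. -/
theorem exists_inout_swap {N : ℕ} {col : ℕ → Bool} {b : Fin N} {σ : Equiv.Perm (Fin N)}
    (hσ : Adm col b σ) {u v : ℕ} (huv : u ≤ v) {κ : Bool}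
    (hκ : ∀ x, x ≠ b → Cr x (σ x) u v → col x = κ)
    (hout : ∃ x, OutC b σ u v x) (hin : ∃ x, InC b σ u v x) :
    ∃ p t, OutC b σ u v p ∧ InC b σ u v t ∧ col p = κ ∧ col t = κ ∧
      (∀ z, z ≠ p → z ≠ t →
      iot b (σ * Equiv.swap p t) z p + iot b (σ * Equiv.swap p t) z t
        ≤ iot b σ z p + iot b σ z t) ∧ iot b (σ * Equiv.swap p t) p t = 0 := by
  obtain ⟨p0, hp0⟩ := hout
  obtain ⟨t0, ht0⟩ := hin
  obtain ⟨⟨p, t⟩, hpt, hmin⟩ := Finset.exists_min_image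
    (Finset.univ.filter (fun a : Fin N × Fin N => OutC b σ u v a.1 ∧ InC b σ u v a.2))
    (fun a => ((a.1 : ℕ) - (σ a.2 : ℕ)) + ((σ a.2 : ℕ) - (a.1 : ℕ))) ⟨(p0, t0), by simp [hp0, ht0]⟩
  simp only [Finset.mem_filter, Finset.mem_univ, true_and, Prod.forall] at hpt hmin
  obtain ⟨hp, ht⟩ := hpt
  have hcp : col p = κ := by
    have := (cr_iff_outC_or_inC huv).2 (Or.inl hp)
    exact hκ p this.1 this.2
  have hct : col t = κ := by
    have := (cr_iff_outC_or_inC huv).2 (Or.inr ht)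
    exact hκ t this.1 this.2
  refine ⟨p, t, hp, ht, hcp, hct, ?_, ?_⟩
  · intro z h1 h2
    by_cases hzb : z = b
    · subst hzb; simp [iot_b_left]
    rw [iot_eq hzb hp.1, iot_eq hzb ht.1, iot_eq hzb hp.1, iot_eq hzb ht.1, mul_swap_left,
      mul_swap_right, mul_swap_ne h1 h2]
    have hz : Cr z (σ z) u v → ¬ (min (p : ℕ) (σ t) ≤ z ∧ z ≤ max (p : ℕ) (σ t)) ∧
        ¬ (min (p : ℕ) (σ t) ≤ σ z ∧ σ z ≤ max (p : ℕ) (σ t)) := by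
      intro hcz
      have hczκ := hκ z hzb hcz
      have n1 : (z : ℕ) ≠ σ t := fun h => by
        have := hσ.hcol t
        rw [← h, hczκ, hct] at this; simp at this
      have n2 : (σ z : ℕ) ≠ p := fun h => by
        have := hσ.hcol z
        rw [h, hczκ, hcp] at this; simp at this
      have n3 : (z : ℕ) ≠ p := fun h => h1 (Fin.ext h)
      have n4 : (σ z : ℕ) ≠ σ t := fun h => h2 (σ.injective (Fin.ext h))
      have m1 := hmin z t
      have m2 := hmin p z
      simp only [hp, ht, and_true, true_and] at m1 m2
      rcases (cr_iff_outC_or_inC huv).1 ⟨hzb, hcz⟩ with h | h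
      · have := m1 h
        obtain ⟨-, a1, a2, a3⟩ := h
        obtain ⟨-, b1, b2, b3⟩ := hp
        obtain ⟨-, c1, c2, c3⟩ := ht
        omega
      · have := m2 h
        obtain ⟨-, a1, a2, a3⟩ := h
        obtain ⟨-, b1, b2, b3⟩ := hp
        obtain ⟨-, c1, c2, c3⟩ := ht
        omega
    obtain ⟨-, b1, b2, b3⟩ := hp
    obtain ⟨-, c1, c2, c3⟩ := ht
    have a1 := fun h => cr_inout_left b1 b2 c1 c2 b3 c3 hz h
    have a2 := fun h => cr_inout_right b1 b2 c1 c2 b3 c3 hz h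
    have a3 := fun h => cr_inout_not_both b1 b2 c1 c2 b3 c3 hz h
    by_cases g1 : Cr z (σ z) p (σ t) <;> by_cases g2 : Cr z (σ z) t (σ p) <;>
    by_cases g3 : Cr z (σ z) p (σ p) <;> by_cases g4 : Cr z (σ z) t (σ t) <;>
    simp [g1, g2, g3, g4] at a1 a2 a3 ⊢
  · rw [iot_eq hp.1 ht.1, mul_swap_left, mul_swap_right, if_neg]
    exact not_cr_inout hp.2.1 hp.2.2.1 ht.2.1 ht.2.2.1 hp.2.2.2 ht.2.2.2

theorem OutC.ne_inC {N : ℕ} {b : Fin N} {σ : Equiv.Perm (Fin N)} {u v : ℕ} {x y : Fin N}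
    (h : OutC b σ u v x) (h' : InC b σ u v y) : x ≠ y := by
  rintro rfl
  obtain ⟨-, h1, h2, -⟩ := h
  obtain ⟨-, -, -, h3⟩ := h'
  omega

/-- The in/out exchange across the chord of an actual edge strictly lowers the potential. -/
theorem exists_inout_swap_edge {N : ℕ} {col : ℕ → Bool} {b : Fin N} {σ : Equiv.Perm (Fin N)}
    (hσ : Adm col b σ) {e : Fin N} (heb : e ≠ b) {u v : ℕ}
    (hu : u = min (e : ℕ) (σ e)) (hv : v = max (e : ℕ) (σ e))
    (hout : ∃ x, OutC b σ u v x) (hin : ∃ x, InC b σ u v x) :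
    ∃ p t, OutC b σ u v p ∧ InC b σ u v t ∧ Adm col b (σ * Equiv.swap p t) ∧
      pot b (σ * Equiv.swap p t) + 2 ≤ pot b σ := by
  have huv : u ≤ v := by omega
  have hce : ∀ a c : ℕ, Cr a c u v ↔ Cr e (σ e) a c := by
    intro a c; subst hu hv; unfold Cr; omega
  obtain ⟨p, t, hp, ht, hcp, hct, hpw, h0⟩ := exists_inout_swap hσ huv (κ := col e)
    (fun x hx hc => (hσ.cls e x heb hx ((hce _ _).1 hc)).symm) hout hin
  have hpt := hp.ne_inC ht
  have hp' := (hce _ _).1 ((cr_iff_outC_or_inC huv).2 (Or.inl hp)).2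
  have ht' := (hce _ _).1 ((cr_iff_outC_or_inC huv).2 (Or.inr ht)).2
  have hep := ne_of_cr hp'
  have het := ne_of_cr ht'
  refine ⟨p, t, hp, ht, hσ.mul_swap hp.1 ht.1 (hcp.trans hct.symm) hpw, ?_⟩
  have h1 := cr2_mul_swap_le (b := b) σ hpt {e} (by simpa using hep.symm) (by simpa using het.symm)
    2 0 ?_ (by omega)
  · have h2 := orbNum_mul_swap_le σ p t
    simp at h1
    unfold pot
    omega
  · intro z h1 h2
    by_cases hze : z = e
    · subst hze
      simp only [Finset.mem_singleton, if_true]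
      rw [iot_eq heb hp.1, iot_eq heb ht.1, iot_eq heb hp.1, iot_eq heb ht.1, mul_swap_left,
        mul_swap_right, mul_swap_ne h1 h2, if_pos hp', if_pos ht', if_neg, if_neg]
      · rw [← hce]
        obtain ⟨-, b1, b2, b3⟩ := hp
        obtain ⟨-, c1, c2, c3⟩ := ht
        unfold Cr; omega
      · rw [← hce]
        obtain ⟨-, b1, b2, b3⟩ := hp
        obtain ⟨-, c1, c2, c3⟩ := ht
        unfold Cr; omega
    · have := hpw z h1 h2
      simpa [hze] using this

/-- Admissible permutations of minimum potential. -/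
def Tight {N : ℕ} (col : ℕ → Bool) (b : Fin N) (σ : Equiv.Perm (Fin N)) : Prop :=
  Adm col b σ ∧ ∀ τ, Adm col b τ → pot b σ ≤ pot b τ

theorem Tight.one_way {N : ℕ} {col : ℕ → Bool} {b : Fin N} {σ : Equiv.Perm (Fin N)}
    (hσ : Tight col b σ) {e : Fin N} (heb : e ≠ b) {u v : ℕ}
    (hu : u = min (e : ℕ) (σ e)) (hv : v = max (e : ℕ) (σ e)) :
    (∀ x, ¬ OutC b σ u v x) ∨ (∀ x, ¬ InC b σ u v x) := by
  by_contra! h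
  obtain ⟨p, t, -, -, h1, h2⟩ := exists_inout_swap_edge hσ.1 heb hu hv h.1 h.2
  have := hσ.2 _ h1
  omega

/-- The sign of a colour: `1` for red, `-1` for blue. -/
def sg (c : Bool) : ℤ := if c then 1 else -1

/-- Excess of red over blue among the first `j` positions. -/
def height (col : ℕ → Bool) (j : ℕ) : ℤ := ∑ i ∈ Finset.range j, sg (col i)

/-- Excess of red over blue strictly between positions `u` and `v`. -/
def exc (N : ℕ) (col : ℕ → Bool) (u v : ℕ) : ℤ :=
  ∑ x ∈ Finset.univ.filter (fun x : Fin N => u < (x : ℕ) ∧ (x : ℕ) < v), sg (col x)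

theorem height_succ (col : ℕ → Bool) (j : ℕ) : height col (j + 1) = height col j + sg (col j) := by
  simp [height, Finset.sum_range_succ]

theorem exc_eq {N : ℕ} {col : ℕ → Bool} {u v : ℕ} (huv : u < v) (hv : v ≤ N) :
    exc N col u v = height col v - height col (u + 1) := by
  unfold exc height
  rw [Finset.sum_filter, Fin.sum_univ_eq_sum_range (fun i => if u < i ∧ i < v then sg (col i) else 0) N,
    ← Finset.sum_Ico_eq_sub _ (by omega), ← Finset.sum_filter]
  congr 1
  ext i
  simp
  omega

theorem height_flow {N : ℕ} {col : ℕ → Bool} {σ : Equiv.Perm (Fin N)}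
    (hcol : ∀ x : Fin N, col (σ x) = !col x) (κ : Bool) (A : Finset (Fin N)) :
    sg κ * ∑ x ∈ A, sg (col x) =
      ((Finset.univ.filter (fun x : Fin N => x ∈ A ∧ col x = κ ∧ σ x ∉ A)).card : ℤ) -
      ((Finset.univ.filter (fun x : Fin N => x ∉ A ∧ col x = κ ∧ σ x ∈ A)).card : ℤ) := by
  have h1 : sg κ * ∑ x ∈ A, sg (col x) =
      ∑ x : Fin N, (if x ∈ A ∧ col x = κ then (1 : ℤ) else 0) -
      ∑ x : Fin N, (if x ∈ A ∧ col x = !κ then (1 : ℤ) else 0) := by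
    rw [← Finset.sum_sub_distrib, Finset.mul_sum, ← Finset.sum_filter_add_sum_filter_not Finset.univ
      (fun x => x ∈ A)]
    rw [Finset.sum_eq_zero (s := Finset.univ.filter (fun x => x ∉ A)), add_zero]
    · rw [Finset.filter_mem_eq_inter, Finset.univ_inter]
      refine Finset.sum_congr rfl fun x hx => ?_
      cases κ <;> cases col x <;> simp [sg, hx]
    · intro x hx
      simp at hx
      simp [hx]
  rw [h1, ← Equiv.sum_comp σ (fun x : Fin N => if x ∈ A ∧ col x = !κ then (1 : ℤ) else 0)]
  simp only [Finset.card_filter, Nat.cast_sum, Nat.cast_ite, Nat.cast_one, Nat.cast_zero]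
  rw [← Finset.sum_sub_distrib, ← Finset.sum_sub_distrib]
  refine Finset.sum_congr rfl fun x _ => ?_
  rw [hcol]
  by_cases h1 : x ∈ A <;> by_cases h2 : σ x ∈ A <;> by_cases h3 : col x = κ <;> simp [h1, h2, h3]

/-- The height conditions satisfied by a special configuration read from `r` at position `0`,
with the other endpoint at position `b`. -/
structure SpCfg {N : ℕ} (col : ℕ → Bool) (b : Fin N) : Prop where
  one_lt : 1 < (b : ℕ)
  lt : (b : ℕ) + 1 < N
  col_zero : col 0 = true
  col_b : col b = false
  low : ∀ j, 1 ≤ j → j ≤ (b : ℕ) → 1 ≤ height col j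
  mid : height col (b + 1) = 0
  high : ∀ j, (b : ℕ) < j → j ≤ N → height col j ≤ 0
  total : height col N = 0

theorem sg_true : sg true = 1 := rfl
theorem sg_false : sg false = -1 := rfl

theorem SpCfg.exc_le {N : ℕ} {col : ℕ → Bool} {b : Fin N} (h : SpCfg col b) {i j : ℕ}
    (hi : 0 < i) (hib : i < b) (hbj : (b : ℕ) < j) (hj : j < N) (hc : col i ≠ col j) :
    exc N col i j ≤ -2 := by
  rw [exc_eq (by omega) hj.le]
  have h1 := h.low i hi hib.le
  have h2 := h.low (i + 1) (by omega) (by omega)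
  have h3 := h.high j hbj hj.le
  have h4 := h.high (j + 1) (by omega) (by omega)
  have h5 := height_succ col i
  have h6 := height_succ col j
  cases hci : col i <;> cases hcj : col j <;> simp [hci, hcj, sg] at hc h5 h6 <;> omega

section Edge

variable {N : ℕ} {col : ℕ → Bool} {b : Fin N} {σ : Equiv.Perm (Fin N)}

/-- Number of edges leaving the open interval `(u, v)` across its chord. -/
def outN (b : Fin N) (σ : Equiv.Perm (Fin N)) (u v : ℕ) : ℕ :=
  (Finset.univ.filter (fun x => OutC b σ u v x)).card

/-- Number of edges entering the open interval `(u, v)` across its chord. -/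
def inN (b : Fin N) (σ : Equiv.Perm (Fin N)) (u v : ℕ) : ℕ :=
  (Finset.univ.filter (fun x => InC b σ u v x)).card

variable (hσ : Adm col b σ) (hcb : col b = false) {e : Fin N} (heb : e ≠ b)
  {u v : ℕ} (hu : u = min (e : ℕ) (σ e)) (hv : v = max (e : ℕ) (σ e))

include hσ heb hu hv in
theorem Adm.col_outC {x : Fin N} (h : OutC b σ u v x) : col x = col e := by
  refine hσ.cls x e h.1 heb ?_
  have := ((cr_iff_outC_or_inC (by omega)).2 (Or.inl h)).2
  subst hu hv
  unfold Cr at *; omega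

include hσ heb hu hv in
theorem Adm.col_inC {x : Fin N} (h : InC b σ u v x) : col x = col e := by
  refine hσ.cls x e h.1 heb ?_
  have := ((cr_iff_outC_or_inC (by omega)).2 (Or.inr h)).2
  subst hu hv
  unfold Cr at *; omega

include hσ hcb heb hu hv in
theorem Adm.exc_eq_sub (h : col e = true ∨ ¬ (u < b ∧ (b : ℕ) < v)) :
    sg (col e) * exc N col u v = (outN b σ u v : ℤ) - inN b σ u v := by
  have hb0 := hσ.hb
  unfold exc
  rw [height_flow hσ.hcol, outN, inN]
  have hne : ∀ {u v : Fin N}, u ≠ v → (u : ℕ) ≠ v := fun h h' => h (Fin.ext h')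
  congr 3
  · ext x
    simp only [Finset.mem_filter, Finset.mem_univ, true_and, not_and, not_lt]
    constructor
    · rintro ⟨⟨h1, h2⟩, h3, h4⟩
      have hxb : x ≠ b := by
        rintro rfl
        rcases h with h | h
        · rw [h3, h] at hcb; simp at hcb
        · exact h ⟨h1, h2⟩
      have a1 : (σ x : ℕ) ≠ e := fun h => by
        have := hσ.hcol x; rw [h, h3] at this; simp at this
      have a2 : (σ x : ℕ) ≠ σ e := hne fun h => by
        have := σ.injective h; subst this; omega
      refine ⟨hxb, h1, h2, ?_⟩
      omega
    · intro hx
      refine ⟨⟨hx.2.1, hx.2.2.1⟩, hσ.col_outC heb hu hv hx, ?_⟩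
      have := hx.2.2.2
      omega
  · ext x
    simp only [Finset.mem_filter, Finset.mem_univ, true_and, not_and, not_lt]
    constructor
    · rintro ⟨h1, h3, h2, h4⟩
      have hxb : x ≠ b := by
        rintro rfl
        omega
      have a1 : (x : ℕ) ≠ σ e := fun h => by
        have := hσ.hcol e; rw [← h, h3] at this; simp at this
      have a2 : (x : ℕ) ≠ e := hne fun h => by
        subst h; omega
      refine ⟨hxb, h2, h4, ?_⟩
      omega
    · intro hx
      refine ⟨?_, hσ.col_inC heb hu hv hx, hx.2.1, hx.2.2.1⟩
      have := hx.2.2.2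
      omega

include hσ hcb heb hu hv in
theorem Adm.exc_bounds : -2 ≤ sg (col e) * exc N col u v ∧ sg (col e) * exc N col u v ≤ 1 ∧
    (col e = false ∨ (e : ℕ) = 0 ∨ ¬ (u < b ∧ (b : ℕ) < v) → -1 ≤ sg (col e) * exc N col u v) := by
  have hb0 := hσ.hb
  have hflow := height_flow hσ.hcol (!col e)
    (Finset.univ.filter (fun x : Fin N => u < (x : ℕ) ∧ (x : ℕ) < v))
  have hsg : sg (!col e) = - sg (col e) := by cases col e <;> rfl
  rw [hsg, neg_mul] at hflow
  have hne : ∀ {u v : Fin N}, u ≠ v → (u : ℕ) ≠ v := fun h h' => h (Fin.ext h')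
  unfold exc
  set A := Finset.univ.filter (fun x : Fin N => u < (x : ℕ) ∧ (x : ℕ) < v) with hA
  set O := Finset.univ.filter (fun x : Fin N => x ∈ A ∧ col x = (!col e) ∧ σ x ∉ A)
  set I := Finset.univ.filter (fun x : Fin N => x ∉ A ∧ col x = (!col e) ∧ σ x ∈ A)
  have hO : ∀ x ∈ O, x = σ⁻¹ e ∨ (x = b ∧ u < b ∧ (b : ℕ) < v ∧ col e = true) := by
    intro x hx
    simp only [O, hA, Finset.mem_filter, Finset.mem_univ, true_and, not_and, not_lt] at hx
    obtain ⟨⟨h1, h2⟩, h3, h4⟩ := hx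
    by_cases hxb : x = b
    · right; subst hxb; exact ⟨rfl, h1, h2, by rw [hcb] at h3; simpa using h3.symm⟩
    left
    by_contra hne'
    have a1 : (σ x : ℕ) ≠ e := hne fun h => hne' (by rw [← h]; simp)
    have a2 : (σ x : ℕ) ≠ σ e := hne fun h => by
        have := σ.injective h; subst this; omega
    have : OutC b σ u v x := ⟨hxb, h1, h2, by omega⟩
    have := hσ.col_outC heb hu hv this
    rw [this] at h3; simp at h3
  have hI : ∀ x ∈ I, x = σ e := by
    intro x hx
    simp only [I, hA, Finset.mem_filter, Finset.mem_univ, true_and, not_and, not_lt] at hx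
    obtain ⟨h1, h3, h2, h4⟩ := hx
    have hxb : x ≠ b := by
      rintro rfl
      omega
    by_contra hne'
    have a1 := hne hne'
    have a2 : (x : ℕ) ≠ e := hne fun h => by
        subst h; omega
    have : InC b σ u v x := ⟨hxb, h2, h4, by omega⟩
    have := hσ.col_inC heb hu hv this
    rw [this] at h3; simp at h3
  have cO : O.card ≤ 2 := by
    refine (Finset.card_le_card (t := {σ⁻¹ e, b}) fun x hx => ?_).trans Finset.card_le_two
    rcases hO x hx with h | h <;> simp [h]
  have cI : I.card ≤ 1 := by
    refine (Finset.card_le_card (t := {σ e}) fun x hx => ?_).trans (by simp)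
    simp [hI x hx]
  refine ⟨by omega, by omega, fun h => ?_⟩
  have cO : O.card ≤ 1 := by
    refine (Finset.card_le_card (t := {σ⁻¹ e}) fun x hx => ?_).trans (by simp)
    rcases hO x hx with h1 | ⟨h1, h2, h3, h4⟩
    · simp [h1]
    rcases h with h | h | h
    · rw [h] at h4; simp at h4
    · have : σ b = e := Fin.ext (by omega)
      simp [h1, ← this]
    · exact absurd ⟨h2, h3⟩ h
  omega

end Edge

section

variable {N : ℕ} {col : ℕ → Bool} {b : Fin N} {σ : Equiv.Perm (Fin N)}

/-- In an admissible permutation every edge crossing the virtual edge is red and has excess `-2`. -/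
theorem Adm.crossing_virtual (hs : SpCfg col b) (hσ : Adm col b σ) {e : Fin N} (heb : e ≠ b)
    {u v : ℕ} (hu : u = min (e : ℕ) (σ e)) (hv : v = max (e : ℕ) (σ e))
    (hcr : Cr e (σ e) 0 b) :
    col e = true ∧ exc N col u v = -2 ∧ inN b σ u v = outN b σ u v + 2 := by
  have h1 := hσ.exc_bounds hs.col_b heb hu hv
  have hc := hσ.hcol e
  have h2 : exc N col u v ≤ -2 := by
    have := e.2
    have := (σ e).2
    refine hs.exc_le ?_ ?_ ?_ ?_ ?_
    · subst hu; unfold Cr at hcr; omega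
    · subst hu; unfold Cr at hcr; omega
    · subst hv; unfold Cr at hcr; omega
    · subst hv; omega
    · rcases le_total (e : ℕ) (σ e) with h | h <;> simp only [h, min_eq_left, max_eq_right,
        min_eq_right, max_eq_left] at hu hv <;> subst hu hv <;> rw [hc] <;> simp
  have h3 : col e = true := by
    by_contra h
    simp only [Bool.not_eq_true] at h
    simp [h, sg] at h1
    omega
  have h4 := hσ.exc_eq_sub hs.col_b heb hu hv (Or.inl h3)
  rw [h3, sg_true] at h1 h4
  refine ⟨h3, ?_, ?_⟩ <;> omega

theorem Adm.not_crossing_virtual (hs : SpCfg col b) (hσ : Adm col b σ) {e : Fin N} (heb : e ≠ b)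
    {u v : ℕ} (hu : u = min (e : ℕ) (σ e)) (hv : v = max (e : ℕ) (σ e))
    (hcr : ¬ Cr e (σ e) 0 b) :
    inN b σ u v ≤ outN b σ u v + 1 ∧ outN b σ u v ≤ inN b σ u v + 1 := by
  have h1 := hσ.exc_bounds hs.col_b heb hu hv
  have key : u < b ∧ (b : ℕ) < v → (e : ℕ) = 0 := by
    intro h
    have h5 : (σ e : ℕ) ≠ 0 := fun h => heb (σ.injective (Fin.ext (h.trans hσ.hb.symm)))
    unfold Cr at hcr
    omega
  have h2 := h1.2.2 (by tauto)
  have h4 := hσ.exc_eq_sub hs.col_b heb hu hv (by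
    by_cases h : u < b ∧ (b : ℕ) < v
    · left; rw [key h]; exact hs.col_zero
    · exact Or.inr h)
  omega

/-- Crossings of an edge counted through its tail. -/
def crossers (b : Fin N) (σ : Equiv.Perm (Fin N)) (e : Fin N) : ℕ := ∑ y, iot b σ e y

theorem crossers_eq {e : Fin N} (heb : e ≠ b)
    {u v : ℕ} (hu : u = min (e : ℕ) (σ e)) (hv : v = max (e : ℕ) (σ e)) :
    crossers b σ e = outN b σ u v + inN b σ u v := by
  unfold crossers outN inN
  rw [← Finset.card_union_of_disjoint, ← Finset.filter_or, Finset.card_filter]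
  · refine Finset.sum_congr rfl fun y _ => ?_
    unfold iot
    congr 1
    rw [← cr_iff_outC_or_inC (by omega)]
    simp only [eq_iff_iff, heb, ne_eq, not_false_eq_true, true_and]
    refine and_congr_right fun _ => ?_
    subst hu hv; unfold Cr; omega
  · rw [Finset.disjoint_filter]
    intro x _ h1 h2
    exact h1.ne_inC h2 rfl

/-- Lower bound on the potential of admissible permutations. -/
theorem Adm.le_pot (hs : SpCfg col b) (hσ : Adm col b σ) : N + 2 ≤ pot b σ + linChg col N := by
  induction hn : cr2 b σ using Nat.strong_induction_on generalizing σ with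
  | _ n ih =>
  by_cases hc : ∃ x y : Fin N, x ≠ b ∧ y ≠ b ∧ Cr x (σ x) y (σ y)
  · obtain ⟨p, t, hp, ht, hcr⟩ := hc
    have hpw := crossing_swap_pointwise hp ht hcr
    have h1 := hσ.mul_swap hp ht (hσ.cls p t hp ht hcr) hpw
    have h2 := cr2_mul_swap_le (b := b) σ (ne_of_cr hcr) ∅ (by simp) (by simp) 0 1 (by simpa using hpw)
      (iot_crossing_swap hp ht hcr)
    have h3 := orbNum_mul_swap_le σ p t
    simp only [Finset.card_empty] at h2
    have h4 := ih (cr2 b (σ * Equiv.swap p t)) (by omega) h1 rfl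
    unfold pot at *
    omega
  · push Not at hc
    have hv : ∀ x, x ≠ b → ¬ Cr x (σ x) 0 b := by
      intro x hx hcr
      have h1 := hσ.crossing_virtual hs hx rfl rfl hcr
      have h2 := crossers_eq (σ := σ) hx rfl rfl
      have h3 : crossers b σ x = 0 := Finset.sum_eq_zero fun y _ => by
        unfold iot; rw [if_neg]; rintro ⟨g1, g2, g3⟩; exact hc x y g1 g2 g3
      omega
    have hsym : ∀ a c : ℕ, Cr a c b 0 ↔ Cr a c 0 b := fun a c => by
      unfold Cr; rw [min_comm, max_comm]; simp
    have hnc : ∀ x y : Fin N, ¬ Cr x (σ x) y (σ y) := by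
      intro x y h
      by_cases hx : x = b
      · by_cases hy : y = b
        · subst hx hy; exact not_cr_self h
        · rw [hx, hσ.hb, cr_comm, hsym] at h; exact hv y hy h
      · by_cases hy : y = b
        · rw [hy, hσ.hb, hsym] at h; exact hv x hx h
        · exact hc x y hx hy h
    have hlt := hs.lt
    have h0 : col (N - 1) = col 0 := by
      have h1 := height_succ col (N - 1)
      rw [Nat.sub_add_cancel (by omega), hs.total] at h1
      have h2 := hs.high (N - 1) (by omega) (by omega)
      rw [hs.col_zero]
      by_contra h
      simp [h, sg] at h1
      omega
    have := noncrossing_bound (by omega) h0 hσ.hcol hnc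
    unfold pot
    omega

end

section

variable {N : ℕ} {col : ℕ → Bool} {b : Fin N} {σ : Equiv.Perm (Fin N)}

theorem outN_eq_zero {u v : ℕ} (h : ∀ x, ¬ OutC b σ u v x) : outN b σ u v = 0 := by
  simp [outN, h]

theorem inN_eq_zero {u v : ℕ} (h : ∀ x, ¬ InC b σ u v x) : inN b σ u v = 0 := by
  simp [inN, h]

theorem outN_pos {u v : ℕ} {x : Fin N} (h : OutC b σ u v x) : 0 < outN b σ u v :=
  Finset.card_pos.2 ⟨x, by simp [h]⟩

theorem inN_pos {u v : ℕ} {x : Fin N} (h : InC b σ u v x) : 0 < inN b σ u v :=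
  Finset.card_pos.2 ⟨x, by simp [h]⟩

theorem exists_outC {u v : ℕ} (h : 0 < outN b σ u v) : ∃ x, OutC b σ u v x := by
  obtain ⟨x, hx⟩ := Finset.card_pos.1 h
  exact ⟨x, by simpa using hx⟩

theorem Tight.crossing_virtual (hs : SpCfg col b) (hσ : Tight col b σ) {e : Fin N} (heb : e ≠ b)
    {u v : ℕ} (hu : u = min (e : ℕ) (σ e)) (hv : v = max (e : ℕ) (σ e))
    (hcr : Cr e (σ e) 0 b) : outN b σ u v = 0 ∧ inN b σ u v = 2 := by
  have h1 := hσ.1.crossing_virtual hs heb hu hv hcr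
  rcases hσ.one_way heb hu hv with h | h
  · have := outN_eq_zero h; omega
  · have := inN_eq_zero h; omega

/-- A red edge of excess zero crossed in one direction is crossed in the other one. -/
theorem Adm.outC_of_inC (hcb : col b = false) (hσ : Adm col b σ) {e : Fin N} (heb : e ≠ b)
    {u v : ℕ} (hu : u = min (e : ℕ) (σ e)) (hv : v = max (e : ℕ) (σ e)) (he : col e = true)
    (h0 : exc N col u v = 0) {f : Fin N} (hf : InC b σ u v f) : ∃ x, OutC b σ u v x := by
  have h1 := hσ.exc_eq_sub hcb heb hu hv (Or.inl he)
  rw [h0] at h1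
  have := inN_pos hf
  exact exists_outC (by omega)

theorem Tight.not_inC (hcb : col b = false) (hσ : Tight col b σ) {e : Fin N} (heb : e ≠ b)
    {u v : ℕ} (hu : u = min (e : ℕ) (σ e)) (hv : v = max (e : ℕ) (σ e)) (he : col e = true)
    (h0 : exc N col u v = 0) (f : Fin N) : ¬ InC b σ u v f := by
  intro hf
  rcases hσ.one_way heb hu hv with h | h
  · obtain ⟨x, hx⟩ := hσ.1.outC_of_inC hcb heb hu hv he h0 hf
    exact h x hx
  · exact h f hf

theorem tight_no_crossing_pair (hs : SpCfg col b) (hσ : Tight col b σ) {p t : Fin N}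
    (hpb : p ≠ b) (htb : t ≠ b) (hp : col p = true) (ht : col t = true)
    (h1 : 0 < (p : ℕ)) (h2 : (p : ℕ) < σ t) (h3 : (σ t : ℕ) < b) (h4 : (b : ℕ) < σ p)
    (h5 : (σ p : ℕ) < t) (e1 : height col p = 1) (e2 : height col (t + 1) = 0)
    (d1 : exc N col p (σ t) = 0) (d2 : exc N col (σ p) t = 0) : False := by
  have hcr : Cr p (σ p) t (σ t) := by unfold Cr; omega
  have hpt := ne_of_cr hcr
  have hpw := crossing_swap_pointwise hpb htb hcr
  have hτ := hσ.1.mul_swap hpb htb (hp.trans ht.symm) hpw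
  have hio := iot_crossing_swap hpb htb hcr
  have hK := orbNum_mul_swap_le σ p t
  have hτt : Tight col b (σ * Equiv.swap p t) := by
    refine ⟨hτ, fun ρ hρ => le_trans ?_ (hσ.2 ρ hρ)⟩
    have := cr2_mul_swap_le (b := b) σ hpt ∅ (by simp) (by simp) 0 1 (by simpa using hpw) hio
    simp only [Finset.card_empty] at this
    unfold pot
    omega
  have n1 := hτt.not_inC hs.col_b hpb (u := p) (v := σ t) (by rw [mul_swap_left]; omega)
    (by rw [mul_swap_left]; omega) hp d1
  have n2 := hτt.not_inC hs.col_b htb (u := σ p) (v := t) (by rw [mul_swap_right]; omega)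
    (by rw [mul_swap_right]; omega) ht d2
  have hflow := height_flow hσ.1.hcol true
    (Finset.univ.filter (fun x : Fin N => (p : ℕ) ≤ x ∧ (x : ℕ) ≤ t))
  have hsum : ∑ x ∈ Finset.univ.filter (fun x : Fin N => (p : ℕ) ≤ x ∧ (x : ℕ) ≤ t), sg (col x) = -1 := by
    have := exc_eq (N := N) (col := col) (u := (p : ℕ) - 1) (v := (t : ℕ) + 1) (by omega)
      (by have := t.2; omega)
    rw [Nat.sub_add_cancel h1, e1, e2] at this
    unfold exc at this
    rw [show (-1 : ℤ) = 0 - 1 by norm_num, ← this]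
    congr 1
    ext x; simp; omega
  rw [hsum, sg_true] at hflow
  have hpos : 0 < (Finset.univ.filter (fun x : Fin N =>
      x ∉ (Finset.univ.filter (fun x : Fin N => (p : ℕ) ≤ x ∧ (x : ℕ) ≤ t)) ∧ col x = true ∧
      σ x ∈ (Finset.univ.filter (fun x : Fin N => (p : ℕ) ≤ x ∧ (x : ℕ) ≤ t)))).card := by
    omega
  obtain ⟨x, hx⟩ := Finset.card_pos.1 hpos
  simp only [Finset.mem_filter, Finset.mem_univ, true_and, not_and, not_le] at hx
  obtain ⟨g1, g2, g3, g4⟩ := hx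
  have hne : ∀ {u v : Fin N}, u ≠ v → (u : ℕ) ≠ v := fun h h' => h (Fin.ext h')
  have xp : x ≠ p := by rintro rfl; omega
  have xt : x ≠ t := by rintro rfl; omega
  have xb : x ≠ b := by rintro rfl; rw [hs.col_b] at g2; simp at g2
  have hcx := hσ.1.hcol x
  rw [g2] at hcx
  have k1 : (σ x : ℕ) ≠ p := fun h => by rw [h, hp] at hcx; simp at hcx
  have k2 : (σ x : ℕ) ≠ t := fun h => by rw [h, ht] at hcx; simp at hcx
  have k3 := hne (fun h => xp (σ.injective h))
  have k4 := hne (fun h => xt (σ.injective h))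
  have m1 := n1 x
  have m2 := n2 x
  unfold InC at m1 m2
  rw [mul_swap_ne xp xt] at m1 m2
  have k5 : (σ t : ℕ) < σ x := by
    by_contra h
    exact m1 ⟨xb, by omega, by omega, by omega⟩
  have k6 : (σ x : ℕ) < σ p := by
    by_contra h
    exact m2 ⟨xb, by omega, by omega, by omega⟩
  have := cr2_mul_swap_le (b := b) σ hpt {x} (by simpa using xp.symm) (by simpa using xt.symm) 2 1 ?_ hio
  · have := hσ.2 _ hτ
    simp only [Finset.card_singleton] at *
    unfold pot at *
    omega
  · intro z z1 z2
    by_cases hzx : z = x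
    · subst hzx
      simp only [Finset.mem_singleton, if_true]
      rw [iot_eq xb hpb, iot_eq xb htb, iot_eq xb hpb, iot_eq xb htb, mul_swap_left,
        mul_swap_right, mul_swap_ne z1 z2, if_neg, if_neg, if_pos, if_pos] <;>
      unfold Cr <;> omega
    · have := hpw z z1 z2
      simpa [hzx] using this

theorem tight_no_nested_pair (hs : SpCfg col b) (hσ : Tight col b σ) {p t : Fin N}
    (hpb : p ≠ b) (htb : t ≠ b) (hp : col p = true) (ht : col t = true)
    (hp0 : 0 < (p : ℕ)) (hp1 : (p : ℕ) < b) (ht0 : (b : ℕ) < t)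
    (hs0 : 0 < (σ t : ℕ)) (hs1 : (σ t : ℕ) < b) (hq0 : (b : ℕ) < σ p)
    (hpw : ∀ z, z ≠ p → z ≠ t →
      iot b (σ * Equiv.swap p t) z p + iot b (σ * Equiv.swap p t) z t
        ≤ iot b σ z p + iot b σ z t)
    (hio : iot b (σ * Equiv.swap p t) p t = 0)
    {a1 a2 a3 a4 : ℕ} (ha1 : a1 = min (p : ℕ) (σ t)) (ha2 : a2 = max (p : ℕ) (σ t))
    (ha3 : a3 = min (t : ℕ) (σ p)) (ha4 : a4 = max (t : ℕ) (σ p))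
    (hor : ((p : ℕ) < σ t ∧ (t : ℕ) < σ p) ∨ ((σ t : ℕ) < p ∧ (σ p : ℕ) < t))
    (d1 : exc N col a1 a2 = 0) (d2 : exc N col a3 a4 = 0) : False := by
  have hpt : p ≠ t := by rintro rfl; omega
  have hτ := hσ.1.mul_swap hpb htb (hp.trans ht.symm) hpw
  have hK := orbNum_mul_swap_le σ p t
  have hin : inN b σ a1 a4 = 2 := by
    rcases hor with h | h
    · exact (hσ.crossing_virtual hs hpb (by omega) (by omega) (by unfold Cr; omega)).2
    · exact (hσ.crossing_virtual hs htb (by omega) (by omega) (by unfold Cr; omega)).2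
  have hne : ∀ {u v : Fin N}, u ≠ v → (u : ℕ) ≠ v := fun h h' => h (Fin.ext h')
  have hcr2 := cr2_mul_swap_le (b := b) σ hpt ∅ (by simp) (by simp) 0 0 (by simpa using hpw)
    (by omega)
  simp only [Finset.card_empty] at hcr2
  have hf : ∀ f, InC b σ a1 a4 f → f ≠ p ∧ f ≠ t ∧
      ((a1 < σ f ∧ σ f < a2) ∨ (a3 < σ f ∧ σ f < a4)) := by
    intro x hx
    have xp : x ≠ p := by rintro rfl; have := hx.2.2.2; omega
    have xt : x ≠ t := by rintro rfl; have := hx.2.2.2; omega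
    refine ⟨xp, xt, ?_⟩
    have xb := hx.1
    have hcx : col x = true := by
      rcases hor with h | h
      · rw [← hp]; exact hσ.1.col_inC hpb (by omega) (by omega) hx
      · rw [← ht]; exact hσ.1.col_inC htb (by omega) (by omega) hx
    have hcx' := hσ.1.hcol x
    rw [hcx] at hcx'
    have k1 : (σ x : ℕ) ≠ p := fun h => by rw [h, hp] at hcx'; simp at hcx'
    have k2 : (σ x : ℕ) ≠ t := fun h => by rw [h, ht] at hcx'; simp at hcx'
    have k3 := hne (fun h => xp (σ.injective h))
    have k4 := hne (fun h => xt (σ.injective h))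
    obtain ⟨-, x1, x2, x3⟩ := hx
    by_contra hcon
    have := cr2_mul_swap_le (b := b) σ hpt {x} (by simpa using xp.symm) (by simpa using xt.symm) 2 0
      ?_ (by omega)
    · have := hσ.2 _ hτ
      simp only [Finset.card_singleton] at *
      unfold pot at *
      omega
    · intro z z1 z2
      by_cases hzx : z = x
      · subst hzx
        simp only [Finset.mem_singleton, if_true]
        rw [iot_eq xb hpb, iot_eq xb htb, iot_eq xb hpb, iot_eq xb htb, mul_swap_left,
          mul_swap_right, mul_swap_ne z1 z2, if_neg, if_neg, if_pos, if_pos] <;>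
        unfold Cr <;> omega
      · have := hpw z z1 z2
        simpa [hzx] using this
  obtain ⟨f1, f2, hf12, hff⟩ := Finset.card_eq_two.1 hin
  have hf1 : InC b σ a1 a4 f1 := by
    have : f1 ∈ Finset.univ.filter (fun x => InC b σ a1 a4 x) := by rw [hff]; simp
    simpa using this
  have hf2 : InC b σ a1 a4 f2 := by
    have : f2 ∈ Finset.univ.filter (fun x => InC b σ a1 a4 x) := by rw [hff]; simp
    simpa using this
  set τ := σ * Equiv.swap p t with hτdef
  have τp : τ p = σ t := mul_swap_left
  have τt : τ t = σ p := mul_swap_right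
  -- an edge entering `(a1, a4)` in `σ` crosses one of the two new edges
  have hcross : ∀ ρ : Equiv.Perm (Fin N), ∀ f, InC b σ a1 a4 f → ρ f = σ f →
      InC b ρ a1 a2 f ∨ InC b ρ a3 a4 f := by
    intro ρ f hf' hρ
    have h1 := hf f hf'
    obtain ⟨h2, h3, h4, h5⟩ := hf'
    unfold InC
    rw [hρ]
    rcases h1.2.2 with h | h
    · left; exact ⟨h2, h.1, h.2, by omega⟩
    · right; exact ⟨h2, h.1, h.2, by omega⟩
  have hstep : ∃ p' t', Adm col b (τ * Equiv.swap p' t') ∧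
      pot b (τ * Equiv.swap p' t') + 2 ≤ pot b τ ∧ p' ≠ p ∧ p' ≠ t ∧ t' ≠ p ∧ t' ≠ t ∧
      p' ≠ f1 ∧ p' ≠ f2 := by
    have g1 := hf1.2.2.2
    have g2 := hf2.2.2.2
    rcases hcross τ f1 hf1 (mul_swap_ne (hf f1 hf1).1 (hf f1 hf1).2.1) with h | h
    · have hu : a1 = min (p : ℕ) (τ p) := by rw [τp]; exact ha1
      have hv : a2 = max (p : ℕ) (τ p) := by rw [τp]; exact ha2
      have ho := hτ.outC_of_inC hs.col_b hpb hu hv hp d1 h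
      obtain ⟨p', t', o, i, h1, h2⟩ := exists_inout_swap_edge hτ hpb hu hv ho ⟨_, h⟩
      obtain ⟨-, o1, o2, o3⟩ := o
      obtain ⟨-, i1, i2, i3⟩ := i
      refine ⟨p', t', h1, h2, ?_, ?_, ?_, ?_, ?_, ?_⟩ <;> rintro rfl <;> omega
    · have hu : a3 = min (t : ℕ) (τ t) := by rw [τt]; exact ha3
      have hv : a4 = max (t : ℕ) (τ t) := by rw [τt]; exact ha4
      have ho := hτ.outC_of_inC hs.col_b htb hu hv ht d2 h
      obtain ⟨p', t', o, i, h1, h2⟩ := exists_inout_swap_edge hτ htb hu hv ho ⟨_, h⟩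
      obtain ⟨-, o1, o2, o3⟩ := o
      obtain ⟨-, i1, i2, i3⟩ := i
      refine ⟨p', t', h1, h2, ?_, ?_, ?_, ?_, ?_, ?_⟩ <;> rintro rfl <;> omega
  obtain ⟨p', t', hρ, hpot, k1, k2, k3, k4, k5, k6⟩ := hstep
  set ρ := τ * Equiv.swap p' t' with hρdef
  have hρt : Tight col b ρ := by
    refine ⟨hρ, fun μ hμ => le_trans ?_ (hσ.2 μ hμ)⟩
    unfold pot at *
    omega
  have ρp : ρ p = σ t := (mul_swap_ne k1.symm k3.symm).trans τp
  have ρt : ρ t = σ p := (mul_swap_ne k2.symm k4.symm).trans τt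
  have m1 := hρt.not_inC hs.col_b hpb (u := a1) (v := a2) (by rw [ρp]; exact ha1)
    (by rw [ρp]; exact ha2) hp d1
  have m2 := hρt.not_inC hs.col_b htb (u := a3) (v := a4) (by rw [ρt]; exact ha3)
    (by rw [ρt]; exact ha4) ht d2
  have hfin : ∀ f, InC b σ a1 a4 f → f ≠ p' → f ≠ t' → False := by
    intro f h1 h2 h3
    have h4 := hf f h1
    rcases hcross ρ f h1 ((mul_swap_ne h2 h3).trans (mul_swap_ne h4.1 h4.2.1)) with h | h
    · exact m1 f h
    · exact m2 f h
  by_cases h : f1 = t'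
  · exact hfin f2 hf2 k6.symm (fun h' => hf12 (h.trans h'.symm))
  · exact hfin f1 hf1 k5.symm h

theorem tight_crossing_virtual_unique (hs : SpCfg col b) (hσ : Tight col b σ) {e₁ e₂ : Fin N}
    (h₁ : e₁ ≠ b) (h₂ : e₂ ≠ b) (hc₁ : Cr e₁ (σ e₁) 0 b) (hc₂ : Cr e₂ (σ e₂) 0 b) : e₁ = e₂ := by
  by_contra hne12
  have hone := hs.one_lt
  have hne : ∀ {u v : Fin N}, u ≠ v → (u : ℕ) ≠ v := fun h h' => h (Fin.ext h')
  have hred : ∀ x, x ≠ b → Cr x (σ x) 0 b → col x = true := fun x hx hc =>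
    (hσ.1.crossing_virtual hs hx rfl rfl hc).1
  have hb1 : height col b = 1 := by
    have := height_succ col b
    rw [hs.mid, hs.col_b, sg_false] at this
    omega
  have h01 : height col 1 = 1 := by simp [height, hs.col_zero, sg]
  have hexc : exc N col 0 b = 0 := by
    rw [exc_eq (by omega) b.2.le, hb1, h01]; rfl
  have hflow := height_flow hσ.1.hcol true
    (Finset.univ.filter (fun x : Fin N => 0 < (x : ℕ) ∧ (x : ℕ) < b))
  unfold exc at hexc
  rw [hexc, mul_zero] at hflow
  set A := Finset.univ.filter (fun x : Fin N => 0 < (x : ℕ) ∧ (x : ℕ) < b) with hA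
  set O := Finset.univ.filter (fun x : Fin N => x ∈ A ∧ col x = true ∧ σ x ∉ A) with hO
  set I := Finset.univ.filter (fun x : Fin N => x ∉ A ∧ col x = true ∧ σ x ∈ A) with hI
  have hσ0 : ∀ x, x ≠ b → (σ x : ℕ) ≠ 0 := fun x hx h =>
    hx (σ.injective (Fin.ext (h.trans hσ.1.hb.symm)))
  have hOutO : ∀ x, OutC b σ 0 b x → x ∈ O := by
    intro x hx
    have := hred x hx.1 ((cr_iff_outC_or_inC (by omega)).2 (Or.inl hx)).2
    obtain ⟨-, x1, x2, x3⟩ := hx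
    simp only [hO, hA, Finset.mem_filter, Finset.mem_univ, true_and]
    exact ⟨⟨x1, x2⟩, this, by omega⟩
  have hInI : ∀ x, InC b σ 0 b x → x ∈ I := by
    intro x hx
    have := hred x hx.1 ((cr_iff_outC_or_inC (by omega)).2 (Or.inr hx)).2
    obtain ⟨-, x1, x2, x3⟩ := hx
    simp only [hI, hA, Finset.mem_filter, Finset.mem_univ, true_and]
    exact ⟨by omega, this, x1, x2⟩
  have hOO : ∀ x ∈ O, x = σ⁻¹ b ∨ OutC b σ 0 b x := by
    intro x hx
    simp only [hO, hA, Finset.mem_filter, Finset.mem_univ, true_and] at hx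
    obtain ⟨⟨x1, x2⟩, x3, x4⟩ := hx
    have xb : x ≠ b := by rintro rfl; omega
    by_cases h : σ x = b
    · left; rw [← h]; simp
    · right
      have := hne h
      have := hσ0 x xb
      exact ⟨xb, x1, x2, by omega⟩
  have hII : ∀ x ∈ I, x = ⟨0, by have := b.2; omega⟩ ∨ InC b σ 0 b x := by
    intro x hx
    simp only [hI, hA, Finset.mem_filter, Finset.mem_univ, true_and] at hx
    obtain ⟨x1, x2, x3, x4⟩ := hx
    have xb : x ≠ b := by rintro rfl; rw [hs.col_b] at x2; simp at x2
    by_cases h : (x : ℕ) = 0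
    · left; exact Fin.ext h
    · right
      have := hne xb
      exact ⟨xb, x3, x4, by omega⟩
  have hmem : ∀ x, x ≠ b → Cr x (σ x) 0 b → OutC b σ 0 b x ∨ InC b σ 0 b x := fun x h h' =>
    (cr_iff_outC_or_inC (by omega)).1 ⟨h, h'⟩
  have hout : ∃ x, OutC b σ 0 b x := by
    by_contra! hcon
    have cO : O.card ≤ 1 := by
      refine (Finset.card_le_card (t := {σ⁻¹ b}) fun x hx => ?_).trans (by simp)
      rcases hOO x hx with h | h
      · simp [h]
      · exact absurd h (hcon x)
    have cI : 2 ≤ I.card := by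
      rw [← Finset.card_pair hne12]
      refine Finset.card_le_card fun x hx => ?_
      simp only [Finset.mem_insert, Finset.mem_singleton] at hx
      rcases hx with rfl | rfl
      · exact hInI _ ((hmem _ h₁ hc₁).resolve_left (hcon _))
      · exact hInI _ ((hmem _ h₂ hc₂).resolve_left (hcon _))
    omega
  have hin : ∃ x, InC b σ 0 b x := by
    by_contra! hcon
    have cI : I.card ≤ 1 := by
      refine (Finset.card_le_card (t := {⟨0, by have := b.2; omega⟩}) fun x hx => ?_).trans (by simp)
      rcases hII x hx with h | h
      · simp [h]
      · exact absurd h (hcon x)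
    have cO : 2 ≤ O.card := by
      rw [← Finset.card_pair hne12]
      refine Finset.card_le_card fun x hx => ?_
      simp only [Finset.mem_insert, Finset.mem_singleton] at hx
      rcases hx with rfl | rfl
      · exact hOutO _ ((hmem _ h₁ hc₁).resolve_right (hcon _))
      · exact hOutO _ ((hmem _ h₂ hc₂).resolve_right (hcon _))
    omega
  obtain ⟨p, t, hpo, hti, hp, ht, hpw, hio⟩ :=
    exists_inout_swap hσ.1 (Nat.zero_le b) (κ := true) hred hout hin
  obtain ⟨hpb, p1, p2, p3⟩ := hpo
  obtain ⟨htb, t1, t2, t3⟩ := hti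
  have cp := hσ.1.hcol p
  have ct := hσ.1.hcol t
  rw [hp] at cp
  rw [ht] at ct
  have xp := (hσ.1.crossing_virtual hs hpb (u := p) (v := σ p) (by omega) (by omega)
    (by unfold Cr; omega)).2.1
  have xt := (hσ.1.crossing_virtual hs htb (u := σ t) (v := t) (by omega) (by omega)
    (by unfold Cr; omega)).2.1
  have lt1 := t.2
  have lq1 := (σ p).2
  rw [exc_eq (by omega) (by omega)] at xp xt
  have sp := height_succ col p
  have st := height_succ col t
  have sq := height_succ col (σ p)
  have ss := height_succ col (σ t)
  rw [hp, sg_true] at sp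
  rw [ht, sg_true] at st
  rw [cp] at sq
  rw [ct] at ss
  simp only [Bool.not_true, sg_false] at sq ss
  have l1 := hs.low p p1 p2.le
  have l2 := hs.low (σ t + 1) (by omega) (by omega)
  have l3 := hs.high (σ p) (by omega) (by omega)
  have l4 := hs.high (t + 1) (by omega) (by omega)
  have nps : (p : ℕ) ≠ σ t := fun h => by rw [← h, hp] at ct; simp at ct
  have nqt : (σ p : ℕ) ≠ t := fun h => by rw [h, ht] at cp; simp at cp
  rcases lt_or_gt_of_ne nps with h | h <;> rcases lt_or_gt_of_ne nqt with h' | h'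
  · exact tight_no_crossing_pair hs hσ hpb htb hp ht p1 h t2 (by omega) h' (by omega) (by omega)
      (by rw [exc_eq h (by omega)]; omega) (by rw [exc_eq h' (by omega)]; omega)
  · refine tight_no_nested_pair hs hσ hpb htb hp ht p1 p2 (by omega) t1 t2 (by omega) hpw hio
      (a1 := p) (a2 := σ t) (a3 := t) (a4 := σ p) (by omega) (by omega) (by omega) (by omega)
      (by omega) (by rw [exc_eq h (by omega)]; omega) (by rw [exc_eq h' (by omega)]; omega)
  · refine tight_no_nested_pair hs hσ hpb htb hp ht p1 p2 (by omega) t1 t2 (by omega) hpw hio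
      (a1 := σ t) (a2 := p) (a3 := σ p) (a4 := t) (by omega) (by omega) (by omega) (by omega)
      (by omega) (by rw [exc_eq h (by omega)]; omega) (by rw [exc_eq h' (by omega)]; omega)
  · have h0 := (hσ.crossing_virtual hs hpb (u := p) (v := σ p) (by omega) (by omega)
      (by unfold Cr; omega)).1
    have : OutC b σ p (σ p) t := ⟨htb, by omega, by omega, by omega⟩
    have := outN_pos this
    omega

theorem exists_crossing_virtual (hs : SpCfg col b) (hσ : Adm col b σ) (hK : orbNum σ = 1) :
    ∃ e, e ≠ b ∧ Cr e (σ e) 0 b := by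
  by_contra! hcon
  have h1 := hs.one_lt
  have h2 := hs.lt
  have hne : ∀ {u v : Fin N}, u ≠ v → (u : ℕ) ≠ v := fun h h' => h (Fin.ext h')
  have hsc : ∀ x y, σ.SameCycle x y := by
    intro x y
    rw [← orb_eq_iff]
    obtain ⟨O, hO⟩ := Finset.card_eq_one.1 hK
    have : ∀ z, orb σ z = O := fun z => by
      have : orb σ z ∈ Finset.univ.image (orb σ) := by simp
      rw [hO] at this
      simpa using this
    rw [this, this]
  have hσ0 : ∀ x, x ≠ b → (σ x : ℕ) ≠ 0 := fun x hx h =>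
    hx (σ.injective (Fin.ext (h.trans hσ.hb.symm)))
  by_cases hX : (σ⁻¹ b : ℕ) < b
  · have := sameCycle_induction (P := fun w => (b : ℕ) < w) (a := ⟨b + 1, h2⟩) (c := b) ?_
      (hsc _ _) (by simp)
    · exact lt_irrefl _ this
    intro w _ hw
    have wb : w ≠ b := by rintro rfl; omega
    have a1 := hcon w wb
    have a2 := hσ0 w wb
    have a3 : (σ w : ℕ) ≠ b := hne fun h => by rw [← h] at hX; simp at hX; omega
    unfold Cr at a1
    omega
  · have := sameCycle_induction (P := fun w => 0 < (w : ℕ) ∧ (w : ℕ) < b)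
      (a := ⟨1, by omega⟩) (c := b) ?_ (hsc _ _) (by simpa using h1)
    · exact lt_irrefl _ this.2
    intro w _ hw
    have wb : w ≠ b := by rintro rfl; omega
    have a1 := hcon w wb
    have a2 := hσ0 w wb
    have a3 : (σ w : ℕ) ≠ b := hne fun h => by rw [← h] at hX; simp at hX; omega
    unfold Cr at a1
    omega

/-- Crossing distribution of tight cyclic permutations. -/
theorem tight_structure (hs : SpCfg col b) (hσ : Tight col b σ) (hK : orbNum σ = 1) :
    ∃ e, e ≠ b ∧ crossers b σ e = 2 ∧ ∀ y, y ≠ b → y ≠ e → crossers b σ y ≤ 1 := by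
  obtain ⟨e, heb, hcr⟩ := exists_crossing_virtual hs hσ.1 hK
  refine ⟨e, heb, ?_, ?_⟩
  · rw [crossers_eq heb rfl rfl]
    have := hσ.crossing_virtual hs heb rfl rfl hcr
    omega
  · intro y hyb hye
    have hn : ¬ Cr y (σ y) 0 b := fun h => hye (tight_crossing_virtual_unique hs hσ hyb heb h hcr)
    rw [crossers_eq hyb rfl rfl]
    have h1 := hσ.1.not_crossing_virtual hs hyb rfl rfl hn
    rcases hσ.one_way hyb rfl rfl with h | h
    · have := outN_eq_zero h; omega
    · have := inN_eq_zero h; omega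

end

/-- Crossings between an edge and the edges of a list. -/
def xes (e : ℕ × ℕ) (F : List (ℕ × ℕ)) : ℕ := (F.map (fun f => ic e.1 e.2 f.1 f.2)).sum

/-- Crossings between two lists of edges. -/
def xee (E F : List (ℕ × ℕ)) : ℕ := (E.map (fun e => xes e F)).sum

/-- Crossings within a list of edges. -/
def ecr : List (ℕ × ℕ) → ℕ
  | [] => 0
  | e :: E => xes e E + ecr E

/-- The edges of a path, each one with its endpoints in increasing order. -/
def pe : List ℕ → List (ℕ × ℕ)
  | [] => []
  | [_] => []
  | a :: b :: l => (min a b, max a b) :: pe (b :: l)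

theorem ic_comm (a b c d : ℕ) : ic a b c d = ic c d a b := by
  unfold ic
  congr 1
  unfold Cr
  simp only [eq_iff_iff]
  omega

theorem ic_minmax_left (a b c d : ℕ) : ic (min a b) (max a b) c d = ic a b c d := by
  unfold ic
  congr 1
  unfold Cr
  simp only [eq_iff_iff]
  omega

theorem ic_minmax_right (a b c d : ℕ) : ic c d (min a b) (max a b) = ic c d a b := by
  rw [ic_comm, ic_minmax_left, ic_comm]

@[simp] theorem xes_nil (e : ℕ × ℕ) : xes e [] = 0 := rfl
@[simp] theorem xes_cons (e f : ℕ × ℕ) (F : List (ℕ × ℕ)) :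
    xes e (f :: F) = ic e.1 e.2 f.1 f.2 + xes e F := by simp [xes]
@[simp] theorem xes_append (e : ℕ × ℕ) (F G : List (ℕ × ℕ)) :
    xes e (F ++ G) = xes e F + xes e G := by simp [xes]
@[simp] theorem xee_nil_left (F : List (ℕ × ℕ)) : xee [] F = 0 := rfl
@[simp] theorem xee_cons_left (e : ℕ × ℕ) (E F : List (ℕ × ℕ)) :
    xee (e :: E) F = xes e F + xee E F := by simp [xee]

theorem xee_comm (E F : List (ℕ × ℕ)) : xee E F = xee F E := by
  induction E with
  | nil => induction F with
    | nil => rfl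
    | cons f F ih => simpa using ih
  | cons e E ih =>
    rw [xee_cons_left, ih]
    clear ih
    induction F with
    | nil => rfl
    | cons f F ih => simp only [xee_cons_left, xes_cons, ← ih, ic_comm f.1]; omega

theorem ecr_append (E F : List (ℕ × ℕ)) : ecr (E ++ F) = ecr E + ecr F + xee E F := by
  induction E with
  | nil => simp [ecr]
  | cons e E ih => simp only [List.cons_append, ecr, ih, xes_append, xee_cons_left]; omega

theorem ecr_perm {E F : List (ℕ × ℕ)} (h : E.Perm F) : ecr E = ecr F := by
  induction h with
  | nil => rfl
  | cons x h ih =>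
    simp only [ecr, ih, xes, (h.map _).sum_eq]
  | swap x y l => simp only [ecr, xes_cons, ic_comm y.1]; omega
  | trans _ _ h1 h2 => exact h1.trans h2

theorem pe_append_cons (l : List ℕ) (a b : ℕ) (m : List ℕ) :
    pe (l ++ a :: b :: m) = pe (l ++ [a]) ++ (min a b, max a b) :: pe (b :: m) := by
  induction l with
  | nil => simp [pe]
  | cons c l ih =>
    cases l with
    | nil => simp [pe]
    | cons d l => simpa [pe] using ih

theorem pe_reverse (l : List ℕ) : pe l.reverse = (pe l).reverse := by
  induction l with
  | nil => rfl
  | cons a l ih =>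
    cases l with
    | nil => rfl
    | cons b l =>
      rw [List.reverse_cons] at ih
      simp only [List.reverse_cons, List.append_assoc, List.cons_append, List.nil_append,
        pe_append_cons, pe, ih, min_comm b, max_comm b]

/-- Hamiltonian alternating paths on the positions below `N`, from `0` to `b`. -/
structure AltList (col : ℕ → Bool) (N b : ℕ) (L : List ℕ) : Prop where
  perm : L.Perm (List.range N)
  head : L.head? = some 0
  last : L.getLast? = some b
  chain : L.IsChain (fun x y => col x ≠ col y)

theorem ic_swap_le {x x1 y y1 z w : ℕ} (h : Cr x x1 y y1) :
    ic z w x y1 + ic z w y x1 ≤ ic z w x x1 + ic z w y y1 := by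
  have h1 : Cr z w x y1 → Cr z w x x1 ∨ Cr z w y y1 := cr_swap_or h
  have h2 : Cr z w x y1 → Cr z w y x1 → Cr z w x x1 ∧ Cr z w y y1 := cr_swap_and h
  have h3 : Cr z w y x1 → Cr z w y y1 ∨ Cr z w x x1 := cr_swap_or h.symm
  unfold ic
  generalize Cr z w x y1 = p at *
  generalize Cr z w y x1 = q at *
  generalize Cr z w x x1 = r at *
  generalize Cr z w y y1 = s at *
  clear h
  by_cases hp : p <;> by_cases hq : q <;> by_cases hr : r <;> by_cases hs : s <;> simp_all

theorem AltList.uncross {col : ℕ → Bool} {N b : ℕ} {A M D : List ℕ} {a x y d : ℕ}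
    (h : AltList col N b (A ++ a :: x :: (M ++ y :: d :: D))) (hc : col a ≠ col y)
    (hcr : Cr a x y d) : ∃ L, AltList col N b L ∧
      ecr (pe L) < ecr (pe (A ++ a :: x :: (M ++ y :: d :: D))) := by
  refine ⟨A ++ a :: y :: (M.reverse ++ x :: d :: D), ⟨?_, ?_, ?_, ?_⟩, ?_⟩
  · refine List.Perm.trans ?_ h.perm
    rw [List.perm_append_left_iff, List.perm_cons]
    have h1 : (y :: (M.reverse ++ x :: d :: D)).Perm (x :: y :: (M ++ d :: D)) :=
      ((List.perm_middle.cons y).trans (List.Perm.swap x y _)).trans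
        (((M.reverse_perm.append_right _).cons y).cons x)
    exact h1.trans ((List.perm_middle.symm).cons x)
  · rw [← h.head]
    cases A <;> simp
  · rw [← h.last]
    simp [List.getLast?_append, List.getLast?_cons]
  · have hch := h.chain
    have e1 : A ++ a :: x :: (M ++ y :: d :: D) = (A ++ [a]) ++ (x :: M ++ [y]) ++ (d :: D) := by simp
    have e2 : A ++ a :: y :: (M.reverse ++ x :: d :: D)
        = (A ++ [a]) ++ (x :: M ++ [y]).reverse ++ (d :: D) := by simp
    rw [e1] at hch
    rw [e2]
    rw [List.isChain_append, List.isChain_append] at hch ⊢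
    obtain ⟨⟨h1, h2, h3⟩, h4, h5⟩ := hch
    have hax : col a ≠ col x := h3 a (by simp) x (by simp)
    have hyd : col y ≠ col d := by
      refine h5 y ?_ d (by simp)
      rw [← List.append_assoc]
      exact List.getLast?_concat
    refine ⟨⟨h1, ?_, ?_⟩, h4, ?_⟩
    · rw [List.isChain_reverse]
      exact h2.imp (fun _ _ h => h.symm)
    · intro u hu v hv
      simp at hu hv
      subst hu hv
      exact hc
    · intro u hu v hv
      simp [List.getLast?_append, List.getLast?_cons] at hu hv
      subst hu hv
      revert hax hyd hc
      cases col a <;> cases col x <;> cases col y <;> cases col d <;> simp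
  · have e1 : (pe (A ++ a :: x :: (M ++ y :: d :: D))).Perm
        ((min a x, max a x) :: (min y d, max y d) :: (pe (A ++ [a]) ++ pe (x :: M ++ [y]) ++ pe (d :: D))) := by
      rw [pe_append_cons, ← List.cons_append, pe_append_cons]
      refine List.perm_middle.trans (List.Perm.cons _ ?_)
      rw [← List.append_assoc]
      exact List.perm_middle
    have e2 : (pe (A ++ a :: y :: (M.reverse ++ x :: d :: D))).Perm
        ((min a y, max a y) :: (min x d, max x d) :: (pe (A ++ [a]) ++ pe (x :: M ++ [y]) ++ pe (d :: D))) := by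
      rw [pe_append_cons, ← List.cons_append, pe_append_cons]
      refine List.perm_middle.trans (List.Perm.cons _ ?_)
      rw [← List.append_assoc]
      refine List.perm_middle.trans (List.Perm.cons _ ?_)
      refine List.Perm.append_right _ (List.Perm.append_left _ ?_)
      have : y :: M.reverse ++ [x] = (x :: M ++ [y]).reverse := by simp
      rw [this, pe_reverse]
      exact List.reverse_perm _
    rw [ecr_perm e1, ecr_perm e2]
    generalize pe (A ++ [a]) ++ pe (x :: M ++ [y]) ++ pe (d :: D) = F
    simp only [ecr, xes_cons, ic_minmax_left, ic_minmax_right]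
    have h1 : ic a x y d = 1 := by simp [ic, hcr]
    have h2 : ic a y x d = 0 := by
      unfold ic
      rw [if_neg]
      unfold Cr at *
      omega
    have h3 : xes (min a y, max a y) F + xes (min x d, max x d) F
        ≤ xes (min a x, max a x) F + xes (min y d, max y d) F := by
      induction F with
      | nil => simp
      | cons f F ih =>
        simp only [xes_cons, ic_minmax_left] at ih ⊢
        have h0 : Cr a x d y := by unfold Cr at *; omega
        have := ic_swap_le (z := f.1) (w := f.2) h0
        rw [ic_comm _ _ a, ic_comm _ _ d, ic_comm _ _ a, ic_comm _ _ d] at this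
        have s1 : ic d x f.1 f.2 = ic x d f.1 f.2 := by
          rw [← ic_minmax_left, min_comm, max_comm, ic_minmax_left]
        have s2 : ic d y f.1 f.2 = ic y d f.1 f.2 := by
          rw [← ic_minmax_left, min_comm, max_comm, ic_minmax_left]
        omega
    omega

/-- The edges of a path, as ordered pairs. -/
def zE (L : List ℕ) : List (ℕ × ℕ) := L.zip L.tail

theorem xes_eq_sum (e : ℕ × ℕ) (F : List (ℕ × ℕ)) :
    xes e F = ∑ i ∈ Finset.range F.length,
      ic e.1 e.2 (F.getD i (0, 0)).1 (F.getD i (0, 0)).2 := by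
  induction F with
  | nil => simp
  | cons f F ih =>
    rw [xes_cons, ih, List.length_cons, Finset.sum_range_succ']
    simp [add_comm]

theorem xee_eq_sum (E F : List (ℕ × ℕ)) :
    xee E F = ∑ i ∈ Finset.range E.length, xes (E.getD i (0, 0)) F := by
  induction E with
  | nil => simp
  | cons f E ih =>
    rw [xee_cons_left, ih, List.length_cons, Finset.sum_range_succ']
    simp [add_comm]

theorem ic_self (a b : ℕ) : ic a b a b = 0 := by
  simp [ic, not_cr_self]

theorem xee_self (E : List (ℕ × ℕ)) : xee E E = 2 * ecr E := by
  induction E with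
  | nil => rfl
  | cons e E ih =>
    rw [xee_cons_left, xee_comm, xee_cons_left, ih, xes_cons, ecr, ic_self]
    ring

theorem pe_eq_map (L : List ℕ) :
    pe L = (zE L).map (fun e : ℕ × ℕ => (min e.1 e.2, max e.1 e.2)) := by
  induction L with
  | nil => rfl
  | cons a L ih =>
    cases L with
    | nil => rfl
    | cons c L => simpa [pe, zE] using ih

theorem ecr_pe (L : List ℕ) : ecr (pe L) = ecr (zE L) := by
  rw [pe_eq_map]
  generalize zE L = E
  induction E with
  | nil => rfl
  | cons e E ih =>
    simp only [List.map_cons, ecr, ih]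
    congr 1
    simp only [xes, List.map_map]
    congr 1
    refine List.map_congr_left fun f _ => ?_
    simp [ic_minmax_left, ic_minmax_right]

theorem length_zE (L : List ℕ) : (zE L).length = L.length - 1 := by
  simp [zE]

theorem zE_getD (L : List ℕ) {i : ℕ} (hi : i + 1 < L.length) :
    (zE L).getD i (0, 0) = (L.getD i 0, L.getD (i + 1) 0) := by
  have h : i < (zE L).length := by rw [length_zE]; omega
  have h' : i < L.length := by omega
  rw [List.getD_eq_getElem _ _ h, List.getD_eq_getElem _ _ hi, List.getD_eq_getElem _ _ h']
  simp [zE]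

section

variable {col : ℕ → Bool} {N : ℕ} {b : Fin N} {L : List ℕ}

theorem AltList.length_eq (h : AltList col N b L) : L.length = N := by
  simpa using h.perm.length_eq

theorem AltList.getD_lt (h : AltList col N b L) {i : ℕ} (hi : i < N) : L.getD i 0 < N := by
  have h' : i < L.length := by rwa [h.length_eq]
  rw [List.getD_eq_getElem _ _ h']
  simpa using h.perm.mem_iff.1 (List.getElem_mem h')

theorem AltList.getD_inj (h : AltList col N b L) {i j : ℕ} (hi : i < N) (hj : j < N)
    (hij : L.getD i 0 = L.getD j 0) : i = j := by
  have hi' : i < L.length := by rwa [h.length_eq]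
  have hj' : j < L.length := by rwa [h.length_eq]
  rw [List.getD_eq_getElem _ _ hi', List.getD_eq_getElem _ _ hj'] at hij
  have hn : L.Nodup := h.perm.nodup_iff.2 List.nodup_range
  exact (hn.getElem_inj_iff).1 hij

theorem AltList.getD_last (h : AltList col N b L) : L.getD (N - 1) 0 = b := by
  have h1 := h.last
  rw [List.getLast?_eq_getElem?, h.length_eq] at h1
  rw [List.getD_eq_getElem?_getD, h1]; rfl

theorem AltList.getD_zero (h : AltList col N b L) : L.getD 0 0 = 0 := by
  have h1 := h.head
  rw [List.head?_eq_getElem?] at h1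
  rw [List.getD_eq_getElem?_getD, h1]; rfl

theorem AltList.col_succ (h : AltList col N b L) {i : ℕ} (hi : i + 1 < N) :
    col (L.getD (i + 1) 0) = !col (L.getD i 0) := by
  have hi' : i + 1 < L.length := by rwa [h.length_eq]
  have := (List.isChain_iff_getElem.1 h.chain) i hi'
  rw [List.getD_eq_getElem _ _ hi', List.getD_eq_getElem _ _ (by omega : i < L.length)]
  revert this
  cases col L[i] <;> cases col L[i + 1] <;> simp

/-- A path closed up by the edge between its endpoints, as a cyclic permutation. -/
theorem AltList.exists_perm (h : AltList col N b L) (h0 : col 0 = true) (hb : col b = false) :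
    ∃ (e : Equiv.Perm (Fin N)) (σ : Equiv.Perm (Fin N)), (∀ i, (e i : ℕ) = L.getD i 0) ∧
      (∀ i : Fin N, (i : ℕ) + 1 < N → (σ (e i) : ℕ) = L.getD (i + 1) 0) ∧
      (σ b : ℕ) = 0 ∧ (∀ x : Fin N, col (σ x) = !col x) ∧ orbNum σ = 1 ∧
      (∀ i : Fin N, e i ≠ b ↔ (i : ℕ) + 1 < N) := by
  obtain ⟨M, rfl⟩ : ∃ M, N = M + 1 := ⟨N - 1, by have := b.2; omega⟩
  let f : Fin (M + 1) → Fin (M + 1) := fun i => ⟨L.getD i 0, h.getD_lt i.2⟩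
  have hf : Function.Injective f := fun i j hij =>
    Fin.ext (h.getD_inj i.2 j.2 (by simpa [f] using hij))
  let e : Equiv.Perm (Fin (M + 1)) := Equiv.ofBijective f (Finite.injective_iff_bijective.1 hf)
  have he : ∀ i, (e i : ℕ) = L.getD i 0 := fun i => rfl
  have hlast : e (Fin.last M) = b := Fin.ext (by rw [he]; exact h.getD_last)
  let σ : Equiv.Perm (Fin (M + 1)) := e * finRotate (M + 1) * e⁻¹
  have hσe : ∀ i, σ (e i) = e (finRotate (M + 1) i) := fun i => by simp [σ]
  have hσ : ∀ i : Fin (M + 1), (i : ℕ) + 1 < M + 1 → (σ (e i) : ℕ) = L.getD (i + 1) 0 := by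
    intro i hi
    rw [hσe, he]
    congr 1
    rw [coe_finRotate_of_ne_last]
    intro h
    rw [h] at hi
    simp at hi
  have hσb : (σ b : ℕ) = 0 := by
    rw [← hlast, hσe, finRotate_last, he]
    exact h.getD_zero
  refine ⟨e, σ, he, hσ, hσb, ?_, ?_, ?_⟩
  · intro x
    obtain ⟨i, rfl⟩ := e.surjective x
    by_cases hi : (i : ℕ) + 1 < M + 1
    · rw [hσ i hi, he]
      exact h.col_succ hi
    · have : i = Fin.last M := Fin.ext (by have := i.2; simp; omega)
      rw [this, hlast, hσb, h0, hb]
      rfl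
  · have key : ∀ k : ℕ, ∀ hk : k < M + 1, orb σ (e ⟨k, hk⟩) = orb σ (e ⟨0, by omega⟩) := by
      intro k
      induction k with
      | zero => intro _; rfl
      | succ k ih =>
        intro hk
        rw [← ih (by omega), orb_eq_iff]
        have : σ (e ⟨k, by omega⟩) = e ⟨k + 1, hk⟩ := by
          apply Fin.ext
          rw [hσ _ (by simpa using hk), he]
        rw [← this]
        exact (Equiv.Perm.sameCycle_apply_left).2 (Equiv.Perm.SameCycle.refl _ _)
    unfold orbNum
    rw [Finset.card_eq_one]
    refine ⟨orb σ (e ⟨0, by omega⟩), ?_⟩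
    ext O
    simp only [Finset.mem_image, Finset.mem_univ, true_and, Finset.mem_singleton]
    constructor
    · rintro ⟨x, rfl⟩
      obtain ⟨i, rfl⟩ := e.surjective x
      exact key i i.2
    · rintro rfl
      exact ⟨_, rfl⟩
  · intro i
    rw [← hlast, e.injective.ne_iff, Ne, Fin.ext_iff]
    have := i.2
    simp only [Fin.val_last]
    omega

theorem AltList.crossers_eq_xes (h : AltList col N b L) {e σ : Equiv.Perm (Fin N)}
    (he : ∀ i, (e i : ℕ) = L.getD i 0)
    (hσ : ∀ i : Fin N, (i : ℕ) + 1 < N → (σ (e i) : ℕ) = L.getD (i + 1) 0)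
    (heb : ∀ i : Fin N, e i ≠ b ↔ (i : ℕ) + 1 < N) (i : Fin N) (hi : (i : ℕ) + 1 < N) :
    crossers b σ (e i) = xes ((zE L).getD i (0, 0)) (zE L) := by
  have hl := h.length_eq
  obtain ⟨M, rfl⟩ : ∃ M, N = M + 1 := ⟨N - 1, by omega⟩
  unfold crossers
  rw [← Equiv.sum_comp e, Fin.sum_univ_castSucc, xes_eq_sum, length_zE, hl, Finset.sum_range]
  rw [zE_getD L (by omega)]
  have hz : iot b σ (e i) (e (Fin.last M)) = 0 := by
    unfold iot
    rw [if_neg]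
    rintro ⟨-, h2, -⟩
    rw [heb] at h2
    simp at h2
  rw [hz, add_zero]
  refine Finset.sum_congr rfl fun j _ => ?_
  have hj : ((Fin.castSucc j : Fin (M + 1)) : ℕ) + 1 < M + 1 := by simp
  have hj' : (j : ℕ) + 1 < L.length := by rw [hl]; simp
  rw [zE_getD L hj', iot_eq ((heb _).2 hi) ((heb _).2 hj), he, he, hσ _ hi, hσ _ hj]
  rfl

theorem AltList.cr2_eq (h : AltList col N b L) {e σ : Equiv.Perm (Fin N)}
    (he : ∀ i, (e i : ℕ) = L.getD i 0)
    (hσ : ∀ i : Fin N, (i : ℕ) + 1 < N → (σ (e i) : ℕ) = L.getD (i + 1) 0)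
    (heb : ∀ i : Fin N, e i ≠ b ↔ (i : ℕ) + 1 < N) :
    cr2 b σ = 2 * ecr (pe L) := by
  have hl := h.length_eq
  rw [ecr_pe, ← xee_self, xee_eq_sum, length_zE, hl]
  unfold cr2
  rw [← Equiv.sum_comp e]
  have hc := h.crossers_eq_xes he hσ heb
  unfold crossers at hc
  obtain ⟨M, rfl⟩ : ∃ M, N = M + 1 := ⟨N - 1, by have := b.2; omega⟩
  rw [Fin.sum_univ_castSucc, Finset.sum_range]
  have hz : ∑ y, iot b σ (e (Fin.last M)) y = 0 := by
    refine Finset.sum_eq_zero fun y _ => ?_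
    unfold iot
    rw [if_neg]
    rintro ⟨h2, -⟩
    rw [heb] at h2
    simp at h2
  rw [hz, add_zero]
  refine Finset.sum_congr rfl fun j _ => ?_
  exact hc (Fin.castSucc j) (by simp)

/-- A crossing of two edges with differently coloured tails can be removed. -/
theorem AltList.uncross_index (h : AltList col N b L) {i j : ℕ} (hij : i < j) (hj : j + 1 < N)
    (hcr : Cr (L.getD i 0) (L.getD (i + 1) 0) (L.getD j 0) (L.getD (j + 1) 0))
    (hc : col (L.getD i 0) ≠ col (L.getD j 0)) :
    ∃ L', AltList col N b L' ∧ ecr (pe L') < ecr (pe L) := by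
  have hl := h.length_eq
  have hij' : i + 2 ≤ j := by
    by_contra hh
    have : j = i + 1 := by omega
    subst this
    unfold Cr at hcr
    omega
  have d1 : L = L.take i ++ L.drop i := (List.take_append_drop i L).symm
  have d2 : L.drop i = L.getD i 0 :: L.getD (i + 1) 0 :: L.drop (i + 2) := by
    rw [List.drop_eq_getElem_cons (by omega), List.drop_eq_getElem_cons (by omega),
      List.getD_eq_getElem _ _ (by omega), List.getD_eq_getElem _ _ (by omega)]
  have d3 : L.drop (i + 2) = (L.drop (i + 2)).take (j - (i + 2)) ++ L.drop j := by
    conv_lhs => rw [← List.take_append_drop (j - (i + 2)) (L.drop (i + 2))]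
    rw [List.drop_drop]
    congr 2
    omega
  have d4 : L.drop j = L.getD j 0 :: L.getD (j + 1) 0 :: L.drop (j + 2) := by
    rw [List.drop_eq_getElem_cons (by omega), List.drop_eq_getElem_cons (by omega),
      List.getD_eq_getElem _ _ (by omega), List.getD_eq_getElem _ _ (by omega)]
  rw [d4] at d3
  rw [d3] at d2
  rw [d2] at d1
  generalize L.getD i 0 = a at *
  generalize L.getD (i + 1) 0 = x at *
  generalize L.getD j 0 = y at *
  generalize L.getD (j + 1) 0 = d at *
  generalize L.take i = A at *
  generalize (L.drop (i + 2)).take (j - (i + 2)) = M at *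
  generalize L.drop (j + 2) = D at *
  subst d1
  exact h.uncross hc hcr

/-- Crossing bound for alternating paths. -/
theorem AltList.le_ecr (hs : SpCfg col b) (h : AltList col N b L) :
    N ≤ 2 * ecr (pe L) + linChg col N := by
  induction hk : ecr (pe L) using Nat.strong_induction_on generalizing L with
  | _ k ih =>
  subst hk
  by_cases hmix : ∃ i j, i < j ∧ j + 1 < N ∧
      Cr (L.getD i 0) (L.getD (i + 1) 0) (L.getD j 0) (L.getD (j + 1) 0) ∧
      col (L.getD i 0) ≠ col (L.getD j 0)
  · obtain ⟨i, j, h1, h2, h3, h4⟩ := hmix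
    obtain ⟨L', h5, h6⟩ := h.uncross_index h1 h2 h3 h4
    have := ih _ h6 h5 rfl
    omega
  · obtain ⟨e, σ, he, hσ, hσb, hσc, hK, heb⟩ := h.exists_perm hs.col_zero hs.col_b
    have hadm : Adm col b σ := by
      refine ⟨hσc, hσb, ?_⟩
      intro x y hx hy hcr
      obtain ⟨i, rfl⟩ := e.surjective x
      obtain ⟨j, rfl⟩ := e.surjective y
      rw [heb] at hx hy
      rw [hσ i hx, hσ j hy, he, he] at hcr
      rw [he, he]
      rcases lt_trichotomy (i : ℕ) j with hij | hij | hij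
      · by_contra hcon
        exact hmix ⟨i, j, hij, hy, hcr, hcon⟩
      · rw [hij]
      · by_contra hcon
        exact hmix ⟨j, i, hij, hx, hcr.symm, fun h' => hcon h'.symm⟩
    have := hadm.le_pot hs
    unfold pot at this
    rw [h.cr2_eq he hσ heb, hK] at this
    omega

/-- Crossing distribution of alternating paths attaining the bound. -/
theorem AltList.crossing_distribution (hs : SpCfg col b) (h : AltList col N b L)
    (hopt : 2 * ecr (pe L) + linChg col N = N) :
    ∃ i, i + 1 < N ∧ xes ((zE L).getD i (0, 0)) (zE L) = 2 ∧
      ∀ j, j + 1 < N → j ≠ i → xes ((zE L).getD j (0, 0)) (zE L) ≤ 1 := by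
  obtain ⟨e, σ, he, hσ, hσb, hσc, hK, heb⟩ := h.exists_perm hs.col_zero hs.col_b
  have hmix : ∀ i j, i < j → j + 1 < N →
      Cr (L.getD i 0) (L.getD (i + 1) 0) (L.getD j 0) (L.getD (j + 1) 0) →
      col (L.getD i 0) = col (L.getD j 0) := by
    intro i j h1 h2 h3
    by_contra hcon
    obtain ⟨L', h5, h6⟩ := h.uncross_index h1 h2 h3 hcon
    have := h5.le_ecr hs
    omega
  have hadm : Adm col b σ := by
    refine ⟨hσc, hσb, ?_⟩
    intro x y hx hy hcr
    obtain ⟨i, rfl⟩ := e.surjective x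
    obtain ⟨j, rfl⟩ := e.surjective y
    rw [heb] at hx hy
    rw [hσ i hx, hσ j hy, he, he] at hcr
    rw [he, he]
    rcases lt_trichotomy (i : ℕ) j with hij | hij | hij
    · exact hmix i j hij hy hcr
    · rw [hij]
    · exact (hmix j i hij hx hcr.symm).symm
  have htight : Tight col b σ := by
    refine ⟨hadm, fun τ hτ => ?_⟩
    have := hτ.le_pot hs
    unfold pot at *
    rw [h.cr2_eq he hσ heb, hK]
    omega
  obtain ⟨x, hx, h2, hall⟩ := tight_structure hs htight hK
  obtain ⟨i, rfl⟩ := e.surjective x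
  have hi := (heb i).1 hx
  refine ⟨i, hi, by rw [← h2, h.crossers_eq_xes he hσ heb i hi], ?_⟩
  intro j hj hji
  have := h.crossers_eq_xes he hσ heb ⟨j, by omega⟩ hj
  rw [show ((⟨j, by omega⟩ : Fin N) : ℕ) = j from rfl] at this
  rw [← this]
  refine hall _ ((heb _).2 hj) fun hh => hji ?_
  have := e.injective hh
  rw [← this]

end

/-- Number of color changes between consecutive positions of `[i, j)`. -/
def chgIco (col : ℕ → Bool) (i j : ℕ) : ℕ :=
  ∑ t ∈ Finset.Ico i (j - 1), if col t = col (t + 1) then 0 else 1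

/-- Alternating paths on the positions of `[i, j)`, from `i` to `j - 1`, with few crossings. -/
structure GoodList (col : ℕ → Bool) (i j : ℕ) (L : List ℕ) : Prop where
  nodup : L.Nodup
  mem : ∀ x, x ∈ L ↔ i ≤ x ∧ x < j
  head : L.head? = some i
  last : L.getLast? = some (j - 1)
  chain : L.IsChain (fun x y => col x ≠ col y)
  le : 2 * ecr (pe L) + chgIco col i j + 1 ≤ j - i

theorem pe_append {A B : List ℕ} {a b : ℕ} (ha : A.getLast? = some a) (hb : B.head? = some b) :
    pe (A ++ B) = pe A ++ (min a b, max a b) :: pe B := by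
  obtain ⟨A', rfl⟩ := List.getLast?_eq_some_iff.1 ha
  obtain ⟨B', rfl⟩ := List.head?_eq_some_iff.1 hb
  rw [List.append_assoc, List.singleton_append, pe_append_cons]

theorem mem_pe {L : List ℕ} {f : ℕ × ℕ} (h : f ∈ pe L) : f.1 ≤ f.2 ∧ f.1 ∈ L ∧ f.2 ∈ L := by
  induction L with
  | nil => simp [pe] at h
  | cons a L ih =>
    cases L with
    | nil => simp [pe] at h
    | cons b L =>
      rw [pe, List.mem_cons] at h
      rcases h with rfl | h
      · refine ⟨min_le_max, ?_, ?_⟩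
        · rcases min_choice a b with h | h <;> simp [h]
        · rcases max_choice a b with h | h <;> simp [h]
      · have := ih h
        exact ⟨this.1, List.mem_cons_of_mem _ this.2.1, List.mem_cons_of_mem _ this.2.2⟩

theorem xes_eq_zero {e : ℕ × ℕ} {F : List (ℕ × ℕ)} (h : ∀ f ∈ F, ¬ Cr e.1 e.2 f.1 f.2) :
    xes e F = 0 := by
  unfold xes
  rw [List.sum_eq_zero]
  intro x hx
  obtain ⟨f, hf, rfl⟩ := List.mem_map.1 hx
  simp [ic, h f hf]

theorem xee_eq_zero {E F : List (ℕ × ℕ)} (h : ∀ e ∈ E, ∀ f ∈ F, ¬ Cr e.1 e.2 f.1 f.2) :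
    xee E F = 0 := by
  unfold xee
  rw [List.sum_eq_zero]
  intro x hx
  obtain ⟨e, he, rfl⟩ := List.mem_map.1 hx
  exact xes_eq_zero (h e he)

theorem ic_eq_zero {a b c d : ℕ} (h : ¬ Cr a b c d) : ic a b c d = 0 := by simp [ic, h]

theorem ic_le_one (a b c d : ℕ) : ic a b c d ≤ 1 := by unfold ic; split_ifs <;> omega

section

variable {col : ℕ → Bool} {i j m : ℕ} {L P Q : List ℕ}

theorem GoodList.bounds (h : GoodList col i j L) {f : ℕ × ℕ} (hf : f ∈ pe L) :
    i ≤ f.1 ∧ f.1 ≤ f.2 ∧ f.2 + 1 ≤ j := by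
  have h1 := mem_pe hf
  have h2 := (h.mem _).1 h1.2.1
  have h3 := (h.mem _).1 h1.2.2
  omega

theorem GoodList.lt (h : GoodList col i j L) : i < j :=
  (h.mem i).1 (List.mem_of_mem_head? h.head) |>.2

theorem chgIco_split (him : i < m) (hmj : m < j) :
    chgIco col i j = chgIco col i m + (if col (m - 1) = col m then 0 else 1) + chgIco col m j := by
  unfold chgIco
  obtain ⟨m, rfl⟩ : ∃ m', m = m' + 1 := ⟨m - 1, by omega⟩
  rw [← Finset.sum_Ico_consecutive _ (show i ≤ m by omega) (show m ≤ j - 1 by omega),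
    Finset.sum_eq_sum_Ico_succ_bot (show m < j - 1 by omega)]
  simp [add_assoc]

theorem GoodList.append (hP : GoodList col i m P) (hQ : GoodList col m j Q)
    (hc : col (m - 1) ≠ col m) : GoodList col i j (P ++ Q) := by
  have h1 := hP.lt
  have h2 := hQ.lt
  refine ⟨?_, ?_, ?_, ?_, ?_, ?_⟩
  · refine List.Nodup.append hP.nodup hQ.nodup ?_
    intro x hx hx'
    have := (hP.mem x).1 hx
    have := (hQ.mem x).1 hx'
    omega
  · intro x
    rw [List.mem_append, hP.mem, hQ.mem]
    omega
  · rw [List.head?_append, hP.head]; rfl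
  · rw [List.getLast?_append, hQ.last]; rfl
  · rw [List.isChain_append]
    refine ⟨hP.chain, hQ.chain, ?_⟩
    rw [hP.last, hQ.head]
    intro x hx y hy
    simp only [Option.mem_some_iff] at hx hy
    subst hx hy
    exact hc
  · rw [pe_append hP.last hQ.head, ecr_append, ecr, chgIco_split h1 h2, if_neg hc]
    have z1 : xes (min (m - 1) m, max (m - 1) m) (pe Q) = 0 := by
      refine xes_eq_zero fun f hf => ?_
      have := hQ.bounds hf
      unfold Cr
      simp only
      omega
    have z2 : xee (pe P) ((min (m - 1) m, max (m - 1) m) :: pe Q) = 0 := by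
      refine xee_eq_zero fun e he f hf => ?_
      have b1 := hP.bounds he
      rw [List.mem_cons] at hf
      rcases hf with rfl | hf
      · unfold Cr
        simp only
        omega
      · have := hQ.bounds hf
        unfold Cr
        omega
    have := hP.le
    have := hQ.le
    omega

theorem GoodList.pair (h1 : col i = true) (h2 : col (i + 1) = false) :
    GoodList col i (i + 2) [i, i + 1] := by
  refine ⟨by simp, ?_, by simp, by simp, by simp [h1, h2], ?_⟩
  · intro x
    simp only [List.mem_cons, List.not_mem_nil, or_false]
    omega
  · simp [pe, ecr, chgIco, h1, h2]

theorem GoodList.wrap (hP : GoodList col (i + 1) m P) (h1 : col i = true) (h2 : col (i + 1) = true)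
    (h3 : col (m - 1) = false) (h4 : col m = false) :
    GoodList col i (m + 1) (i :: (P.reverse ++ [m])) := by
  have hlt := hP.lt
  have hlast : P.reverse.getLast? = some (i + 1) := by rw [List.getLast?_reverse, hP.head]
  have hhead : P.reverse.head? = some (m - 1) := by rw [List.head?_reverse, hP.last]
  have hne : i + 1 ≠ m - 1 := by
    intro h
    rw [← h, h2] at h3
    simp at h3
  refine ⟨?_, ?_, by simp, ?_, ?_, ?_⟩
  · rw [List.nodup_cons, List.mem_append, List.mem_reverse, hP.mem, List.mem_singleton]
    refine ⟨by omega, List.Nodup.append (List.nodup_reverse.2 hP.nodup) (by simp) ?_⟩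
    intro x hx hx'
    rw [List.mem_reverse, hP.mem] at hx
    simp at hx'
    omega
  · intro x
    rw [List.mem_cons, List.mem_append, List.mem_reverse, hP.mem, List.mem_singleton]
    omega
  · simp [List.getLast?_cons, List.getLast?_append]
  · rw [List.isChain_cons, List.isChain_append, List.head?_append, hhead, hlast,
      List.isChain_reverse]
    refine ⟨?_, hP.chain.imp (fun _ _ h => h.symm), by simp, ?_⟩
    · intro y hy
      simp only [Option.some_or, Option.mem_some_iff] at hy
      subst hy
      simp [h1, h3]
    · intro x hx y hy
      simp at hx hy
      subst hx hy
      simp [h2, h4]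
  · have e : pe (i :: (P.reverse ++ [m])) = (min i (m - 1), max i (m - 1)) ::
        ((pe P).reverse ++ [(min (i + 1) m, max (i + 1) m)]) := by
      have : i :: (P.reverse ++ [m]) = [i] ++ (P.reverse ++ [m]) := rfl
      rw [this, pe_append (a := i) (b := m - 1) (by simp) (by simp [List.head?_append, hP.last]),
        pe_append (a := i + 1) (b := m) hlast (by simp), pe_reverse]
      rfl
    have hp : ((min i (m - 1), max i (m - 1)) ::
        ((pe P).reverse ++ [(min (i + 1) m, max (i + 1) m)])).Perm
        ((min i (m - 1), max i (m - 1)) :: (min (i + 1) m, max (i + 1) m) :: pe P) := by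
      refine List.Perm.cons _ ?_
      refine (List.perm_append_comm).trans ?_
      exact (List.reverse_perm _).cons _
    rw [e, ecr_perm hp]
    simp only [ecr, xes_cons]
    have z1 : xes (min i (m - 1), max i (m - 1)) (pe P) = 0 := by
      refine xes_eq_zero fun f hf => ?_
      have := hP.bounds hf
      unfold Cr
      simp only
      omega
    have z2 : xes (min (i + 1) m, max (i + 1) m) (pe P) = 0 := by
      refine xes_eq_zero fun f hf => ?_
      have := hP.bounds hf
      unfold Cr
      simp only
      omega
    have h5 := ic_le_one (min i (m - 1)) (max i (m - 1)) (min (i + 1) m) (max (i + 1) m)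
    have s1 := chgIco_split (col := col) (i := i) (m := i + 1) (j := m + 1) (by omega) (by omega)
    have s2 := chgIco_split (col := col) (i := i + 1) (m := m) (j := m + 1) (by omega) (by omega)
    rw [Nat.add_sub_cancel, h1, h2, if_pos rfl] at s1
    rw [h3, h4, if_pos rfl] at s2
    have s3 : chgIco col i (i + 1) = 0 := by simp [chgIco]
    have s4 : chgIco col m (m + 1) = 0 := by simp [chgIco]
    have := hP.le
    omega

theorem col_of_height_lt {t : ℕ} (h : height col t < height col (t + 1)) : col t = true := by
  rw [height_succ] at h
  by_contra hc
  rw [Bool.not_eq_true] at hc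
  rw [hc, sg_false] at h
  omega

theorem col_of_lt_height {t : ℕ} (h : height col (t + 1) < height col t) : col t = false := by
  rw [height_succ] at h
  by_contra hc
  rw [Bool.not_eq_false] at hc
  rw [hc, sg_true] at h
  omega

theorem height_succ_ne (t : ℕ) : height col (t + 1) = height col t + 1 ∨
    height col (t + 1) = height col t - 1 := by
  rw [height_succ]
  cases col t
  · right; rw [sg_false]; ring
  · left; rw [sg_true]

theorem exists_goodList (hij : i < j) (hend : height col j = height col i)
    (hlow : ∀ t, i ≤ t → t ≤ j → height col i ≤ height col t) : ∃ L, GoodList col i j L := by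
  induction hk : j - i using Nat.strong_induction_on generalizing i j with
  | _ k ih =>
  subst hk
  have hex : ∃ m, i ≤ m ∧ m < j ∧ height col (m + 1) = height col i :=
    ⟨j - 1, by omega, by omega, by rw [Nat.sub_add_cancel (by omega)]; exact hend⟩
  classical
  obtain ⟨hm1, hm2, hm3⟩ := Nat.find_spec hex
  have hmin : ∀ t, t < Nat.find hex → i ≤ t → height col i < height col (t + 1) := by
    intro t ht hit
    have h1 := Nat.find_min hex ht
    have h2 := hlow (t + 1) (by omega) (by omega)
    rcases h2.lt_or_eq with h | h
    · exact h
    · exact absurd ⟨hit, by omega, h.symm⟩ h1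
  generalize Nat.find hex = m at *
  have g1 := height_succ_ne (col := col) i
  have g2 := hlow (i + 1) (by omega) (by omega)
  have ci : col i = true := col_of_height_lt (by omega)
  have him : i < m := by
    rcases hm1.lt_or_eq with h | h
    · exact h
    · subst h; omega
  have g3 := hmin (m - 1) (by omega) (by omega)
  rw [Nat.sub_add_cancel (by omega)] at g3
  have g4 := height_succ_ne (col := col) m
  have cm : col m = false := col_of_lt_height (by omega)
  have hwrap : ∃ P, GoodList col i (m + 1) P := by
    by_cases hm : m = i + 1
    · subst hm
      exact ⟨_, GoodList.pair ci cm⟩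
    · obtain ⟨P, hP⟩ := ih (m - (i + 1)) (by omega) (i := i + 1) (j := m) (by omega) (by omega) (by
        intro t h1 h2
        have := hmin (t - 1) (by omega) (by omega)
        rw [Nat.sub_add_cancel (by omega)] at this
        omega) rfl
      refine ⟨_, hP.wrap ci ?_ ?_ cm⟩
      · refine col_of_height_lt ?_
        have := hmin (i + 1) (by omega) (by omega)
        have := height_succ_ne (col := col) (i + 1)
        omega
      · refine col_of_lt_height ?_
        rw [Nat.sub_add_cancel (by omega)]
        have h5 := hmin (m - 2) (by omega) (by omega)
        rw [show m - 2 + 1 = m - 1 by omega] at h5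
        have h6 := height_succ_ne (col := col) (m - 1)
        rw [Nat.sub_add_cancel (by omega)] at h6
        omega
  obtain ⟨P, hP⟩ := hwrap
  by_cases hmj : m + 1 = j
  · subst hmj
    exact ⟨P, hP⟩
  · obtain ⟨Q, hQ⟩ := ih (j - (m + 1)) (by omega) (i := m + 1) (j := j) (by omega) (by omega) (by
      intro t h1 h2
      have := hlow t (by omega) h2
      omega) rfl
    refine ⟨P ++ Q, hP.append hQ ?_⟩
    rw [Nat.add_sub_cancel, cm]
    have h5 := hlow (m + 1 + 1) (by omega) (by omega)
    have h6 := height_succ_ne (col := col) (m + 1)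
    rw [col_of_height_lt (col := col) (t := m + 1) (by omega)]
    simp

end

theorem height_reflect (col : ℕ → Bool) {N t : ℕ} (h1 : 1 ≤ t) (h2 : t ≤ N) :
    height (fun x : ℕ => col (N - x)) t - height (fun x : ℕ => col (N - x)) 1
      = height col N - height col (N + 1 - t) := by
  induction t, h1 using Nat.le_induction with
  | base => simp
  | succ t h1 ih =>
    have h3 := ih (by omega)
    have h4 := height_succ (fun x : ℕ => col (N - x)) t
    have h5 := height_succ col (N - t)
    rw [show N - t + 1 = N + 1 - t by omega] at h5
    rw [show N + 1 - (t + 1) = N - t by omega]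
    beta_reduce at h4
    omega

theorem chgIco_reflect (col : ℕ → Bool) {N k : ℕ} (hk : k + 1 < N) :
    chgIco (fun x : ℕ => col (N - x)) 1 (N - k) = chgIco col (k + 1) N := by
  unfold chgIco
  have h := Finset.sum_Ico_reflect (fun s : ℕ => if col s = col (s + 1) then 0 else 1) 1
    (m := N - k - 1) (n := N - 1) (by omega)
  rw [show N - 1 + 1 - (N - k - 1) = k + 1 by omega, show N - 1 + 1 - 1 = N - 1 by omega] at h
  rw [← h]
  refine Finset.sum_congr rfl fun t ht => ?_
  rw [Finset.mem_Ico] at ht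
  beta_reduce
  rw [show N - 1 - t + 1 = N - t by omega, show N - (t + 1) = N - 1 - t by omega]
  simp only [eq_comm]

theorem ecr_map {g : ℕ × ℕ → ℕ × ℕ} {E : List (ℕ × ℕ)}
    (h : ∀ e ∈ E, ∀ f ∈ E, ic (g e).1 (g e).2 (g f).1 (g f).2 = ic e.1 e.2 f.1 f.2) :
    ecr (E.map g) = ecr E := by
  induction E with
  | nil => rfl
  | cons e E ih =>
    simp only [List.map_cons, ecr]
    rw [ih fun a ha b hb => h a (List.mem_cons_of_mem _ ha) b (List.mem_cons_of_mem _ hb)]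
    congr 1
    simp only [xes, List.map_map]
    congr 1
    exact List.map_congr_left fun f hf => h e List.mem_cons_self f (List.mem_cons_of_mem _ hf)

theorem pe_map_reflect (N : ℕ) (L : List ℕ) :
    pe (L.map (fun x : ℕ => N - x)) = (pe L).map (fun e : ℕ × ℕ => (N - e.2, N - e.1)) := by
  induction L with
  | nil => rfl
  | cons a L ih =>
    cases L with
    | nil => rfl
    | cons c L =>
      simp only [List.map_cons, pe] at ih ⊢
      rw [ih]
      congr 1
      ext <;> simp only <;> omega

section

variable {N : ℕ} {col : ℕ → Bool} {b : Fin N}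

theorem SpCfg.exists_left (hs : SpCfg col b) : ∃ L, GoodList col 1 b L := by
  have h1 := hs.one_lt
  have h01 : height col 1 = 1 := by simp [height, hs.col_zero, sg]
  have hb := height_succ col b
  rw [hs.mid, hs.col_b, sg_false] at hb
  refine exists_goodList h1 (by omega) fun t h2 h3 => ?_
  have := hs.low t h2 h3
  omega

theorem SpCfg.exists_right (hs : SpCfg col b) : ∃ L : List ℕ, L.Nodup ∧
    (∀ x, x ∈ L ↔ (b : ℕ) + 1 ≤ x ∧ x < N) ∧ L.head? = some (N - 1) ∧
    L.getLast? = some ((b : ℕ) + 1) ∧ L.IsChain (fun x y => col x ≠ col y) ∧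
    2 * ecr (pe L) + chgIco col (b + 1) N + 1 ≤ N - (b + 1) := by
  have h1 := hs.one_lt
  have h2 := hs.lt
  have htot := hs.total
  have hmid := hs.mid
  obtain ⟨Q, hQ⟩ : ∃ L, GoodList (fun x : ℕ => col (N - x)) 1 (N - b) L := by
    refine exists_goodList (by omega) ?_ fun t h3 h4 => ?_
    · have := height_reflect col (N := N) (t := N - b) (by omega) (by omega)
      rw [show N + 1 - (N - b) = (b : ℕ) + 1 by omega] at this
      omega
    · have := height_reflect col (N := N) (t := t) h3 (by omega)
      have := hs.high (N + 1 - t) (by omega) (by omega)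
      omega
  have hinj : ∀ x ∈ Q, ∀ y ∈ Q, N - x = N - y → x = y := by
    intro x hx y hy h
    have := (hQ.mem x).1 hx
    have := (hQ.mem y).1 hy
    omega
  refine ⟨Q.map (fun x : ℕ => N - x), ?_, ?_, ?_, ?_, ?_, ?_⟩
  · exact List.Nodup.map_on hinj hQ.nodup
  · intro x
    rw [List.mem_map]
    constructor
    · rintro ⟨y, hy, rfl⟩
      have := (hQ.mem y).1 hy
      omega
    · intro h
      exact ⟨N - x, (hQ.mem _).2 (by omega), by omega⟩
  · rw [List.head?_map, hQ.head]; rfl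
  · rw [List.getLast?_map, hQ.last]
    simp only [Option.map_some, Option.some_inj]
    omega
  · rw [List.isChain_map]
    exact hQ.chain
  · have hle := hQ.le
    rw [chgIco_reflect col h2] at hle
    rw [pe_map_reflect, ecr_map]
    · omega
    · intro e he f hf
      have b1 := hQ.bounds he
      have b2 := hQ.bounds hf
      simp only
      unfold ic
      congr 1
      unfold Cr
      simp only [eq_iff_iff]
      omega

theorem linChg_eq_chgIco (col : ℕ → Bool) (N : ℕ) : linChg col N = chgIco col 0 N := by
  unfold linChg chgIco
  rw [Finset.range_eq_Ico]

/-- Special configurations have alternating paths attaining the crossing bound. -/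
theorem SpCfg.exists_altList (hs : SpCfg col b) :
    ∃ L : List ℕ, AltList col N b L ∧ 2 * ecr (pe L) + linChg col N ≤ N := by
  have h1 := hs.one_lt
  have h2 := hs.lt
  have htot := hs.total
  have hmid := hs.mid
  obtain ⟨X, hX⟩ := hs.exists_left
  obtain ⟨Y, hYn, hYm, hYh, hYl, hYc, hYle⟩ := hs.exists_right
  have h01 : height col 1 = 1 := by simp [height, hs.col_zero, sg]
  have hb := height_succ col b
  rw [hs.mid, hs.col_b, sg_false] at hb
  have c1 : col 1 = true := by
    refine col_of_height_lt ?_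
    have := hs.low (1 + 1) (by omega) (by omega)
    have := height_succ_ne (col := col) 1
    omega
  have c2 : col (b - 1) = false := by
    refine col_of_lt_height ?_
    rw [Nat.sub_add_cancel (by omega)]
    have := hs.low (b - 1) (by omega) (by omega)
    have h6 := height_succ_ne (col := col) (b - 1)
    rw [Nat.sub_add_cancel (by omega)] at h6
    omega
  have c3 : col (b + 1) = false := by
    refine col_of_lt_height ?_
    have := hs.high (b + 1 + 1) (by omega) (by omega)
    have h6 := height_succ_ne (col := col) (b + 1)
    omega
  have c4 : col (N - 1) = true := by
    refine col_of_height_lt ?_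
    rw [Nat.sub_add_cancel (by omega)]
    have := hs.high (N - 1) (by omega) (by omega)
    have h6 := height_succ_ne (col := col) (N - 1)
    rw [Nat.sub_add_cancel (by omega)] at h6
    omega
  have hXh : X.reverse.head? = some ((b : ℕ) - 1) := by rw [List.head?_reverse, hX.last]
  have hXl : X.reverse.getLast? = some 1 := by rw [List.getLast?_reverse, hX.head]
  have hYh' : Y.reverse.head? = some ((b : ℕ) + 1) := by rw [List.head?_reverse, hYl]
  have hYl' : Y.reverse.getLast? = some (N - 1) := by rw [List.getLast?_reverse, hYh]
  have hYbd : ∀ f ∈ pe Y, (b : ℕ) + 1 ≤ f.1 ∧ f.1 ≤ f.2 ∧ f.2 < N := by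
    intro f hf
    have h1 := mem_pe hf
    have h2 := (hYm _).1 h1.2.1
    have h3 := (hYm _).1 h1.2.2
    omega
  refine ⟨[0] ++ (X.reverse ++ (Y.reverse ++ [(b : ℕ)])), ⟨?_, by simp, ?_, ?_⟩, ?_⟩
  · rw [List.perm_ext_iff_of_nodup _ List.nodup_range]
    · intro x
      simp only [List.mem_append, List.mem_singleton, List.mem_reverse, hX.mem, hYm, List.mem_range]
      omega
    · refine List.Nodup.append (by simp) (List.Nodup.append (List.nodup_reverse.2 hX.nodup)
        (List.Nodup.append (List.nodup_reverse.2 hYn) (by simp) ?_) ?_) ?_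
      all_goals
        intro x
        simp only [List.mem_append, List.mem_singleton, List.mem_reverse, hX.mem, hYm]
        omega
  · simp [List.getLast?_cons, List.getLast?_append]
  · rw [List.isChain_append, List.isChain_append, List.isChain_append]
    refine ⟨by simp, ⟨?_, ⟨?_, by simp, ?_⟩, ?_⟩, ?_⟩
    · rw [List.isChain_reverse]
      exact hX.chain.imp (fun _ _ h => h.symm)
    · rw [List.isChain_reverse]
      exact hYc.imp (fun _ _ h => h.symm)
    · rw [hYl']
      intro x hx y hy
      simp at hx hy
      subst hx hy
      simp [c4, hs.col_b]
    · rw [hXl, List.head?_append, hYh']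
      intro x hx y hy
      simp at hx hy
      subst hx hy
      simp [c1, c3]
    · rw [List.head?_append, hXh]
      intro x hx y hy
      simp at hx hy
      subst hx hy
      simp [hs.col_zero, c2]
  · have e : pe ([0] ++ (X.reverse ++ (Y.reverse ++ [(b : ℕ)])))
        = (0, (b : ℕ) - 1) :: ((pe X).reverse ++ (1, (b : ℕ) + 1) ::
            ((pe Y).reverse ++ [((b : ℕ), N - 1)])) := by
      rw [pe_append (a := 0) (b := b - 1) (by simp) (by rw [List.head?_append, hXh]; rfl),
        pe_append (a := 1) (b := b + 1) hXl (by rw [List.head?_append, hYh']; rfl),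
        pe_append (a := N - 1) (b := b) hYl' (by simp), pe_reverse, pe_reverse]
      have : min (N - 1) (b : ℕ) = b := by omega
      have : max (N - 1) (b : ℕ) = N - 1 := by omega
      have : min 1 ((b : ℕ) + 1) = 1 := by omega
      have : max 1 ((b : ℕ) + 1) = b + 1 := by omega
      simp [pe, *]
    have hp : ((0, (b : ℕ) - 1) :: ((pe X).reverse ++ (1, (b : ℕ) + 1) ::
            ((pe Y).reverse ++ [((b : ℕ), N - 1)]))).Perm
        ((0, (b : ℕ) - 1) :: (1, (b : ℕ) + 1) :: ((b : ℕ), N - 1) :: (pe X ++ pe Y)) := by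
      refine List.Perm.cons _ (List.perm_middle.trans (List.Perm.cons _ ?_))
      rw [← List.append_assoc]
      refine List.perm_append_comm.trans ?_
      rw [List.singleton_append]
      exact List.Perm.cons _ (List.Perm.append (List.reverse_perm _) (List.reverse_perm _))
    rw [e, ecr_perm hp]
    simp only [ecr, xes_cons, xes_append, ecr_append]
    have z1 : xes (0, (b : ℕ) - 1) (pe X) = 0 := by
      refine xes_eq_zero fun f hf => ?_
      have := hX.bounds hf
      unfold Cr; simp only; omega
    have z2 : xes (0, (b : ℕ) - 1) (pe Y) = 0 := by
      refine xes_eq_zero fun f hf => ?_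
      have := hYbd f hf
      unfold Cr; simp only; omega
    have z3 : xes (1, (b : ℕ) + 1) (pe X) = 0 := by
      refine xes_eq_zero fun f hf => ?_
      have := hX.bounds hf
      unfold Cr; simp only; omega
    have z4 : xes (1, (b : ℕ) + 1) (pe Y) = 0 := by
      refine xes_eq_zero fun f hf => ?_
      have := hYbd f hf
      unfold Cr; simp only; omega
    have z5 : xes ((b : ℕ), N - 1) (pe X) = 0 := by
      refine xes_eq_zero fun f hf => ?_
      have := hX.bounds hf
      unfold Cr; simp only; omega
    have z6 : xes ((b : ℕ), N - 1) (pe Y) = 0 := by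
      refine xes_eq_zero fun f hf => ?_
      have := hYbd f hf
      unfold Cr; simp only; omega
    have z7 : xee (pe X) (pe Y) = 0 := by
      refine xee_eq_zero fun e he f hf => ?_
      have := hX.bounds he
      have := hYbd f hf
      unfold Cr; omega
    have z8 : ic 0 ((b : ℕ) - 1) b (N - 1) = 0 := ic_eq_zero (by unfold Cr; omega)
    have i1 := ic_le_one 0 ((b : ℕ) - 1) 1 ((b : ℕ) + 1)
    have i2 := ic_le_one 1 ((b : ℕ) + 1) b (N - 1)
    have s0 := chgIco_split (col := col) (i := 0) (m := 1) (j := N) (by omega) (by omega)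
    have s1 := chgIco_split (col := col) (i := 1) (m := b) (j := N) (by omega) (by omega)
    have s2 := chgIco_split (col := col) (i := b) (m := b + 1) (j := N) (by omega) (by omega)
    rw [Nat.sub_self, hs.col_zero, c1, if_pos rfl] at s0
    rw [c2, hs.col_b, if_pos rfl] at s1
    rw [Nat.add_sub_cancel, c3, hs.col_b, if_pos rfl] at s2
    have s3 : chgIco col 0 1 = 0 := by simp [chgIco]
    have s4 : chgIco col b (b + 1) = 0 := by simp [chgIco]
    have := hX.le
    rw [linChg_eq_chgIco]
    omega

end

theorem det2_affine (p q c d : Pt) {s t : ℝ} (hst : s + t = 1) :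
    det2 p q (s • c + t • d) = s * det2 p q c + t * det2 p q d := by
  have : s = 1 - t := by linarith
  subst this
  simp only [det2, Prod.fst_add, Prod.snd_add, Prod.smul_fst, Prod.smul_snd, smul_eq_mul]
  ring

theorem det2_openSegment {p q x : Pt} (hx : x ∈ openSegment ℝ p q) : det2 p q x = 0 := by
  obtain ⟨s, t, _, _, hst, rfl⟩ := hx
  rw [det2_affine _ _ _ _ hst]
  simp only [det2]
  ring

theorem not_segCross_of_nonneg {p q c d : Pt} (h1 : 0 ≤ det2 p q c) (h2 : 0 ≤ det2 p q d)
    (h3 : 0 < det2 p q c ∨ 0 < det2 p q d) : ¬ SegCross (p, q) (c, d) := by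
  rintro ⟨x, hx, s, t, hs, ht, hst, rfl⟩
  have h := det2_openSegment hx
  simp only at h
  rw [det2_affine _ _ _ _ hst] at h
  rcases h3 with h3 | h3
  · have := mul_pos hs h3
    have := mul_nonneg ht.le h2
    linarith
  · have := mul_pos ht h3
    have := mul_nonneg hs.le h1
    linarith

theorem not_segCross_of_nonpos {p q c d : Pt} (h1 : det2 p q c ≤ 0) (h2 : det2 p q d ≤ 0)
    (h3 : det2 p q c < 0 ∨ det2 p q d < 0) : ¬ SegCross (p, q) (c, d) := by
  rintro ⟨x, hx, s, t, hs, ht, hst, rfl⟩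
  have h := det2_openSegment hx
  simp only at h
  rw [det2_affine _ _ _ _ hst] at h
  rcases h3 with h3 | h3
  · have := mul_neg_of_pos_of_neg hs h3
    have := mul_nonpos_of_nonneg_of_nonpos ht.le h2
    linarith
  · have := mul_neg_of_pos_of_neg ht h3
    have := mul_nonpos_of_nonneg_of_nonpos hs.le h1
    linarith

theorem segCross_of_det {p q c d : Pt} (h1 : 0 < det2 p q c) (h2 : det2 p q d < 0)
    (h3 : det2 c d p < 0) (h4 : 0 < det2 c d q) : SegCross (p, q) (c, d) := by
  have hD : 0 < det2 p q c - det2 p q d := by linarith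
  have hE : det2 c d q - det2 c d p = det2 p q c - det2 p q d := by simp only [det2]; ring
  refine ⟨(det2 c d q / (det2 p q c - det2 p q d)) • p +
    (-det2 c d p / (det2 p q c - det2 p q d)) • q, ?_, ?_⟩
  · refine ⟨_, _, div_pos h4 hD, div_pos (by linarith) hD, ?_, rfl⟩
    rw [← hE] at hD ⊢
    field_simp
    ring
  · refine ⟨-det2 p q d / (det2 p q c - det2 p q d), det2 p q c / (det2 p q c - det2 p q d),
      div_pos (by linarith) hD, div_pos h1 hD, ?_, ?_⟩
    · field_simp
      ring
    · have hne := hD.ne'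
      ext
      · simp only [Prod.fst_add, Prod.smul_fst, smul_eq_mul]
        field_simp
        simp only [det2]
        ring
      · simp only [Prod.snd_add, Prod.smul_snd, smul_eq_mul]
        field_simp
        simp only [det2]
        ring

theorem segCross_comm {e f : Pt × Pt} : SegCross e f ↔ SegCross f e := by
  unfold SegCross
  simp only [and_comm]

theorem segCross_swap_left {p q : Pt} {f : Pt × Pt} : SegCross (p, q) f ↔ SegCross (q, p) f := by
  unfold SegCross
  simp only [openSegment_symm ℝ p q]

/-- Points in convex position, listed clockwise by the naturals below `N`. -/
def CWNat (N : ℕ) (p : ℕ → Pt) : Prop :=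
  ∀ i j k, i < j → j < k → k < N → det2 (p i) (p j) (p k) < 0

section

variable {N : ℕ} {p : ℕ → Pt}

theorem CWNat.det_pos (h : CWNat N p) {a b x : ℕ} (h1 : a < x) (h2 : x < b) (h3 : b < N) :
    0 < det2 (p a) (p b) (p x) := by
  have := h a x b h1 h2 h3
  have e : det2 (p a) (p b) (p x) = - det2 (p a) (p x) (p b) := by simp only [det2]; ring
  linarith

theorem CWNat.det_neg (h : CWNat N p) {a b x : ℕ} (hab : a < b) (h1 : x < a ∨ b < x)
    (h2 : b < N) (h3 : x < N) : det2 (p a) (p b) (p x) < 0 := by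
  rcases h1 with h1 | h1
  · have := h x a b h1 hab h2
    have e : det2 (p a) (p b) (p x) = det2 (p x) (p a) (p b) := by simp only [det2]; ring
    linarith
  · exact h a b x hab h1 h3

theorem det2_self_left (u v : Pt) : det2 u v u = 0 := by simp only [det2]; ring
theorem det2_self_right (u v : Pt) : det2 u v v = 0 := by simp only [det2]; ring

theorem CWNat.segCross_iff_of_lt (h : CWNat N p) {a b c d : ℕ} (hab : a < b) (hcd : c < d)
    (hb : b < N) (hd : d < N) (hne : ¬ (a = c ∧ b = d)) :
    SegCross (p a, p b) (p c, p d) ↔ Cr a b c d := by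
  constructor
  · intro hs
    by_contra hcr
    have hsign : ∀ x, x < N → (a ≤ x ∧ x ≤ b → 0 ≤ det2 (p a) (p b) (p x)) ∧
        (x ≤ a ∨ b ≤ x → det2 (p a) (p b) (p x) ≤ 0) := by
      intro x hx
      rcases eq_or_ne x a with rfl | hxa
      · simp [det2_self_left]
      rcases eq_or_ne x b with rfl | hxb
      · simp [det2_self_right]
      constructor
      · intro h1
        exact (h.det_pos (by omega) (by omega) hb).le
      · intro h1
        exact (h.det_neg hab (by omega) hb hx).le
    have h1 := hsign c (by omega)
    have h2 := hsign d hd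
    by_cases hc : a ≤ c ∧ d ≤ b
    · refine not_segCross_of_nonneg (h1.1 (by omega)) (h2.1 (by omega)) ?_ hs
      by_cases hac : a < c
      · exact Or.inl (h.det_pos hac (by omega) hb)
      · exact Or.inr (h.det_pos (by omega) (by omega) hb)
    · have hc' : (c ≤ a ∨ b ≤ c) ∧ (d ≤ a ∨ b ≤ d) := by
        unfold Cr at hcr
        omega
      refine not_segCross_of_nonpos (h1.2 hc'.1) (h2.2 hc'.2) ?_ hs
      by_cases h3 : c < a ∨ b < c
      · exact Or.inl (h.det_neg hab h3 hb (by omega))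
      · exact Or.inr (h.det_neg hab (by omega) hb hd)
  · intro hcr
    have : (a < c ∧ c < b ∧ b < d) ∨ (c < a ∧ a < d ∧ d < b) := by
      unfold Cr at hcr
      omega
    rcases this with ⟨h1, h2, h3⟩ | ⟨h1, h2, h3⟩
    · exact segCross_of_det (h.det_pos h1 h2 hb) (h.det_neg hab (Or.inr h3) hb hd)
        (h.det_neg hcd (Or.inl h1) hd (by omega)) (h.det_pos h2 h3 hd)
    · rw [segCross_comm]
      exact segCross_of_det (h.det_pos h1 h2 hd) (h.det_neg hcd (Or.inr h3) hd hb)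
        (h.det_neg hab (Or.inl h1) hb (by omega)) (h.det_pos h2 h3 hb)

theorem CWNat.segCross_iff (h : CWNat N p) {a b c d : ℕ} (hab : a ≠ b) (hcd : c ≠ d)
    (ha : a < N) (hb : b < N) (hc : c < N) (hd : d < N) (h1 : ¬ (a = c ∧ b = d))
    (h2 : ¬ (a = d ∧ b = c)) :
    SegCross (p a, p b) (p c, p d) ↔ Cr a b c d := by
  rcases lt_or_gt_of_ne hab with h3 | h3 <;> rcases lt_or_gt_of_ne hcd with h4 | h4
  · exact h.segCross_iff_of_lt h3 h4 hb hd h1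
  · rw [segCross_comm, segCross_swap_left, segCross_comm, h.segCross_iff_of_lt h3 h4 hb hc h2]
    unfold Cr
    rw [min_comm c, max_comm c]
  · rw [segCross_swap_left, h.segCross_iff_of_lt h3 h4 ha hd (by omega)]
    unfold Cr
    rw [min_comm a, max_comm a]
  · rw [segCross_swap_left, segCross_comm, segCross_swap_left, segCross_comm,
      h.segCross_iff_of_lt h3 h4 ha hc (by omega)]
    unfold Cr
    rw [min_comm a, max_comm a, min_comm c, max_comm c]

end

theorem pathEdges_map (p : ℕ → Pt) (L : List ℕ) :
    pathEdges (L.map p) = (zE L).map (Prod.map p p) := by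
  unfold pathEdges zE
  rw [← List.map_tail, List.zip_map]

theorem two_mul_crossNum (es : List (Pt × Pt)) :
    2 * crossNum es = ∑ i ∈ Finset.range es.length, edgeCrossCount es i := by
  unfold crossNum edgeCrossCount
  set S : ℕ → ℕ → Prop := fun i j =>
    SegCross (es.getD i ((0, 0), (0, 0))) (es.getD j ((0, 0), (0, 0))) with hS
  have hsymm : ∀ i j, S i j ↔ S j i := fun i j => segCross_comm
  have h1 : ((Finset.range es.length ×ˢ Finset.range es.length).filter
      (fun ij : ℕ × ℕ => ij.1 < ij.2 ∧ S ij.1 ij.2)).card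
      = ∑ i ∈ Finset.range es.length, ∑ j ∈ Finset.range es.length,
        if i < j ∧ S i j then 1 else 0 := by
    rw [Finset.card_filter, Finset.sum_product]
  have h2 : ∑ i ∈ Finset.range es.length, ∑ j ∈ Finset.range es.length,
        (if i < j ∧ S i j then 1 else 0) = ∑ i ∈ Finset.range es.length,
          ∑ j ∈ Finset.range es.length, if j < i ∧ S i j then 1 else 0 := by
    rw [Finset.sum_comm]
    refine Finset.sum_congr rfl fun i _ => Finset.sum_congr rfl fun j _ => ?_
    rw [hsymm]
  rw [h1, two_mul]
  nth_rewrite 2 [h2]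
  rw [← Finset.sum_add_distrib]
  refine Finset.sum_congr rfl fun i _ => ?_
  rw [← Finset.sum_add_distrib, Finset.card_filter]
  refine Finset.sum_congr rfl fun j _ => ?_
  rcases lt_trichotomy i j with h | h | h
  · simp [h, h.ne', h.not_gt, hS]
  · simp [h]
  · simp [h, h.ne, h.not_gt, hS]

section

variable {N : ℕ} {p : ℕ → Pt} {col : ℕ → Bool} {b : Fin N} {L : List ℕ}

theorem AltList.edgeCrossCount_eq (h : AltList col N b L) (hp : CWNat N p) {i : ℕ}
    (hi : i + 1 < N) : edgeCrossCount (pathEdges (L.map p)) i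
      = xes ((zE L).getD i (0, 0)) (zE L) := by
  have hl := h.length_eq
  unfold edgeCrossCount
  rw [pathEdges_map, List.length_map, xes_eq_sum, Finset.card_filter]
  refine Finset.sum_congr rfl fun j hj => ?_
  rw [Finset.mem_range, length_zE, hl] at hj
  have hget : ∀ t, t + 1 < N → ((zE L).map (Prod.map p p)).getD t ((0, 0), (0, 0))
      = (p (L.getD t 0), p (L.getD (t + 1) 0)) := by
    intro t ht
    have h1 : t < (zE L).length := by rw [length_zE, hl]; omega
    have h2 := zE_getD L (i := t) (by omega)
    rw [List.getD_eq_getElem _ _ h1] at h2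
    rw [List.getD_eq_getElem _ _ (by simpa using h1), List.getElem_map, h2]
    rfl
  rw [hget i hi, hget j (by omega), zE_getD L (by omega : i + 1 < L.length),
    zE_getD L (by omega : j + 1 < L.length)]
  by_cases hij : j = i
  · subst hij
    simp [ic_self]
  · have inj : ∀ s t, s < N → t < N → L.getD s 0 = L.getD t 0 → s = t :=
      fun s t hs ht => h.getD_inj hs ht
    unfold ic
    congr 1
    rw [hp.segCross_iff]
    · simp [hij]
    · intro hh; have := inj _ _ (by omega) (by omega) hh; omega
    · intro hh; have := inj _ _ (by omega) (by omega) hh; omega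
    · exact h.getD_lt (by omega)
    · exact h.getD_lt (by omega)
    · exact h.getD_lt (by omega)
    · exact h.getD_lt (by omega)
    · rintro ⟨hh, -⟩; have := inj _ _ (by omega) (by omega) hh; omega
    · rintro ⟨hh, hh'⟩
      have := inj _ _ (by omega) (by omega) hh
      have := inj _ _ (by omega) (by omega) hh'
      omega

theorem AltList.crossNum_eq (h : AltList col N b L) (hp : CWNat N p) :
    crossNum (pathEdges (L.map p)) = ecr (pe L) := by
  have hl := h.length_eq
  have h1 := two_mul_crossNum (pathEdges (L.map p))
  have h2 := xee_self (zE L)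
  rw [xee_eq_sum] at h2
  rw [ecr_pe]
  suffices hh : ∑ i ∈ Finset.range (pathEdges (L.map p)).length,
      edgeCrossCount (pathEdges (L.map p)) i
      = ∑ i ∈ Finset.range (zE L).length, xes ((zE L).getD i (0, 0)) (zE L) by omega
  have hlen : (pathEdges (L.map p)).length = (zE L).length := by simp [pathEdges_map]
  rw [hlen]
  refine Finset.sum_congr rfl fun i hi => ?_
  rw [Finset.mem_range, length_zE, hl] at hi
  exact h.edgeCrossCount_eq hp (by omega)

end

/-- A clockwise listing of the bicolored point set `R ∪ B` by the naturals below `m`. -/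
structure Listing (R B : Finset Pt) (m : ℕ) (p : ℕ → Pt) : Prop where
  cw : CWNat m p
  inj : ∀ i j, i < m → j < m → p i = p j → i = j
  mem : ∀ v, v ∈ R ∪ B ↔ ∃ j < m, p j = v

/-- The color of a listed point, red being `true`. -/
def colOf (R : Finset Pt) (p : ℕ → Pt) (j : ℕ) : Bool := decide (p j ∈ R)

/-- The cyclic listing `pt`, started at position `s`. -/
def rot {m : ℕ} (hm : 0 < m) (pt : Fin m → Pt) (s j : ℕ) : Pt := pt ⟨(s + j) % m, Nat.mod_lt _ hm⟩

theorem det2_rotate (a b c : Pt) : det2 a b c = det2 b c a := by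
  simp only [det2]; ring

theorem CWList.listing {R B : Finset Pt} {m : ℕ} (hm : 0 < m) {pt : Fin m → Pt} (hcw : CWList pt)
    (hcover : Finset.univ.image pt = R ∪ B) {s : ℕ} (hs : s < m) :
    Listing R B m (rot hm pt s) := by
  have hmod : ∀ j, j < m → (s + j) % m = if s + j < m then s + j else s + j - m := by
    intro j hj
    split_ifs with h
    · exact Nat.mod_eq_of_lt h
    · rw [Nat.mod_eq_sub_mod (by omega), Nat.mod_eq_of_lt (by omega)]
  refine ⟨?_, ?_, ?_⟩
  · intro i j k hij hjk hk
    unfold rot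
    have h1 := hmod i (by omega)
    have h2 := hmod j (by omega)
    have h3 := hmod k hk
    by_cases c1 : s + i < m <;> by_cases c2 : s + j < m <;> by_cases c3 : s + k < m <;>
      simp only [c1, c2, c3, if_true, if_false] at h1 h2 h3 <;> first | omega | skip
    · exact hcw.2 _ _ _ (by rw [Fin.mk_lt_mk]; omega) (by rw [Fin.mk_lt_mk]; omega)
    · rw [← det2_rotate]
      exact hcw.2 _ _ _ (by rw [Fin.mk_lt_mk]; omega) (by rw [Fin.mk_lt_mk]; omega)
    · rw [det2_rotate]
      exact hcw.2 _ _ _ (by rw [Fin.mk_lt_mk]; omega) (by rw [Fin.mk_lt_mk]; omega)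
    · exact hcw.2 _ _ _ (by rw [Fin.mk_lt_mk]; omega) (by rw [Fin.mk_lt_mk]; omega)
  · intro i j hi hj h
    have := Fin.mk.inj_iff.1 (hcw.1 h)
    rw [hmod i hi, hmod j hj] at this
    split_ifs at this <;> omega
  · intro v
    rw [← hcover, Finset.mem_image]
    constructor
    · rintro ⟨i, -, rfl⟩
      have hi := i.2
      refine ⟨if s ≤ i then i - s else i + m - s, by split_ifs <;> omega, ?_⟩
      unfold rot
      congr 1
      ext
      simp only
      rw [hmod _ (by split_ifs <;> omega)]
      split_ifs <;> omega
    · rintro ⟨j, -, rfl⟩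
      exact ⟨_, Finset.mem_univ _, rfl⟩

theorem Listing.head_notMem_convexHull {R B : Finset Pt} {m : ℕ} {p : ℕ → Pt}
    (h : Listing R B m p) (hm : 3 ≤ m) :
    p 0 ∉ convexHull ℝ (((R ∪ B).erase (p 0) : Finset Pt) : Set Pt) := by
  intro hmem
  have hconv : Convex ℝ {x : Pt | 0 ≤ det2 (p 1) (p (m - 1)) x} := by
    intro x hx y hy a c ha hc hac
    simp only [Set.mem_ofPred_eq] at *
    rw [det2_affine _ _ _ _ hac]
    positivity
  have hsub : (((R ∪ B).erase (p 0) : Finset Pt) : Set Pt) ⊆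
      {x : Pt | 0 ≤ det2 (p 1) (p (m - 1)) x} := by
    intro x hx
    rw [Finset.mem_coe, Finset.mem_erase, h.mem] at hx
    obtain ⟨hx0, j, hj, rfl⟩ := hx
    rcases eq_or_ne j 0 with rfl | hj0
    · exact absurd rfl hx0
    rcases eq_or_ne j 1 with rfl | hj1
    · simp [det2_self_left]
    rcases eq_or_ne j (m - 1) with rfl | hj2
    · simp [det2_self_right]
    exact (h.cw.det_pos (by omega) (by omega) (by omega)).le
  have := convexHull_min hsub hconv hmem
  simp only [Set.mem_ofPred_eq] at this
  have := h.cw.det_neg (a := 1) (b := m - 1) (x := 0) (by omega) (by omega) (by omega) (by omega)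
  linarith

theorem CWList.hullPts_eq {R B : Finset Pt} {m : ℕ} (hm : 3 ≤ m) {pt : Fin m → Pt}
    (hcw : CWList pt) (hcover : Finset.univ.image pt = R ∪ B) : hullPts (R ∪ B) = R ∪ B := by
  unfold hullPts
  rw [Finset.filter_true_of_mem]
  intro v hv
  rw [← hcover, Finset.mem_image] at hv
  obtain ⟨i, -, rfl⟩ := hv
  have h0 : rot (by omega) pt i 0 = pt i := by
    unfold rot
    congr 1
    ext
    simp [Nat.mod_eq_of_lt i.2]
  have := (hcw.listing (by omega) hcover i.2).head_notMem_convexHull hm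
  rwa [h0] at this

theorem isChain_iff_zE {c : ℕ → Bool} (L : List ℕ) :
    L.IsChain (fun x y => c x ≠ c y) ↔ ∀ e ∈ zE L, c e.1 ≠ c e.2 := by
  induction L with
  | nil => simp [zE]
  | cons a L ih =>
    cases L with
    | nil => simp [zE]
    | cons d L =>
      have : zE (a :: d :: L) = (a, d) :: zE (d :: L) := rfl
      rw [List.isChain_cons_cons, ih, this, List.forall_mem_cons]

theorem mem_of_mem_zE {L : List ℕ} {e : ℕ × ℕ} (h : e ∈ zE L) : e.1 ∈ L ∧ e.2 ∈ L := by
  have := List.of_mem_zip (a := e.1) (b := e.2) h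
  exact ⟨this.1, List.mem_of_mem_tail this.2⟩

section

variable {R B : Finset Pt} {m : ℕ} {p : ℕ → Pt} {L : List ℕ} {b : ℕ}

theorem Listing.mem_B_iff (h : Listing R B m p) (hd : Disjoint R B) {j : ℕ} (hj : j < m) :
    p j ∈ B ↔ colOf R p j = false := by
  have h1 := (h.mem (p j)).2 ⟨j, hj, rfl⟩
  unfold colOf
  rw [decide_eq_false_iff_not]
  rw [Finset.mem_union] at h1
  constructor
  · intro h2 h3
    exact Finset.disjoint_left.1 hd h3 h2
  · intro h2
    exact h1.resolve_left h2

theorem mem_R_iff {j : ℕ} : p j ∈ R ↔ colOf R p j = true := by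
  unfold colOf
  rw [decide_eq_true_eq]

theorem Listing.bichromatic_iff (h : Listing R B m p) (hd : Disjoint R B) {i j : ℕ}
    (hi : i < m) (hj : j < m) :
    Bichromatic R B (p i, p j) ↔ colOf R p i ≠ colOf R p j := by
  unfold Bichromatic
  simp only [h.mem_B_iff hd hi, h.mem_B_iff hd hj, mem_R_iff]
  cases colOf R p i <;> cases colOf R p j <;> simp

/-- The Hamiltonian alternating path traced by an alternating list of positions. -/
def Listing.path (h : Listing R B m p) (hd : Disjoint R B) (hL : AltList (colOf R p) m b L) :
    HamAltPath R B (p 0) (p b) where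
  verts := L.map p
  nodup := by
    refine List.Nodup.map_on ?_ (hL.perm.nodup_iff.2 List.nodup_range)
    intro x hx y hy hxy
    rw [hL.perm.mem_iff, List.mem_range] at hx hy
    exact h.inj x y hx hy hxy
  cover := by
    ext v
    rw [List.mem_toFinset, h.mem, List.mem_map]
    simp only [hL.perm.mem_iff, List.mem_range]
  head_eq := by rw [List.head?_map, hL.head]; rfl
  last_eq := by rw [List.getLast?_map, hL.last]; rfl
  alt := by
    intro e he
    rw [pathEdges_map, List.mem_map] at he
    obtain ⟨f, hf, rfl⟩ := he
    have h1 := mem_of_mem_zE hf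
    rw [hL.perm.mem_iff, hL.perm.mem_iff, List.mem_range, List.mem_range] at h1
    exact (h.bichromatic_iff hd h1.1 h1.2).2 ((isChain_iff_zE L).1 hL.chain f hf)

theorem Listing.exists_altList (h : Listing R B m p) (hd : Disjoint R B) (hm : 0 < m) (hb : b < m)
    (P : HamAltPath R B (p 0) (p b)) :
    ∃ L, AltList (colOf R p) m b L ∧ P.verts = L.map p := by
  have hg : ∀ v, ∃ j, v ∈ R ∪ B → j < m ∧ p j = v := by
    intro v
    by_cases hv : v ∈ R ∪ B
    · obtain ⟨j, hj⟩ := (h.mem v).1 hv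
      exact ⟨j, fun _ => hj⟩
    · exact ⟨0, fun hv' => absurd hv' hv⟩
  choose g hg using hg
  have hmem : ∀ v, v ∈ P.verts ↔ v ∈ R ∪ B := fun v => by rw [← P.cover, List.mem_toFinset]
  have hgp : ∀ j, j < m → g (p j) = j := by
    intro j hj
    have := hg (p j) ((h.mem _).2 ⟨j, hj, rfl⟩)
    exact h.inj _ _ this.1 hj this.2
  have hmap : P.verts = (P.verts.map g).map p := by
    rw [List.map_map]
    conv_lhs => rw [← List.map_id P.verts]
    refine List.map_congr_left fun v hv => ?_
    exact ((hg v ((hmem v).1 hv)).2).symm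
  have hlt : ∀ x ∈ P.verts.map g, x < m := by
    intro x hx
    obtain ⟨v, hv, rfl⟩ := List.mem_map.1 hx
    exact (hg v ((hmem v).1 hv)).1
  refine ⟨P.verts.map g, ⟨?_, ?_, ?_, ?_⟩, hmap⟩
  · rw [List.perm_ext_iff_of_nodup _ List.nodup_range]
    · intro x
      rw [List.mem_range]
      refine ⟨hlt x, fun hx => ?_⟩
      rw [List.mem_map]
      exact ⟨p x, (hmem _).2 ((h.mem _).2 ⟨x, hx, rfl⟩), hgp x hx⟩
    · refine List.Nodup.of_map p ?_
      rw [← hmap]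
      exact P.nodup
  · rw [List.head?_map, P.head_eq, Option.map_some, hgp 0 hm]
  · rw [List.getLast?_map, P.last_eq, Option.map_some, hgp b hb]
  · rw [isChain_iff_zE]
    intro e he
    have h1 := mem_of_mem_zE he
    rw [← h.bichromatic_iff hd (hlt _ h1.1) (hlt _ h1.2)]
    refine P.alt _ ?_
    rw [hmap, pathEdges_map, List.mem_map]
    exact ⟨e, he, rfl⟩

end

theorem card_filter_le_eq_sum {K : ℕ} (c : ℕ → Bool) (e : Bool) (j : Fin K) :
    (Finset.univ.filter fun i : Fin K => i ≤ j ∧ c i = e).card =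
      ∑ i ∈ Finset.range ((j : ℕ) + 1), if c i = e then 1 else 0 := by
  rw [Finset.card_filter]
  have h1 := Fin.sum_univ_eq_sum_range (fun i : ℕ => if i ≤ (j : ℕ) ∧ c i = e then 1 else 0) K
  simp only [Fin.le_def]
  rw [h1]
  have hj := j.2
  rw [← Finset.sum_subset (Finset.range_subset_range.2 (show (j : ℕ) + 1 ≤ K by omega))]
  · refine Finset.sum_congr rfl fun i hi => ?_
    have : i ≤ (j : ℕ) := by rw [Finset.mem_range] at hi; omega
    simp [this]
  · intro i _ hi
    have : ¬ i ≤ (j : ℕ) := by rw [Finset.mem_range] at hi; omega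
    simp [this]

theorem height_eq_sub (c : ℕ → Bool) (t : ℕ) :
    height c t = ((∑ i ∈ Finset.range t, if c i = true then 1 else 0 : ℕ) : ℤ) -
      ((∑ i ∈ Finset.range t, if c i = false then 1 else 0 : ℕ) : ℤ) := by
  unfold height
  push_cast
  rw [← Finset.sum_sub_distrib]
  refine Finset.sum_congr rfl fun i _ => ?_
  cases c i <;> simp [sg]

theorem balancedAt_iff {R B : Finset Pt} {K : ℕ} {q : Fin K → Pt} {c : ℕ → Bool}
    (hR : ∀ i, q i ∈ R ↔ c i = true) (hB : ∀ i, q i ∈ B ↔ c i = false) (j : Fin K) :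
    BalancedAt R B q j ↔ 1 + height c ((j : ℕ) + 1) = 0 := by
  unfold BalancedAt
  simp only [hR, hB]
  rw [card_filter_le_eq_sum c true, card_filter_le_eq_sum c false, height_eq_sub]
  omega

theorem exists_firstBalanced {A C : Finset Pt} {K : ℕ} {q : Fin K → Pt} {j : Fin K}
    (h : BalancedAt A C q j) : ∃ i, FirstBalanced A C q i := by
  obtain ⟨i, hi, hmin⟩ := wellFounded_lt.has_min {i : Fin K | BalancedAt A C q i} ⟨j, h⟩
  exact ⟨i, hi, fun j' hj' hb => hmin j' hb hj'⟩

theorem height_tail {col : ℕ → Bool} (h0 : col 0 = true) (t : ℕ) :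
    1 + height (fun j : ℕ => col (j + 1)) t = height col (t + 1) := by
  unfold height
  rw [Finset.sum_range_succ', h0]
  simp only [sg, if_true]
  ring

theorem height_reverse (col : ℕ → Bool) {m t : ℕ} (ht : t ≤ m) :
    height (fun j : ℕ => col (m - 1 - j)) t + height col (m - t) = height col m := by
  induction t with
  | zero => simp [height]
  | succ t ih =>
    have h1 := ih (by omega)
    have h2 := height_succ col (m - (t + 1))
    rw [show m - (t + 1) + 1 = m - t by omega] at h2
    rw [height_succ, show m - 1 - t = m - (t + 1) by omega]
    linarith

namespace Listing

variable {R B : Finset Pt} {m k : ℕ} {p : ℕ → Pt}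

theorem image_erase_eq (h : Listing R B m p) (f : Fin (m - 1) → ℕ) (hf : ∀ i, 1 ≤ f i ∧ f i < m)
    (hsurj : ∀ j, 1 ≤ j → j < m → ∃ i, f i = j) :
    Finset.univ.image (fun i => p (f i)) = (R ∪ B).erase (p 0) := by
  ext v
  simp only [Finset.mem_image, Finset.mem_univ, true_and, Finset.mem_erase, h.mem]
  constructor
  · rintro ⟨i, rfl⟩
    refine ⟨fun hp => ?_, f i, (hf i).2, rfl⟩
    have := h.inj _ _ (hf i).2 (by have := (hf i).2; omega) hp
    have := (hf i).1
    omega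
  · rintro ⟨hv, j, hj, rfl⟩
    have : j ≠ 0 := by rintro rfl; exact hv rfl
    obtain ⟨i, rfl⟩ := hsurj j (by omega) hj
    exact ⟨i, rfl⟩

theorem cwOrder (h : Listing R B m p) :
    CWOrder (p 0) (fun i : Fin (m - 1) => p ((i : ℕ) + 1)) ((R ∪ B).erase (p 0)) := by
  refine ⟨?_, h.image_erase_eq (fun i : Fin (m - 1) => (i : ℕ) + 1)
    (fun i => by have := i.2; omega) (fun j h1 h2 => ⟨⟨j - 1, by omega⟩, by simp; omega⟩), ?_⟩
  · intro i j hij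
    have h1 := i.2
    have h2 := j.2
    have := h.inj _ _ (by omega) (by omega) hij
    exact Fin.ext (by omega)
  · intro i j hij
    have h2 := j.2
    rw [Fin.lt_def] at hij
    exact h.cw _ _ _ (by omega) (by omega) (by omega)

theorem ccwOrder (h : Listing R B m p) :
    CCWOrder (p 0) (fun i : Fin (m - 1) => p (m - 1 - (i : ℕ))) ((R ∪ B).erase (p 0)) := by
  refine ⟨?_, h.image_erase_eq (fun i : Fin (m - 1) => m - 1 - (i : ℕ))
    (fun i => by have := i.2; omega)
    (fun j h1 h2 => ⟨⟨m - 1 - j, by omega⟩, by simp; omega⟩), ?_⟩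
  · intro i j hij
    have h1 := i.2
    have h2 := j.2
    have := h.inj _ _ (by omega) (by omega) hij
    exact Fin.ext (by omega)
  · intro i j hij
    have h2 := j.2
    rw [Fin.lt_def] at hij
    have := h.cw 0 (m - 1 - (j : ℕ)) (m - 1 - (i : ℕ)) (by omega) (by omega) (by omega)
    have e : ∀ a b c : Pt, det2 a b c = - det2 a c b := by
      intro a b c
      simp only [det2]; ring
    rw [e]
    linarith

theorem card_eq_sum (h : Listing R B m p) {A : Finset Pt} {e : Bool} (hA : A ⊆ R ∪ B)
    (hmem : ∀ j < m, p j ∈ A ↔ colOf R p j = e) :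
    A.card = ∑ i ∈ Finset.range m, if colOf R p i = e then 1 else 0 := by
  rw [← Finset.card_filter]
  have : A = ((Finset.range m).filter (fun i : ℕ => colOf R p i = e)).image p := by
    ext v
    simp only [Finset.mem_image, Finset.mem_filter, Finset.mem_range]
    constructor
    · intro hv
      obtain ⟨j, hj, rfl⟩ := (h.mem v).1 (hA hv)
      exact ⟨j, ⟨hj, (hmem j hj).1 hv⟩, rfl⟩
    · rintro ⟨j, ⟨hj, hc⟩, rfl⟩
      exact (hmem j hj).2 hc
  conv_lhs => rw [this]
  refine Finset.card_image_of_injOn ?_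
  intro x hx y hy hxy
  simp only [Finset.coe_filter, Finset.mem_range] at hx hy
  exact h.inj x y hx.1 hy.1 hxy

theorem height_eq_zero (h : Listing R B m p) (hd : Disjoint R B) (hRB : R.card = B.card) :
    height (colOf R p) m = 0 := by
  rw [height_eq_sub, ← h.card_eq_sum Finset.subset_union_left (fun j _ => mem_R_iff),
    ← h.card_eq_sum Finset.subset_union_right (fun j hj => h.mem_B_iff hd hj), hRB, sub_self]

theorem isHullList (h : Listing R B m p) (h0 : p 0 ∈ hullPts (R ∪ B)) (hk : p k ∈ hullPts (R ∪ B))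
    (hk0 : k ≠ 0) (hkm : k < m) : IsHullList (R ∪ B) (fun i : Fin m => p i) := by
  have hcw : CWList (fun i : Fin m => p i) :=
    ⟨fun i j hij => Fin.ext (h.inj _ _ i.2 j.2 hij), fun i j l hij hjl => h.cw _ _ _ hij hjl l.2⟩
  have himg : Finset.univ.image (fun i : Fin m => p i) = R ∪ B := by
    ext v
    simp only [Finset.mem_image, Finset.mem_univ, true_and, h.mem]
    exact ⟨fun ⟨i, hi⟩ => ⟨i, i.2, hi⟩, fun ⟨j, hj, hv⟩ => ⟨⟨j, hj⟩, hv⟩⟩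
  refine ⟨hcw, ?_⟩
  by_cases hm : 3 ≤ m
  · rw [himg, hcw.hullPts_eq hm himg]
  · rw [himg]
    refine Finset.Subset.antisymm (fun v hv => ?_) (Finset.filter_subset _ _)
    obtain ⟨j, hj, rfl⟩ := (h.mem v).1 hv
    obtain rfl | rfl : j = 0 ∨ j = k := by omega
    · exact h0
    · exact hk

theorem spCfg (h : Listing R B m p) (hd : Disjoint R B) (hRB : R.card = B.card)
    (h0 : p 0 ∈ R) (hkm : k < m) (hk : p k ∈ B) (hsp : SpecialConfig R B (p 0) (p k)) :
    SpCfg (colOf R p) (⟨k, hkm⟩ : Fin m) ∧ p (m - 1) ∈ R := by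
  obtain ⟨hr, hb, hnb, hrad, -⟩ := hsp
  set col := colOf R p with hcol
  have c0 : col 0 = true := mem_R_iff.1 h0
  have ck : col k = false := (h.mem_B_iff hd hkm).1 hk
  have hk0 : k ≠ 0 := by rintro rfl; rw [c0] at ck; cases ck
  have hn := (hnb m (by omega) _ (h.isHullList hr hb hk0 hkm) ⟨0, by omega⟩).1 rfl
  simp only [cycPred, cycSucc, zero_add] at hn
  rw [Nat.mod_eq_of_lt (by omega), Nat.mod_eq_of_lt (by omega)] at hn
  have c1 : col 1 = true := mem_R_iff.1 hn.2
  have cm : col (m - 1) = true := mem_R_iff.1 hn.1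
  have hk1 : k ≠ 1 := by rintro rfl; rw [c1] at ck; cases ck
  have hk2 : k ≠ m - 1 := by rintro rfl; rw [cm] at ck; cases ck
  have htot := h.height_eq_zero hd hRB
  rw [← hcol] at htot
  have hcwb : ∀ j : Fin (m - 1), BalancedAt R B (fun i : Fin (m - 1) => p ((i : ℕ) + 1)) j ↔
      height col ((j : ℕ) + 2) = 0 := by
    intro j
    rw [balancedAt_iff (c := fun j : ℕ => col (j + 1)) (fun i => mem_R_iff)
      (fun i => h.mem_B_iff hd (by have := i.2; omega)), height_tail c0]
  have hccwb : ∀ j : Fin (m - 1), BalancedAt R B (fun i : Fin (m - 1) => p (m - 1 - (i : ℕ))) j ↔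
      height col (m - 1 - (j : ℕ)) = 1 := by
    intro j
    have hj := j.2
    rw [balancedAt_iff (c := fun j : ℕ => col (m - 1 - j)) (fun i => mem_R_iff)
      (fun i => h.mem_B_iff hd (by have := i.2; omega))]
    have := height_reverse col (m := m) (t := (j : ℕ) + 1) (by omega)
    rw [show m - ((j : ℕ) + 1) = m - 1 - (j : ℕ) by omega] at this
    constructor <;> intro <;> linarith
  have hone : height col 1 = 1 := by simp [height, c0, sg]
  obtain ⟨i, hi⟩ := exists_firstBalanced ((hcwb ⟨m - 2, by omega⟩).2 (by
    simp only; rw [show m - 2 + 2 = m by omega]; exact htot))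
  have hik := h.inj _ _ (by have := i.2; omega) hkm (hrad _ _ (Or.inr h.cwOrder) i hi)
  have hmid : height col (k + 1) = 0 := by
    have := (hcwb i).1 hi.1
    rwa [show (i : ℕ) + 2 = k + 1 by omega] at this
  have hlow : ∀ j, 1 ≤ j → j ≤ k → 1 ≤ height col j := by
    intro j h1
    induction j, h1 using Nat.le_induction with
    | base => intro _; rw [hone]
    | succ j h1 ih =>
      intro hj
      have h2 := ih (by omega)
      have h3 : height col (j + 1) ≠ 0 := by
        have := hi.2 ⟨j - 1, by have := i.2; omega⟩ (by rw [Fin.lt_def]; simp only; omega)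
        rw [hcwb] at this
        simp only at this
        rwa [show j - 1 + 2 = j + 1 by omega] at this
      rcases height_succ_ne (col := col) j with h4 | h4 <;> omega
  have hkone : height col k = 1 := by
    have := height_succ col k
    rw [hmid, ck] at this
    simp only [sg] at this
    norm_num at this
    linarith
  obtain ⟨l, hl⟩ := exists_firstBalanced ((hccwb ⟨m - 1 - k, by omega⟩).2 (by
    simp only; rw [show m - 1 - (m - 1 - k) = k by omega]; exact hkone))
  have hlk := h.inj _ _ (by omega) hkm (hrad _ _ (Or.inl h.ccwOrder) l hl)
  have hhigh : ∀ j, k < j → j ≤ m → height col j ≤ 0 := by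
    intro j h1
    induction j, h1 using Nat.le_induction with
    | base => intro _; rw [hmid]
    | succ j h1 ih =>
      intro hj
      have h2 := ih (by omega)
      rcases eq_or_ne (j + 1) m with h5 | h5
      · rw [h5, htot]
      have h3 : height col (j + 1) ≠ 1 := by
        have := hl.2 ⟨m - 1 - (j + 1), by omega⟩ (by rw [Fin.lt_def]; simp only; omega)
        rw [hccwb] at this
        simp only at this
        rwa [show m - 1 - (m - 1 - (j + 1)) = j + 1 by omega] at this
      rcases height_succ_ne (col := col) j with h4 | h4 <;> omega
  exact ⟨⟨by simp only; omega, by simp only; omega, c0, ck, hlow, hmid, hhigh, htot⟩, hn.1⟩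

end Listing

theorem two_mul_sum_ascents (c : ℕ → Bool) (n : ℕ) :
    2 * (∑ t ∈ Finset.range n, if c t = false ∧ c (t + 1) = true then 1 else 0) +
      (if c 0 = true then 1 else 0) =
    (∑ t ∈ Finset.range n, if c t = c (t + 1) then 0 else 1) + (if c n = true then 1 else 0) := by
  induction n with
  | zero => simp
  | succ n ih =>
    rw [Finset.sum_range_succ, Finset.sum_range_succ]
    cases h1 : c n <;> cases h2 : c (n + 1) <;> simp only [h1] at ih ⊢ <;> simp at ih ⊢ <;> omega

theorem linChg_eq_two_mul_runCount {R B : Finset Pt} {m : ℕ} (hm : 0 < m) {pt : Fin m → Pt}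
    {s : ℕ} (hs : s < m) (h : Listing R B m (rot hm pt s)) (hd : Disjoint R B)
    (h0 : rot hm pt s 0 ∈ R) (hlast : rot hm pt s (m - 1) ∈ R) (hB : ∃ i, pt i ∈ B) :
    linChg (colOf R (rot hm pt s)) m = 2 * runCount hm R B pt := by
  have key := two_mul_sum_ascents (colOf R (rot hm pt s)) (m - 1)
  rw [mem_R_iff.1 h0, mem_R_iff.1 hlast] at key
  have hrun : runCount hm R B pt = ∑ t ∈ Finset.range (m - 1),
      if colOf R (rot hm pt s) t = false ∧ colOf R (rot hm pt s) (t + 1) = true then 1 else 0 := by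
    obtain ⟨i₁, hi₁⟩ := hB
    unfold runCount
    rw [if_neg fun hall => Finset.disjoint_left.1 hd (hall i₁) hi₁, ← Finset.card_filter]
    symm
    refine Finset.card_bij (fun t _ => ⟨(s + (t + 1)) % m, Nat.mod_lt _ hm⟩) ?_ ?_ ?_
    · intro t ht
      rw [Finset.mem_filter, Finset.mem_range] at ht
      rw [Finset.mem_filter]
      refine ⟨Finset.mem_univ _, mem_R_iff.2 ht.2.2, ?_⟩
      have heq : cycPred hm ⟨(s + (t + 1)) % m, Nat.mod_lt _ hm⟩ = ⟨(s + t) % m, Nat.mod_lt _ hm⟩ := by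
        refine Fin.ext ?_
        simp only [cycPred]
        rw [Nat.mod_add_mod, show s + (t + 1) + (m - 1) = s + t + m by omega, Nat.add_mod_right]
      rw [heq]
      exact (h.mem_B_iff hd (by omega)).2 ht.2.1
    · intro t ht u hu htu
      rw [Finset.mem_filter, Finset.mem_range] at ht hu
      have := h.inj (t + 1) (u + 1) (by omega) (by omega) (by unfold rot; rw [htu])
      omega
    · intro i hi
      rw [Finset.mem_filter] at hi
      obtain ⟨-, hiR, hiB⟩ := hi
      have hi2 := i.2
      obtain ⟨t, ht, hit⟩ : ∃ t < m, (s + t) % m = (i : ℕ) := by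
        by_cases hsi : s ≤ i
        · exact ⟨i - s, by omega, by rw [show s + (i - s) = (i : ℕ) by omega, Nat.mod_eq_of_lt hi2]⟩
        · exact ⟨i + m - s, by omega, by
            rw [show s + (i + m - s) = (i : ℕ) + m by omega, Nat.add_mod_right,
              Nat.mod_eq_of_lt hi2]⟩
      have hpred : rot hm pt s (t + (m - 1)) ∈ B := by
        have heq : cycPred hm i = ⟨(s + (t + (m - 1))) % m, Nat.mod_lt _ hm⟩ := by
          refine Fin.ext ?_
          simp only [cycPred]
          rw [← hit, Nat.mod_add_mod, add_assoc]
        rwa [heq] at hiB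
      rcases t with _ | t
      · rw [zero_add] at hpred
        exact absurd hpred (Finset.disjoint_left.1 hd hlast)
      · have hpt : rot hm pt s t ∈ B := by
          have heq : rot hm pt s (t + 1 + (m - 1)) = rot hm pt s t := by
            unfold rot
            congr 2
            rw [show s + (t + 1 + (m - 1)) = s + t + m by omega, Nat.add_mod_right]
          rwa [heq] at hpred
        refine ⟨t, ?_, Fin.ext hit⟩
        rw [Finset.mem_filter, Finset.mem_range]
        refine ⟨by omega, (h.mem_B_iff hd (by omega)).1 hpt, mem_R_iff.1 ?_⟩
        have heq : i = ⟨(s + (t + 1)) % m, Nat.mod_lt _ hm⟩ := Fin.ext hit.symm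
        rwa [heq] at hiR
  rw [hrun]
  unfold linChg
  omega

/-- Corollary 3.12: let `S = R ∪ B` be in convex position (listed clockwise by `pt`) with
`|R| = |B| = n ≥ 1`, let `r ∈ R`, `b ∈ B`, and suppose `(S, r, b)` is a special
configuration.  Then every Hamiltonian alternating path on `S` with endpoints `r` and `b`
has at least `n − r(S)` crossings; there exists one with exactly `n − r(S)` crossings;
and every optimum such path has exactly `n − r(S)` crossings and all of its edges are
crossed at most once, except for exactly one edge that is crossed exactly twice. -/
theorem stmt16 (n : ℕ) (hn : 1 ≤ n) (R B : Finset Pt)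
    (hdisj : Disjoint R B)
    (hR : R.card = n) (hB : B.card = n)
    (m : ℕ) (hm : 0 < m) (pt : Fin m → Pt)
    (hcw : CWList pt) (hcover : Finset.univ.image pt = R ∪ B)
    (r b : Pt) (hr : r ∈ R) (hb : b ∈ B)
    (hsp : SpecialConfig R B r b) :
    (∀ P : HamAltPath R B r b,
      n - runCount hm R B pt ≤ crossNum (pathEdges P.verts)) ∧
    (∃ P : HamAltPath R B r b,
      crossNum (pathEdges P.verts) = n - runCount hm R B pt) ∧
    (∀ P : HamAltPath R B r b, OptimumPath R B r b P →
      crossNum (pathEdges P.verts) = n - runCount hm R B pt ∧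
      ∃ i ∈ Finset.range (pathEdges P.verts).length,
        edgeCrossCount (pathEdges P.verts) i = 2 ∧
        ∀ j ∈ Finset.range (pathEdges P.verts).length, j ≠ i →
          edgeCrossCount (pathEdges P.verts) j ≤ 1) := by
  have hmn : m = 2 * n := by
    have h1 := Finset.card_image_of_injective Finset.univ hcw.1
    rw [hcover, Finset.card_union_of_disjoint hdisj, Finset.card_univ, Fintype.card_fin] at h1
    omega
  obtain ⟨s, -, hs⟩ := Finset.mem_image.1 (hcover ▸ Finset.mem_union_left B hr)
  obtain ⟨i₁, -, hi₁⟩ := Finset.mem_image.1 (hcover ▸ Finset.mem_union_right R hb)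
  have hlist := hcw.listing hm hcover s.2
  obtain ⟨k, hkm, hk⟩ := (hlist.mem b).1 (Finset.mem_union_right R hb)
  have hp0 : rot hm pt s 0 = r := by
    rw [← hs]
    unfold rot
    congr 1
    exact Fin.ext (by simp [Nat.mod_eq_of_lt s.2])
  have hBex : ∃ i, pt i ∈ B := ⟨i₁, hi₁ ▸ hb⟩
  clear hs hi₁
  subst hp0 hk
  obtain ⟨hcfg, hlast⟩ := hlist.spCfg hdisj (hR.trans hB.symm) hr hkm hb hsp
  have hruns := linChg_eq_two_mul_runCount hm s.2 hlist hdisj hr hlast hBex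
  obtain ⟨L, hL, hLle⟩ := hcfg.exists_altList
  have hlow : ∀ P : HamAltPath R B (rot hm pt s 0) (rot hm pt s k),
      n - runCount hm R B pt ≤ crossNum (pathEdges P.verts) := by
    intro P
    obtain ⟨L', hL', hP⟩ := hlist.exists_altList hdisj hm hkm P
    rw [hP, AltList.crossNum_eq (b := ⟨k, hkm⟩) hL' hlist.cw]
    have := AltList.le_ecr hcfg hL'
    omega
  have hex : crossNum (pathEdges (hlist.path hdisj hL).verts) ≤ n - runCount hm R B pt := by
    have h1 : crossNum (pathEdges (hlist.path hdisj hL).verts) = ecr (pe L) :=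
      AltList.crossNum_eq hL hlist.cw
    omega
  refine ⟨hlow, ⟨hlist.path hdisj hL, le_antisymm hex (hlow _)⟩, fun P hP => ?_⟩
  have hPeq := le_antisymm ((hP _).trans hex) (hlow P)
  refine ⟨hPeq, ?_⟩
  obtain ⟨L', hL', hPL⟩ := hlist.exists_altList hdisj hm hkm P
  have hcross := AltList.crossNum_eq (b := ⟨k, hkm⟩) hL' hlist.cw
  rw [hPL] at hPeq ⊢
  have hge := AltList.le_ecr hcfg hL'
  obtain ⟨i, hi, hi2, hi1⟩ := AltList.crossing_distribution hcfg hL' (by omega)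
  have hlen : (pathEdges (L'.map (rot hm pt s))).length = m - 1 := by
    rw [pathEdges_map, List.length_map, length_zE, AltList.length_eq (b := ⟨k, hkm⟩) hL']
  rw [hlen]
  refine ⟨i, Finset.mem_range.2 (by omega), ?_, fun j hj hji => ?_⟩
  · rw [AltList.edgeCrossCount_eq (b := ⟨k, hkm⟩) hL' hlist.cw hi, hi2]
  · rw [Finset.mem_range] at hj
    rw [AltList.edgeCrossCount_eq (b := ⟨k, hkm⟩) hL' hlist.cw (by omega)]
    exact hi1 j (by omega) hji

end
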